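/- Fix integers k ∈ {2, 3} and d > k. There exist constants C > 0 and Ω > 0 such that for every integer N ≥ 2, the number of polynomials p ∈ P_d(N) whose Galois group is not k-homogeneous of degree d — that is, for which it is not the case that p has d distinct complex roots and for any two subsets S, T of rootSet of cardinality k there exists g ∈ Gal(p) with (galActionHom g) '' S = T — is at most C · N^{d-1} · (log N)^Ω. -/

import Mathlib

section ModA1
open Polynomial

/-- logarithmic weight -/
noncomputable def Lg (N : ℕ) : ℝ := 1 + Real.log N

lemma Lg_one_le (N : ℕ) : 1 ≤ Lg N := by
  unfold Lg
  have : 0 ≤ Real.log N := Real.log_natCast_nonneg N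
  linarith

lemma Lg_pow_mono (N : ℕ) {a b : ℕ} (h : a ≤ b) : Lg N ^ a ≤ Lg N ^ b :=
  pow_le_pow_right₀ (Lg_one_le N) h

lemma Lg_mono {M N : ℕ} (h1 : 1 ≤ M) (h : M ≤ N) : Lg M ≤ Lg N := by
  unfold Lg
  have : Real.log M ≤ Real.log N := Real.log_le_log (by exact_mod_cast h1) (by exact_mod_cast h)
  linarith

lemma Lg_mul_le (c N : ℕ) (hc : 1 ≤ c) (hN : 1 ≤ N) : Lg (c * N) ≤ Lg c * Lg N := by
  unfold Lg
  push_cast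
  rw [Real.log_mul (by positivity) (by positivity)]
  have h1 : 0 ≤ Real.log c := Real.log_natCast_nonneg c
  have h2 : 0 ≤ Real.log N := Real.log_natCast_nonneg N
  nlinarith [mul_nonneg h1 h2]

lemma Lg_pow_le (N k : ℕ) (hk : 1 ≤ k) : Lg (N ^ k) ≤ k * Lg N := by
  unfold Lg
  push_cast
  rw [Real.log_pow]
  have h2 : 0 ≤ Real.log N := Real.log_natCast_nonneg N
  have : (1:ℝ) ≤ k := by exact_mod_cast hk
  nlinarith

lemma natlog_le_Lg (N : ℕ) : ((Nat.log 2 N + 1 : ℕ) : ℝ) ≤ 2 * Lg N := by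
  unfold Lg
  rcases Nat.eq_zero_or_pos N with rfl | hN
  · simp
  have h : ((2:ℝ) ^ Nat.log 2 N) ≤ N := by exact_mod_cast Nat.pow_log_le_self 2 hN.ne'
  have h1 := Real.log_le_log (by positivity) h
  rw [Real.log_pow] at h1
  have h2 : (0.6931471803 : ℝ) < Real.log 2 := Real.log_two_gt_d9
  have h3 : (0:ℝ) ≤ Nat.log 2 N := by positivity
  push_cast
  nlinarith

/-- number of polynomials with weighted coefficient bounds -/
def WBox (n : ℕ) (B : ℕ → ℕ) : Set ℤ[X] :=
  {p | p.Monic ∧ p.natDegree = n ∧ ∀ i < n, |p.coeff i| ≤ (B i : ℤ)}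

/-- box -/
def PBox (n N : ℕ) : Set ℤ[X] := {p | p.Monic ∧ p.natDegree = n ∧ ∀ i < n, |p.coeff i| ≤ (N : ℤ)}

lemma PBox_eq (n N : ℕ) : PBox n N = WBox n (fun _ => N) := rfl

lemma coeffs_inj {n : ℕ} {p q : ℤ[X]} (hp : p.Monic) (hq : q.Monic) (hpn : p.natDegree = n)
    (hqn : q.natDegree = n) (h : ∀ i < n, p.coeff i = q.coeff i) : p = q := by
  ext i
  rcases lt_trichotomy i n with hi | hi | hi
  · exact h i hi
  · subst hi
    have h1 := hp.coeff_natDegree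
    have h2 := hq.coeff_natDegree
    rw [hpn] at h1; rw [hqn] at h2; rw [h1, h2]
  · rw [coeff_eq_zero_of_natDegree_lt (by omega), coeff_eq_zero_of_natDegree_lt (by omega)]

lemma WBox_finite_card (n : ℕ) (B : ℕ → ℕ) :
    (WBox n B).Finite ∧ (WBox n B).ncard ≤ ∏ i ∈ Finset.range n, (2 * B i + 1) := by
  classical
  let T : Finset (Fin n → ℤ) := Fintype.piFinset (fun i : Fin n => Finset.Icc (-(B i : ℤ)) (B i))
  let φ : ℤ[X] → (Fin n → ℤ) := fun p i => p.coeff i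
  have hmap : Set.MapsTo φ (WBox n B) (T : Set (Fin n → ℤ)) := by
    intro p hp
    simp only [T, Finset.mem_coe, Fintype.mem_piFinset, Finset.mem_Icc, φ]
    intro i
    exact abs_le.mp (hp.2.2 i i.2)
  have hinj : Set.InjOn φ (WBox n B) := by
    intro p hp q hq h
    refine coeffs_inj hp.1 hq.1 hp.2.1 hq.2.1 (fun i hi => ?_)
    exact congrFun h ⟨i, hi⟩
  refine ⟨Set.Finite.of_injOn hmap hinj T.finite_toSet, ?_⟩
  refine (Set.ncard_le_ncard_of_injOn φ hmap hinj T.finite_toSet).trans ?_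
  rw [Set.ncard_coe_finset, Fintype.card_piFinset, ← Fin.prod_univ_eq_prod_range (fun i => 2 * B i + 1)]
  refine Finset.prod_le_prod' (fun i _ => ?_)
  simp only [Int.card_Icc]
  omega

lemma PBox_finite (n N : ℕ) : (PBox n N).Finite := (WBox_finite_card n _).1

lemma PBox_card (n N : ℕ) : (PBox n N).ncard ≤ (2 * N + 1) ^ n := by
  rw [PBox_eq]; simpa using (WBox_finite_card n (fun _ => N)).2

/-- small families of subsets of `PBox n N` -/
def SmallP (n : ℕ) (S : ℕ → Set ℤ[X]) : Prop :=
  ∃ C : ℝ, 0 < C ∧ ∃ Ω : ℕ, ∀ N : ℕ, 2 ≤ N →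
    (S N).Finite ∧ ((S N).ncard : ℝ) ≤ C * (N : ℝ) ^ (n - 1) * Lg N ^ Ω

lemma SmallP.mono {n : ℕ} {S T : ℕ → Set ℤ[X]} (hT : SmallP n T) (h : ∀ N, 2 ≤ N → S N ⊆ T N) :
    SmallP n S := by
  obtain ⟨C, hC, Ω, H⟩ := hT
  refine ⟨C, hC, Ω, fun N hN => ?_⟩
  obtain ⟨h1, h2⟩ := H N hN
  refine ⟨h1.subset (h N hN), le_trans ?_ h2⟩
  exact_mod_cast Set.ncard_le_ncard (h N hN) h1

lemma SmallP.union {n : ℕ} {S T : ℕ → Set ℤ[X]} (hS : SmallP n S) (hT : SmallP n T) :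
    SmallP n (fun N => S N ∪ T N) := by
  obtain ⟨C, hC, Ω, H⟩ := hS
  obtain ⟨C', hC', Ω', H'⟩ := hT
  refine ⟨C + C', by positivity, Ω + Ω', fun N hN => ?_⟩
  obtain ⟨h1, h2⟩ := H N hN
  obtain ⟨h1', h2'⟩ := H' N hN
  refine ⟨h1.union h1', ?_⟩
  have h3 : ((S N ∪ T N).ncard : ℝ) ≤ (S N).ncard + (T N).ncard := by
    exact_mod_cast Set.ncard_union_le _ _
  have e1 := Lg_pow_mono N (show Ω ≤ Ω + Ω' by omega)
  have e2 := Lg_pow_mono N (show Ω' ≤ Ω + Ω' by omega)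
  calc _ ≤ _ := h3
    _ ≤ C * (N : ℝ) ^ (n - 1) * Lg N ^ Ω + C' * (N : ℝ) ^ (n - 1) * Lg N ^ Ω' := by linarith
    _ ≤ C * (N : ℝ) ^ (n - 1) * Lg N ^ (Ω+Ω') + C' * (N : ℝ) ^ (n - 1) * Lg N ^ (Ω+Ω') := by
        gcongr
    _ = _ := by ring

lemma SmallP.biUnion {n : ℕ} {ι : Type*} (s : Finset ι) {S : ι → ℕ → Set ℤ[X]}
    (h : ∀ i ∈ s, SmallP n (S i)) : SmallP n (fun N => ⋃ i ∈ s, S i N) := by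
  classical
  induction s using Finset.induction_on with
  | empty =>
    refine ⟨1, one_pos, 0, fun N _ => ?_⟩
    simp
  | insert a s ha ih =>
    have h1 := (h a (by simp)).union (ih (fun i hi => h i (by simp [hi])))
    simpa using h1

lemma SmallP.to_log {n : ℕ} {S : ℕ → Set ℤ[X]} (hS : SmallP n S) :
    ∃ C : ℝ, 0 < C ∧ ∃ Ω : ℕ, 0 < Ω ∧ ∀ N : ℕ, 2 ≤ N →
      ((S N).ncard : ℝ) ≤ C * (N : ℝ) ^ (n - 1) * Real.log N ^ Ω := by
  obtain ⟨C, hC, Ω, H⟩ := hS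
  refine ⟨C * 3 ^ (Ω+1), by positivity, Ω + 1, by omega, fun N hN => ?_⟩
  obtain ⟨h1, h2⟩ := H N hN
  have h3 : Lg N ≤ 3 * Real.log N := by
    have : Real.log 2 ≤ Real.log N := Real.log_le_log (by norm_num) (by exact_mod_cast hN)
    have h2 : (0.6931471803 : ℝ) < Real.log 2 := Real.log_two_gt_d9
    unfold Lg; linarith
  have h4 : Lg N ^ Ω ≤ (3 * Real.log N) ^ (Ω + 1) :=
    (Lg_pow_mono N (by omega)).trans
      (pow_le_pow_left₀ (by linarith [Lg_one_le N]) h3 _)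
  calc _ ≤ _ := h2
    _ ≤ C * (N : ℝ) ^ (n - 1) * (3 * Real.log N) ^ (Ω + 1) := by gcongr
    _ = _ := by rw [mul_pow]; ring

/-- complex Mahler measure of an integer polynomial -/
noncomputable def MM (p : ℤ[X]) : ℝ := (p.map (Int.castRingHom ℂ)).mahlerMeasure

lemma MM_le {n N : ℕ} (hN : 1 ≤ N) {p : ℤ[X]} (hp : p ∈ PBox n N) : MM p ≤ (n + 1) * N := by
  unfold MM
  refine (mahlerMeasure_le_sum_norm_coeff _).trans ?_
  rw [Polynomial.sum_over_range' _ (by simp) (n+1)]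
  swap
  · rw [natDegree_map_eq_of_injective (Int.cast_injective), hp.2.1]; omega
  have : ∀ i ∈ Finset.range (n+1), ‖(p.map (Int.castRingHom ℂ)).coeff i‖ ≤ (N:ℝ) := by
    intro i hi
    rw [coeff_map]
    simp only [eq_intCast, Complex.norm_intCast]
    rcases Nat.lt_or_ge i n with h | h
    · exact_mod_cast hp.2.2 i h
    · have : i = n := by simp at hi; omega
      subst this
      have h1 := hp.1.coeff_natDegree
      rw [hp.2.1] at h1; rw [h1]; simpa using hN
  refine (Finset.sum_le_sum this).trans ?_
  simp

lemma coeff_le_MM (p : ℤ[X]) (i : ℕ) : (|p.coeff i| : ℝ) ≤ 2 ^ p.natDegree * MM p := by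
  have h := norm_coeff_le_choose_mul_mahlerMeasure i (p.map (Int.castRingHom ℂ))
  rw [natDegree_map_eq_of_injective (Int.cast_injective), coeff_map] at h
  simp only [eq_intCast, Complex.norm_intCast] at h
  refine h.trans ?_
  have : ((p.natDegree.choose i : ℕ) : ℝ) ≤ 2 ^ p.natDegree := by
    exact_mod_cast Nat.choose_le_two_pow _ _
  have h0 : 0 ≤ MM p := mahlerMeasure_nonneg _
  unfold MM at *
  gcongr

lemma MM_mul (p q : ℤ[X]) : MM (p * q) = MM p * MM q := by
  unfold MM; rw [Polynomial.map_mul, mahlerMeasure_mul]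

lemma MM_one_le {p : ℤ[X]} (hp : p.Monic) : 1 ≤ MM p := by
  unfold MM
  apply one_le_mahlerMeasure_of_one_le_norm_leadingCoeff
  rw [(hp.map _).leadingCoeff]; simp

lemma MM_eq {p : ℤ[X]} (hp : p.Monic) :
    MM p = ((p.map (Int.castRingHom ℂ)).roots.map (fun a => max 1 ‖a‖)).prod := by
  unfold MM
  rw [mahlerMeasure_eq_leadingCoeff_mul_prod_roots, (hp.map _).leadingCoeff]; simp
end ModA1

section ModR
open Polynomial

lemma coeff_mem_box {p : ℤ[X]} (hp : p.Monic) {n B : ℕ} (hn : p.natDegree ≤ n) {X : ℝ}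
    (hX : MM p ≤ X) (hB : (2:ℝ) ^ n * X < B + 1) : p ∈ PBox p.natDegree B := by
  refine ⟨hp, rfl, fun i _ => ?_⟩
  have h := coeff_le_MM p i
  have h0 : 0 ≤ MM p := by linarith [MM_one_le hp]
  have h1 : (|p.coeff i| : ℝ) < B + 1 := by
    refine lt_of_le_of_lt (h.trans ?_) hB
    have : (2:ℝ) ^ p.natDegree ≤ 2 ^ n := pow_le_pow_right₀ (by norm_num) hn
    gcongr
  have h2 : |p.coeff i| < (B:ℤ) + 1 := by exact_mod_cast h1
  omega

lemma red_small (n : ℕ) : SmallP n (fun N => {p | p ∈ PBox n N ∧ ¬ Irreducible p}) := by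
  classical
  rcases Nat.eq_zero_or_pos n with rfl | hn
  · refine ⟨1, one_pos, 0, fun N hN => ⟨(PBox_finite 0 N).subset (fun p hp => hp.1), ?_⟩⟩
    have h1 : {p | p ∈ PBox 0 N ∧ ¬ Irreducible p}.ncard ≤ 1 :=
      (Set.ncard_le_ncard (fun p hp => hp.1) (PBox_finite 0 N)).trans (by simpa using PBox_card 0 N)
    simp
    exact_mod_cast h1
  have key : SmallP n (fun N => ⋃ e ∈ Finset.Ico 1 n,
      {p | p ∈ PBox n N ∧ ∃ g h : ℤ[X], g.Monic ∧ h.Monic ∧ g.natDegree = e ∧ p = g * h}) := by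
    apply SmallP.biUnion
    intro e he
    simp only [Finset.mem_Ico] at he
    set A : ℕ := 2 ^ n with hA
    have hA1 : (1:ℝ) ≤ A := by rw [hA]; exact_mod_cast Nat.one_le_two_pow
    refine ⟨(5 * A) ^ n * (n + 1) ^ (n - 1) * (2 * Lg (n + 1)), ?_, 1, fun N hN => ?_⟩
    · have := Lg_one_le (n+1); positivity
    set L := Nat.log 2 ((n + 1) * N) + 1 with hL
    let U : ℕ → Set ℤ[X] := fun i =>
      (fun x : ℤ[X] × ℤ[X] => x.1 * x.2) ''
        ((PBox e (2 * A * 2 ^ i)) ×ˢ (PBox (n - e) (⌊(A:ℝ) * ((n + 1) * N / 2 ^ i)⌋₊)))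
    have hsub : {p | p ∈ PBox n N ∧ ∃ g h : ℤ[X], g.Monic ∧ h.Monic ∧ g.natDegree = e ∧ p = g * h}
        ⊆ ⋃ i ∈ Finset.range L, U i := by
      rintro p ⟨hp, g, h, hg, hh, hge, rfl⟩
      have hM := MM_le (by omega) hp
      rw [MM_mul] at hM
      have g1 := MM_one_le hg
      have h1 := MM_one_le hh
      have hdeg : h.natDegree = n - e := by
        have := hp.2.1; rw [hg.natDegree_mul hh] at this; omega
      set m := ⌊MM g⌋₊ with hm
      have hm1 : 1 ≤ m := Nat.le_floor (by simpa using g1)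
      set i := Nat.log 2 m with hi
      have hi1 : (2:ℝ) ^ i ≤ MM g := by
        refine le_trans ?_ (Nat.floor_le (by linarith))
        exact_mod_cast Nat.pow_log_le_self 2 (by omega)
      have hi2 : MM g < 2 * 2 ^ i := by
        have : m < 2 ^ (i + 1) := Nat.lt_pow_succ_log_self (by norm_num) m
        have h3 : (m:ℝ) + 1 ≤ 2 ^ (i+1) := by exact_mod_cast this
        have := Nat.lt_floor_add_one (MM g)
        rw [← hm] at this
        rw [pow_succ] at h3; linarith
      have hiL : i < L := by
        rw [hL, Nat.lt_add_one_iff, hi]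
        apply Nat.log_mono_right
        have : (m:ℝ) ≤ ((n + 1) * N : ℕ) := by
          refine (Nat.floor_le (by linarith)).trans ?_
          push_cast
          nlinarith
        exact_mod_cast this
      have hh2 : MM h ≤ (n + 1) * N / 2 ^ i := by
        rw [le_div_iff₀ (by positivity)]
        nlinarith
      simp only [Set.mem_iUnion, Finset.mem_range]
      refine ⟨i, hiL, ⟨(g, h), ⟨?_, ?_⟩, rfl⟩⟩
      · simp only [← hge]
        refine coeff_mem_box hg (n := n) (by omega) hi2.le ?_
        push_cast [hA]
        linarith
      · simp only [← hdeg]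
        refine coeff_mem_box hh (n := n) (by omega) hh2 ?_
        have := Nat.lt_floor_add_one ((A:ℝ) * ((n + 1) * N / 2 ^ i))
        push_cast [hA] at this ⊢
        exact this
    have hUfin : ∀ i, (U i).Finite := fun i =>
      Set.Finite.image _ ((PBox_finite _ _).prod (PBox_finite _ _))
    have hfin : (⋃ i ∈ Finset.range L, U i).Finite :=
      Set.Finite.biUnion (Finset.range L).finite_toSet (fun i _ => hUfin i)
    have hcard : ∀ i ∈ Finset.range L, ((U i).ncard : ℝ) ≤ (5 * A) ^ n * ((n+1) * N) ^ (n - 1) := by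
      intro i hi
      have h1 : (U i).ncard ≤ (2 * (2 * A * 2 ^ i) + 1) ^ e *
          (2 * ⌊(A:ℝ) * ((n + 1) * N / 2 ^ i)⌋₊ + 1) ^ (n - e) := by
        refine (Set.ncard_image_le ((PBox_finite _ _).prod (PBox_finite _ _))).trans ?_
        rw [Set.ncard_prod]
        exact Nat.mul_le_mul (PBox_card _ _) (PBox_card _ _)
      have h1' : ((U i).ncard:ℝ) ≤ (2 * (2 * A * 2 ^ i) + 1) ^ e *
          (2 * (⌊(A:ℝ) * ((n + 1) * N / 2 ^ i)⌋₊ : ℝ) + 1) ^ (n - e) := by exact_mod_cast h1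
      set x : ℝ := 2 ^ i with hx
      have hx1 : 1 ≤ x := one_le_pow₀ (by norm_num)
      set y : ℝ := (n + 1) * N / 2 ^ i with hy
      have hy1 : 1 ≤ y := by
        rw [hy, le_div_iff₀ (by positivity), one_mul]
        have h5 : 2 ^ i ≤ (n + 1) * N := by
          refine le_trans (Nat.pow_le_pow_right (by norm_num) (Nat.lt_add_one_iff.mp (Finset.mem_range.mp hi)))
            (Nat.pow_log_le_self 2 (by positivity))
        exact_mod_cast h5
      have hxy : x * y = (n + 1) * N := by rw [hx, hy]; field_simp
      have hfl : (⌊(A:ℝ) * y⌋₊ : ℝ) ≤ A * y := Nat.floor_le (by positivity)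
      have hAx : 1 ≤ A * x := by nlinarith
      have hAy : 1 ≤ A * y := by nlinarith
      calc ((U i).ncard:ℝ) ≤ _ := h1'
        _ ≤ (5 * A * x) ^ e * (5 * A * y) ^ (n - e) := by
            gcongr
            · nlinarith
            · nlinarith
        _ = (5 * A) ^ (e + (n - e)) * (x ^ e * y ^ (n - e)) := by
            rw [mul_pow, mul_pow (5 * (A:ℝ)) y, pow_add]; ring
        _ ≤ (5 * A) ^ n * (x ^ (n - 1) * y ^ (n - 1)) := by
            rw [show e + (n - e) = n by omega]
            gcongr <;> omega
        _ = _ := by rw [← mul_pow, hxy]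
    refine ⟨hfin.subset hsub, ?_⟩
    have h3 : (⋃ i ∈ Finset.range L, U i).ncard ≤ ∑ i ∈ Finset.range L, (U i).ncard :=
      Finset.set_ncard_biUnion_le _ _
    have h4 : ({p | p ∈ PBox n N ∧ ∃ g h : ℤ[X], g.Monic ∧ h.Monic ∧ g.natDegree = e ∧
        p = g * h}.ncard : ℝ) ≤ ∑ i ∈ Finset.range L, ((U i).ncard : ℝ) := by
      exact_mod_cast (Set.ncard_le_ncard hsub hfin).trans h3
    have hLL : (L:ℝ) ≤ 2 * (Lg (n+1) * Lg N) :=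
      (natlog_le_Lg _).trans (by
        have := Lg_mul_le (n+1) N (by omega) (by omega)
        linarith)
    calc _ ≤ _ := h4
      _ ≤ L * ((5 * A) ^ n * ((n+1) * N) ^ (n - 1)) := by
          refine (Finset.sum_le_sum hcard).trans ?_
          simp
      _ ≤ 2 * (Lg (n+1) * Lg N) * ((5 * A) ^ n * ((n+1) * N) ^ (n - 1)) := by gcongr
      _ = _ := by rw [mul_pow ((n:ℝ) + 1) N]; ring
  refine key.mono (fun N hN p hp => ?_)
  obtain ⟨hp, hirr⟩ := hp
  have hne : p ≠ 1 := by
    rintro rfl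
    have := hp.2.1
    simp at this; omega
  rw [hp.1.irreducible_iff_natDegree' ] at hirr
  push Not at hirr
  obtain ⟨f, g, hf, hg, rfl, hmem⟩ := hirr hne
  simp only [Finset.mem_Ioc] at hmem
  have h2 := hp.2.1
  rw [hf.natDegree_mul hg] at h2 hmem
  simp only [Set.mem_iUnion, Finset.mem_Ico]
  exact ⟨g.natDegree, ⟨by omega, by omega⟩, hp, g, f, hg, hf, rfl, mul_comm _ _⟩
end ModR

section ModL1
open Polynomial NumberField

noncomputable section

lemma prod_emb_eq_prod_place (K : Type*) [Field K] [NumberField K] (g : InfinitePlace K → ℝ) :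
    ∏ φ : K →+* ℂ, g (InfinitePlace.mk φ) = ∏ v : InfinitePlace K, g v ^ v.mult := by
  classical
  rw [← Finset.prod_fiberwise_of_maps_to (g := InfinitePlace.mk) (t := Finset.univ) (by simp)]
  refine Finset.prod_congr rfl (fun v _ => ?_)
  rw [Finset.prod_congr rfl (g := fun _ => g v)]
  · rw [Finset.prod_const, InfinitePlace.card_filter_mk_eq]
  · intro φ hφ
    simp at hφ
    rw [hφ]

/-- height on a number field -/
def Ht {K : Type*} [Field K] [NumberField K] (x : K) : ℝ := ∏ φ : K →+* ℂ, max 1 ‖φ x‖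

lemma Ht_eq {K : Type*} [Field K] [NumberField K] (x : K) :
    Ht x = ∏ v : InfinitePlace K, (max 1 (v x)) ^ v.mult := by
  rw [← prod_emb_eq_prod_place K (fun v => max 1 (v x))]
  rfl

lemma ring_eq_of_close {K : Type*} [Field K] [NumberField K] (x y : 𝓞 K)
    (h : ∀ v : InfinitePlace K, v ((x : K) - y) < 1) : x = y := by
  by_contra hne
  have h0 : x - y ≠ 0 := sub_ne_zero.mpr hne
  obtain ⟨w⟩ : Nonempty (InfinitePlace K) := inferInstance
  have h1 := InfinitePlace.one_le_of_lt_one (w := w) h0 (fun z _ => by simpa using h z)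
  have h2 := h w
  simp only [map_sub] at h1
  linarith

lemma floor_close {a b : ℝ} (h : ⌊2 * a⌋ = ⌊2 * b⌋) : |a - b| < 1 / 2 := by
  have := Int.abs_sub_lt_one_of_floor_eq_floor h
  rw [← mul_sub, abs_mul] at this
  simp at this
  linarith

lemma norm_lt_one_of_cell {z w : ℂ} (h1 : ⌊2 * z.re⌋ = ⌊2 * w.re⌋) (h2 : ⌊2 * z.im⌋ = ⌊2 * w.im⌋) :
    ‖z - w‖ < 1 := by
  have a := floor_close h1
  have b := floor_close h2
  calc ‖z - w‖ ≤ |(z - w).re| + |(z - w).im| := Complex.norm_le_abs_re_add_abs_im _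
    _ < 1 := by simp; linarith

lemma cell_card (k : ℕ) : (Finset.Icc (-(4 * 2 ^ k : ℤ)) (4 * 2 ^ k)).card ≤ 10 * 2 ^ k := by
  simp only [Int.card_Icc]
  have : 1 ≤ 2 ^ k := Nat.one_le_two_pow
  zify at *
  rw [Int.toNat_of_nonneg (by linarith)]
  linarith

lemma cell_mem {k : ℕ} {a : ℝ} (h : |a| < 2 * 2 ^ k) :
    ⌊2 * a⌋ ∈ Finset.Icc (-(4 * 2 ^ k : ℤ)) (4 * 2 ^ k) := by
  rw [abs_lt] at h
  rw [Finset.mem_Icc]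
  constructor
  · rw [Int.le_floor]; push_cast; linarith
  · have := Int.floor_le (2 * a)
    have h2 : (⌊2 * a⌋ : ℝ) ≤ 4 * 2 ^ k := by linarith
    exact_mod_cast h2

lemma dyadic_cell_count {K : Type*} [Field K] [NumberField K] (k : InfinitePlace K → ℕ) :
    {x : 𝓞 K | ∀ v : InfinitePlace K, v (x : K) < 2 * 2 ^ k v}.Finite ∧
    {x : 𝓞 K | ∀ v : InfinitePlace K, v (x : K) < 2 * 2 ^ k v}.ncard ≤
      10 ^ (Module.finrank ℚ K) * ∏ v : InfinitePlace K, 2 ^ (k v * v.mult) := by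
  classical
  set S := {x : 𝓞 K | ∀ v : InfinitePlace K, v (x : K) < 2 * 2 ^ k v}
  let I : ℕ → Finset ℤ := fun k => Finset.Icc (-(4 * 2 ^ k : ℤ)) (4 * 2 ^ k)
  let T : Finset (InfinitePlace K → ℤ × ℤ) := Fintype.piFinset
    (fun v => I (k v) ×ˢ (if v.IsReal then {0} else I (k v)))
  let φ : 𝓞 K → (InfinitePlace K → ℤ × ℤ) := fun x v =>
    (⌊2 * (v.embedding x).re⌋, ⌊2 * (v.embedding x).im⌋)
  have hmap : Set.MapsTo φ S T := by
    intro x hx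
    simp only [Finset.mem_coe, T, Fintype.mem_piFinset, Finset.mem_product, φ]
    intro v
    have hv := hx v
    rw [← InfinitePlace.norm_embedding_eq] at hv
    refine ⟨cell_mem (lt_of_le_of_lt (Complex.abs_re_le_norm _) hv), ?_⟩
    split_ifs with hr
    · have : (v.embedding x).im = 0 := by
        have := InfinitePlace.embedding_of_isReal_apply hr (x:K)
        rw [← this]; exact Complex.ofReal_im _
      simp [this]
    · exact cell_mem (lt_of_le_of_lt (Complex.abs_im_le_norm _) hv)
  have hinj : Set.InjOn φ S := by
    intro x _ y _ h
    apply ring_eq_of_close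
    intro v
    have := congrFun h v
    simp only [φ, Prod.mk.injEq] at this
    rw [← InfinitePlace.norm_embedding_eq, map_sub]
    exact norm_lt_one_of_cell this.1 this.2
  refine ⟨Set.Finite.of_injOn hmap hinj T.finite_toSet, ?_⟩
  refine (Set.ncard_le_ncard_of_injOn φ hmap hinj T.finite_toSet).trans ?_
  rw [Set.ncard_coe_finset, Fintype.card_piFinset, ← InfinitePlace.sum_mult_eq (K := K),
    ← Finset.prod_pow_eq_pow_sum, ← Finset.prod_mul_distrib]
  refine Finset.prod_le_prod' (fun v _ => ?_)
  rw [Finset.card_product, pow_mul, ← mul_pow]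
  have hc := cell_card (k v)
  split_ifs with hr
  · rw [hr.mult_eq_one, pow_one, Finset.card_singleton, mul_one]; exact hc
  · rw [(InfinitePlace.not_isReal_iff_isComplex.mp hr).mult_eq_two, sq]
    exact Nat.mul_le_mul hc hc

lemma single_le_prod_real {ι : Type*} [Fintype ι] (f : ι → ℝ) (hf : ∀ i, 1 ≤ f i) (i : ι) :
    f i ≤ ∏ j, f j := by
  have := Finset.prod_le_prod_of_subset_of_one_le (f := f) (Finset.subset_univ {i})
    (fun j _ => by linarith [hf j]) (fun j _ _ => hf j)
  simpa using this

/-- Lemma P : counting integers of bounded height -/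
lemma height_count {K : Type*} [Field K] [NumberField K] (X : ℕ) (hX : 1 ≤ X) :
    {x : 𝓞 K | Ht (x : K) ≤ X}.Finite ∧
    ({x : 𝓞 K | Ht (x : K) ≤ X}.ncard : ℝ) ≤
      20 ^ (Module.finrank ℚ K) * X * Lg X ^ (Module.finrank ℚ K) := by
  classical
  set e := Module.finrank ℚ K
  set L := Nat.log 2 X + 1 with hL
  let T : Finset (InfinitePlace K → ℕ) :=
    (Fintype.piFinset (fun _ : InfinitePlace K => Finset.range L)).filter
      (fun k => ∏ v : InfinitePlace K, 2 ^ (k v * v.mult) ≤ X)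
  let S : (InfinitePlace K → ℕ) → Set (𝓞 K) := fun k =>
    {x : 𝓞 K | ∀ v : InfinitePlace K, v (x : K) < 2 * 2 ^ k v}
  have hsub : {x : 𝓞 K | Ht (x : K) ≤ X} ⊆ ⋃ k ∈ T, S k := by
    intro x hx
    simp only [Set.mem_ofPred_eq] at hx
    rw [Ht_eq] at hx
    have hone : ∀ v : InfinitePlace K, 1 ≤ (max 1 (v (x:K))) := fun v => le_max_left _ _
    have hle : ∀ v : InfinitePlace K, (max 1 (v (x:K))) ≤ X := by
      intro v
      refine le_trans ?_ hx
      calc max 1 (v (x:K)) ≤ (max 1 (v (x:K))) ^ v.mult :=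
            le_self_pow₀ (hone v) InfinitePlace.mult_ne_zero
        _ ≤ _ := single_le_prod_real _ (fun v => one_le_pow₀ (hone v)) v
    let k : InfinitePlace K → ℕ := fun v => Nat.log 2 ⌊max 1 (v (x:K))⌋₊
    have hk1 : ∀ v, (2:ℝ) ^ k v ≤ max 1 (v (x:K)) := by
      intro v
      refine le_trans ?_ (Nat.floor_le (by linarith [hone v]))
      have : 1 ≤ ⌊max 1 (v (x:K))⌋₊ := Nat.le_floor (by simp)
      exact_mod_cast Nat.pow_log_le_self 2 (by omega)
    have hk2 : ∀ v, max 1 (v (x:K)) < 2 * 2 ^ k v := by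
      intro v
      have h1 : ⌊max 1 (v (x:K))⌋₊ < 2 ^ (k v + 1) := Nat.lt_pow_succ_log_self (by norm_num) _
      have h3 : (⌊max 1 (v (x:K))⌋₊ : ℝ) + 1 ≤ 2 ^ (k v +1) := by exact_mod_cast h1
      have := Nat.lt_floor_add_one (max 1 (v (x:K)))
      rw [pow_succ] at h3; linarith
    simp only [Set.mem_iUnion]
    refine ⟨k, ?_, fun v => lt_of_le_of_lt (le_max_right _ _) (hk2 v)⟩
    simp only [T, Finset.mem_filter, Fintype.mem_piFinset, Finset.mem_range]
    constructor
    · intro v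
      rw [hL, Nat.lt_add_one_iff]
      apply Nat.log_mono_right
      exact Nat.floor_le_of_le (hle v)
    · have : (∏ v : InfinitePlace K, (2:ℝ) ^ (k v * v.mult)) ≤ X := by
        refine le_trans (Finset.prod_le_prod (fun _ _ => by positivity) (fun v _ => ?_)) hx
        rw [pow_mul]
        exact pow_le_pow_left₀ (by positivity) (hk1 v) _
      exact_mod_cast this
  have hfin : (⋃ k ∈ T, S k).Finite :=
    Set.Finite.biUnion T.finite_toSet (fun k _ => (dyadic_cell_count k).1)
  refine ⟨hfin.subset hsub, ?_⟩
  have h1 : {x : 𝓞 K | Ht (x : K) ≤ X}.ncard ≤ L ^ e * (10 ^ e * X) := by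
    refine (Set.ncard_le_ncard hsub hfin).trans ((Finset.set_ncard_biUnion_le _ _).trans ?_)
    refine (Finset.sum_le_card_nsmul T _ (10 ^ e * X) (fun k hk => ?_)).trans ?_
    · refine (dyadic_cell_count k).2.trans ?_
      exact Nat.mul_le_mul_left _ (Finset.mem_filter.mp hk).2
    · rw [smul_eq_mul]
      apply Nat.mul_le_mul_right
      refine (Finset.card_filter_le _ _).trans ?_
      rw [Fintype.card_piFinset]
      simp only [Finset.card_range, Finset.prod_const]
      apply Nat.pow_le_pow_right (by omega)
      rw [show e = _ from (InfinitePlace.sum_mult_eq (K := K)).symm, Finset.card_eq_sum_ones]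
      exact Finset.sum_le_sum (fun v _ => InfinitePlace.mult_pos)
  have h2 : ({x : 𝓞 K | Ht (x : K) ≤ X}.ncard : ℝ) ≤ (L:ℝ) ^ e * (10 ^ e * X) := by
    exact_mod_cast h1
  refine h2.trans ?_
  have hLL := natlog_le_Lg X
  rw [← hL] at hLL
  calc (L:ℝ) ^ e * (10 ^ e * X) ≤ (2 * Lg X) ^ e * (10 ^ e * X) := by gcongr
    _ = _ := by
      rw [mul_pow, show (20:ℝ) = 2 * 10 by norm_num, mul_pow]; ring

end
end ModL1

section ModM1
open Polynomial NumberField IntermediateField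

noncomputable section

instance numberField_of_fd (L : IntermediateField ℚ ℂ) [FiniteDimensional ℚ L] : NumberField L where
  to_charZero := inferInstance
  to_finiteDimensional := inferInstance

lemma irr_Q {f : ℤ[X]} (hf : f.Monic) (hirr : Irreducible f) : Irreducible (f.map (algebraMap ℤ ℚ)) :=
  (hf.irreducible_iff_irreducible_map_fraction_map (K := ℚ)).mp hirr

lemma minpoly_Q {f : ℤ[X]} (hf : f.Monic) (hirr : Irreducible f) {α : ℂ} (hα : aeval α f = 0) :
    f.map (algebraMap ℤ ℚ) = minpoly ℚ α := by
  apply minpoly.eq_of_irreducible_of_monic (irr_Q hf hirr) _ (hf.map _)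
  rw [aeval_map_algebraMap]; exact hα

lemma integral_of_root {f : ℤ[X]} (hf : f.Monic) {α : ℂ} (hα : aeval α f = 0) : IsIntegral ℤ α :=
  ⟨f, hf, by simpa [aeval_def] using hα⟩

lemma fd_of_root {f : ℤ[X]} (hf : f.Monic) {α : ℂ} (hα : aeval α f = 0) :
    FiniteDimensional ℚ ℚ⟮α⟯ :=
  adjoin.finiteDimensional ((integral_of_root hf hα).tower_top)

lemma finrank_of_root {f : ℤ[X]} (hf : f.Monic) (hirr : Irreducible f) {α : ℂ} (hα : aeval α f = 0) :
    Module.finrank ℚ ℚ⟮α⟯ = f.natDegree := by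
  rw [adjoin.finrank ((integral_of_root hf hα).tower_top), ← minpoly_Q hf hirr hα,
    natDegree_map_eq_of_injective (algebraMap ℤ ℚ).injective_int]

lemma root_common {L : IntermediateField ℚ ℂ} {α : ℂ} (hL : L ≤ ℚ⟮α⟯) (hint : IsIntegral ℚ α)
    {g : L[X]} (hg : g = minpoly L α) {σ σ' : L →+* ℂ} {β : ℂ} (h1 : (g.map σ).eval β = 0)
    (h2 : (g.map σ').eval β = 0) : σ = σ' := by
  ext l
  have hl : (l:ℂ) ∈ ℚ⟮α⟯ := hL l.2
  rw [← IntermediateField.mem_toSubalgebra, adjoin_simple_toSubalgebra_of_isAlgebraic hint.isAlgebraic,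
    Algebra.adjoin_singleton_eq_range_aeval] at hl
  obtain ⟨P, hP⟩ := hl
  have hdvd : g ∣ P.map (algebraMap ℚ L) - C l := by
    rw [hg]
    apply minpoly.dvd
    have hP' : aeval α P = (l:ℂ) := hP
    rw [map_sub, aeval_map_algebraMap, hP', aeval_C]
    exact sub_self _
  have key : ∀ τ : L →+* ℂ, (g.map τ).eval β = 0 → aeval β P = τ l := by
    intro τ hτ
    have h := Polynomial.map_dvd τ hdvd
    have h0 : ((P.map (algebraMap ℚ L) - C l).map τ).eval β = 0 :=
      eval_eq_zero_of_dvd_of_eval_eq_zero h hτ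
    rw [Polynomial.map_sub, Polynomial.map_map, map_C, eval_sub, eval_C, sub_eq_zero,
      Subsingleton.elim (τ.comp (algebraMap ℚ L)) (algebraMap ℚ ℂ), eval_map_algebraMap] at h0
    exact h0
  rw [← key σ h1, ← key σ' h2]

lemma prod_identity {f : ℤ[X]} (hf : f.Monic) (hirr : Irreducible f) {α : ℂ} (hα : aeval α f = 0)
    (L : IntermediateField ℚ ℂ) [FiniteDimensional ℚ L] (hL : L ≤ ℚ⟮α⟯) :
    f.map (Int.castRingHom ℂ) = ∏ σ : L →+* ℂ, (minpoly L α).map σ := by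
  have hintZ := integral_of_root hf hα
  have hint : IsIntegral ℚ α := hintZ.tower_top
  have hintL : IsIntegral L α := hintZ.tower_top
  set g := minpoly L α with hg
  have hgm : g.Monic := minpoly.monic hintL
  have hfC : f.map (Int.castRingHom ℂ) = (f.map (algebraMap ℤ ℚ)).map (algebraMap ℚ ℂ) := by
    rw [Polynomial.map_map]; congr 1
  have hsep : (f.map (Int.castRingHom ℂ)).Separable := by
    rw [hfC]; exact ((irr_Q hf hirr).separable).map
  apply eq_of_monic_of_associated (hf.map _)
    (monic_prod_of_monic _ _ (fun σ _ => hgm.map σ))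
  apply associated_of_dvd_dvd
  · -- every root of f is a root
    have hcard := IsAlgClosed.splits (f.map (Int.castRingHom ℂ))
    rw [hcard.dvd_iff_roots_le_roots (hf.map _).ne_zero
      (monic_prod_of_monic _ _ (fun σ _ => hgm.map σ)).ne_zero]
    rw [Multiset.le_iff_subset (nodup_roots hsep)]
    intro β hβ
    rw [mem_roots (hf.map _).ne_zero, IsRoot.def] at hβ
    rw [mem_roots (monic_prod_of_monic _ _ (fun σ _ => hgm.map σ)).ne_zero, IsRoot.def, eval_prod]
    have hβ' : aeval β (minpoly ℚ α) = 0 := by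
      rw [← minpoly_Q hf hirr hα, aeval_map_algebraMap, aeval_def, ← eval_map]
      exact hβ
    obtain ⟨τ, hτ⟩ : ∃ τ : ℚ⟮α⟯ →ₐ[ℚ] ℂ, τ (AdjoinSimple.gen ℚ α) = β := by
      refine ⟨(algHomAdjoinIntegralEquiv ℚ hint).symm ⟨β, ?_⟩, algHomAdjoinIntegralEquiv_symm_apply_gen ℚ hint _⟩
      rw [mem_aroots]
      exact ⟨minpoly.ne_zero hint, hβ'⟩
    refine Finset.prod_eq_zero (Finset.mem_univ ((τ : ℚ⟮α⟯ →+* ℂ).comp (inclusion hL : L →+* ℚ⟮α⟯))) ?_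
    have h0 : eval₂ (inclusion hL : L →+* ℚ⟮α⟯) (AdjoinSimple.gen ℚ α) g = 0 := by
      apply (algebraMap ℚ⟮α⟯ ℂ).injective
      rw [hom_eval₂, map_zero, AdjoinSimple.algebraMap_gen]
      exact minpoly.aeval L α
    rw [eval_map, ← hτ]
    have := hom_eval₂ g (inclusion hL : L →+* ℚ⟮α⟯) (τ : ℚ⟮α⟯ →+* ℂ) (AdjoinSimple.gen ℚ α)
    rw [h0, map_zero] at this
    exact this.symm
  · apply Finset.prod_dvd_of_coprime
    · intro σ _ σ' _ hne
      by_contra hnc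
      obtain ⟨β, h1, h2⟩ : ∃ β, (g.map σ).eval β = 0 ∧ (g.map σ').eval β = 0 := by
        have := (Polynomial.isCoprime_iff_aeval_ne_zero_of_isAlgClosed (k := ℂ) ℂ (g.map σ) (g.map σ')).not.mp hnc
        push Not at this
        simpa [aeval_def] using this
      exact hne (root_common hL hint hg h1 h2)
    · intro σ _
      have : g ∣ f.map (algebraMap ℤ L) := by
        apply minpoly.dvd; rw [aeval_map_algebraMap]; exact hα
      have h2 := Polynomial.map_dvd σ this
      rw [Polynomial.map_map] at h2
      rwa [Subsingleton.elim (σ.comp (algebraMap ℤ L)) (Int.castRingHom ℂ)] at h2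

end
end ModM1

section ModM2
open Polynomial NumberField IntermediateField

noncomputable section

lemma mahler_prod {ι : Type*} (s : Finset ι) (p : ι → ℂ[X]) :
    (∏ i ∈ s, p i).mahlerMeasure = ∏ i ∈ s, (p i).mahlerMeasure := by
  classical
  induction s using Finset.induction_on with
  | empty => simp
  | insert a s ha ih => rw [Finset.prod_insert ha, Finset.prod_insert ha, mahlerMeasure_mul, ih]

lemma minpoly_of_mem {L : IntermediateField ℚ ℂ} (x : L) : minpoly L (x:ℂ) = X - C x := by
  have := minpoly.eq_X_sub_C (B := ℂ) x
  exact this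

lemma Ht_gen {f : ℤ[X]} (hf : f.Monic) (hirr : Irreducible f)
    {L : IntermediateField ℚ ℂ} [FiniteDimensional ℚ L] (x : L) (hx : aeval (x:ℂ) f = 0)
    (hL : ℚ⟮(x:ℂ)⟯ = L) : Ht x = MM f := by
  unfold MM
  rw [prod_identity hf hirr hx L hL.ge, mahler_prod]
  unfold Ht
  refine Finset.prod_congr rfl (fun σ _ => ?_)
  rw [minpoly_of_mem, Polynomial.map_sub, map_X, map_C, mahlerMeasure_X_sub_C]

lemma degree_mul {f : ℤ[X]} (hf : f.Monic) (hirr : Irreducible f) {α : ℂ} (hα : aeval α f = 0)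
    (L : IntermediateField ℚ ℂ) [FiniteDimensional ℚ L] (hL : L ≤ ℚ⟮α⟯) :
    f.natDegree = Module.finrank ℚ L * (minpoly L α).natDegree := by
  have h := congrArg natDegree (prod_identity hf hirr hα L hL)
  have hintL : IsIntegral L α := (integral_of_root hf hα).tower_top
  rw [natDegree_map_eq_of_injective (Int.cast_injective),
    natDegree_prod_of_monic _ _ (fun σ _ => (minpoly.monic hintL).map σ)] at h
  rw [h]
  simp only [natDegree_map, Finset.sum_const, smul_eq_mul, Finset.card_univ]
  rw [Embeddings.card L ℂ]

lemma Ht_coeff {f : ℤ[X]} (hf : f.Monic) (hirr : Irreducible f) {α : ℂ} (hα : aeval α f = 0)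
    (L : IntermediateField ℚ ℂ) [FiniteDimensional ℚ L] (hL : L ≤ ℚ⟮α⟯) (j : ℕ) :
    Ht ((minpoly L α).coeff j) ≤ 2 ^ f.natDegree * MM f := by
  have hintL : IsIntegral L α := (integral_of_root hf hα).tower_top
  unfold MM
  rw [degree_mul hf hirr hα L hL, prod_identity hf hirr hα L hL, mahler_prod]
  unfold Ht
  rw [← Embeddings.card L ℂ, pow_mul', ← Finset.card_univ, ← Finset.prod_const,
    ← Finset.prod_mul_distrib]
  refine Finset.prod_le_prod (fun σ _ => by positivity) (fun σ _ => ?_)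
  set p := (minpoly L α).map σ with hp
  have hpm : p.Monic := (minpoly.monic hintL).map σ
  have hM : 1 ≤ p.mahlerMeasure := by
    apply one_le_mahlerMeasure_of_one_le_norm_leadingCoeff
    rw [hpm.leadingCoeff]; simp
  have h := norm_coeff_le_choose_mul_mahlerMeasure j p
  have hd : p.natDegree = (minpoly L α).natDegree := natDegree_map σ
  rw [hp, coeff_map, ← hp, hd] at h
  have h2 : (((minpoly L α).natDegree.choose j : ℕ) : ℝ) ≤ 2 ^ (minpoly L α).natDegree := by
    exact_mod_cast Nat.choose_le_two_pow _ _
  apply max_le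
  · have : (1:ℝ) ≤ 2 ^ (minpoly L α).natDegree := one_le_pow₀ (by norm_num)
    nlinarith
  · exact h.trans (by gcongr)

/-- no proper intermediate fields -/
def NoMid (K : IntermediateField ℚ ℂ) : Prop := ∀ L : IntermediateField ℚ ℂ, L ≤ K → L = ⊥ ∨ L = K

lemma exists_min_sub {K : IntermediateField ℚ ℂ} [FiniteDimensional ℚ K] (h : ¬ NoMid K) :
    ∃ L : IntermediateField ℚ ℂ, L ≤ K ∧ L ≠ ⊥ ∧ L ≠ K ∧ FiniteDimensional ℚ L ∧ NoMid L := by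
  have hfd : ∀ L : IntermediateField ℚ ℂ, L ≤ K → FiniteDimensional ℚ L := fun L hL =>
    FiniteDimensional.of_injective (inclusion hL).toLinearMap (inclusion_injective hL)
  let P : ℕ → Prop := fun k => ∃ L : IntermediateField ℚ ℂ, L ≤ K ∧ L ≠ ⊥ ∧ L ≠ K ∧ Module.finrank ℚ L = k
  classical
  have hex : ∃ k, P k := by
    unfold NoMid at h
    push Not at h
    obtain ⟨L, h1, h2, h3⟩ := h
    exact ⟨_, L, h1, h2, h3, rfl⟩
  obtain ⟨L, h1, h2, h3, h4⟩ := Nat.find_spec hex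
  have := hfd L h1
  refine ⟨L, h1, h2, h3, hfd L h1, fun L' hL' => ?_⟩
  by_contra hcon
  push Not at hcon
  have hlt : Module.finrank ℚ L' < Nat.find hex := by
    rw [← h4]
    refine lt_of_le_of_ne ?_ (fun heq => hcon.2 (eq_of_le_of_finrank_eq hL' heq))
    exact LinearMap.finrank_le_finrank_of_injective (f := (inclusion hL').toLinearMap) (inclusion_injective hL')
  refine Nat.find_min hex hlt ⟨L', hL'.trans h1, hcon.1, ?_, rfl⟩
  intro h; exact h3 (le_antisymm h1 (h ▸ hL'))

lemma NoMid.gen {K : IntermediateField ℚ ℂ} (h : NoMid K) {x : ℂ} (hx : x ∈ K)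
    (hxb : x ∉ (⊥ : IntermediateField ℚ ℂ)) : ℚ⟮x⟯ = K := by
  rcases h ℚ⟮x⟯ (by rw [adjoin_simple_le_iff]; exact hx) with h | h
  · exact absurd (h ▸ mem_adjoin_simple_self ℚ x) hxb
  · exact h

lemma irr_minpolyZ {x : ℂ} (hx : IsIntegral ℤ x) :
    (minpoly ℤ x).Monic ∧ Irreducible (minpoly ℤ x) ∧ aeval x (minpoly ℤ x) = 0 :=
  ⟨minpoly.monic hx, minpoly.irreducible hx, minpoly.aeval _ _⟩

/-- fields of degree `e` generated by a root of a polynomial in a set -/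
lemma field_count {n : ℕ} (N : ℕ) (hN : 1 ≤ N) (L : IntermediateField ℚ ℂ) [FiniteDimensional ℚ L]
    (hL : Module.finrank ℚ L = n) :
    ({f | f ∈ PBox n N ∧ Irreducible f ∧ ∃ α : ℂ, aeval α f = 0 ∧ ℚ⟮α⟯ = L}.ncard : ℝ) ≤
      20 ^ n * ((n + 1) * N : ℕ) * Lg ((n + 1) * N) ^ n := by
  classical
  have h := height_count (K := L) ((n + 1) * N) (by nlinarith)
  rw [hL] at h
  refine le_trans ?_ h.2
  set S := {f | f ∈ PBox n N ∧ Irreducible f ∧ ∃ α : ℂ, aeval α f = 0 ∧ ℚ⟮α⟯ = L} with hS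
  have key : ∀ f ∈ S, ∃ x : 𝓞 L, aeval ((x:L):ℂ) f = 0 ∧ Ht (x:L) ≤ ((n + 1) * N : ℕ) := by
    rintro f ⟨hf, hirr, α, hα, hαL⟩
    have hmem : α ∈ L := hαL ▸ mem_adjoin_simple_self ℚ α
    have hint : IsIntegral ℤ (⟨α, hmem⟩ : L) := by
      have : IsIntegral ℤ ((algebraMap L ℂ) ⟨α, hmem⟩) := integral_of_root hf.1 hα
      exact (isIntegral_algebraMap_iff (algebraMap L ℂ).injective).mp this
    refine ⟨⟨⟨α, hmem⟩, hint⟩, hα, ?_⟩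
    have := Ht_gen hf.1 hirr (L := L) ⟨α, hmem⟩ hα hαL
    show Ht (⟨α, hmem⟩ : L) ≤ _
    rw [this]
    push_cast
    exact MM_le hN hf
  choose! φ h1 h2 using key
  have hinj : Set.InjOn φ S := by
    intro f hf f' hf' heq
    have e1 := minpoly_Q hf.1.1 hf.2.1 (h1 f hf)
    have e2 := minpoly_Q hf'.1.1 hf'.2.1 (h1 f' hf')
    rw [heq, ← e2] at e1
    exact map_injective _ (algebraMap ℤ ℚ).injective_int e1
  exact_mod_cast Set.ncard_le_ncard_of_injOn φ (fun f hf => h2 f hf) hinj h.1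

end
end ModM2

section ModM3
open Polynomial NumberField IntermediateField

noncomputable section

/-- polynomials whose root field contains `L`, with specified coefficient -/
def MSet (n N m : ℕ) (L : IntermediateField ℚ ℂ) (j0 : ℕ) (β : ℂ) : Set ℤ[X] :=
  {f | f ∈ PBox n N ∧ Irreducible f ∧ ∃ α : ℂ, aeval α f = 0 ∧ L ≤ ℚ⟮α⟯ ∧
    (minpoly L α).natDegree = m ∧ (((minpoly L α).coeff j0 : L) : ℂ) = β}

lemma coeff_integral {f : ℤ[X]} (hf : f.Monic) {α : ℂ} (hα : aeval α f = 0)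
    (L : IntermediateField ℚ ℂ) (j : ℕ) : IsIntegral ℤ ((minpoly L α).coeff j) := by
  have hintL : IsIntegral L α := (integral_of_root hf hα).tower_top
  apply isIntegral_coeff_of_dvd f _ hf (minpoly.monic hintL)
  apply minpoly.dvd
  rw [aeval_map_algebraMap]; exact hα

lemma MSet_count {n N m : ℕ} (hN : 1 ≤ N) (L : IntermediateField ℚ ℂ) [FiniteDimensional ℚ L]
    (j0 : ℕ) (hj0 : j0 < m) (β : ℂ) :
    ((MSet n N m L j0 β).ncard : ℝ) ≤
      (20 ^ n * ((2 ^ n * (n + 1)) * N : ℕ) * Lg ((2 ^ n * (n + 1)) * N) ^ n) ^ (m - 1) := by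
  classical
  set Y := (2 ^ n * (n + 1)) * N with hY
  have hY1 : 1 ≤ Y := by rw [hY]; exact Nat.one_le_iff_ne_zero.mpr (by positivity)
  have hH := height_count (K := L) Y hY1
  by_cases hne : (MSet n N m L j0 β).Nonempty
  swap
  · rw [Set.not_nonempty_iff_eq_empty.mp hne]
    have := Lg_one_le Y
    simp only [Set.ncard_empty, Nat.cast_zero]
    positivity
  have key : ∀ f ∈ MSet n N m L j0 β, Module.finrank ℚ L ≤ n ∧
      ∃ g : Fin m → 𝓞 L, (∀ j, Ht (g j : L) ≤ Y) ∧
      (((g ⟨j0, hj0⟩ : 𝓞 L) : L) : ℂ) = β ∧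
      f.map (Int.castRingHom ℂ) = ∏ σ : L →+* ℂ,
        (X ^ m + ∑ j : Fin m, C ((g j : L)) * X ^ (j:ℕ) : L[X]).map σ := by
    rintro f ⟨hf, hirr, α, hα, hL, hm, hβ⟩
    have hZ := integral_of_root hf.1 hα
    have hintL : IsIntegral L α := hZ.tower_top
    have hdeg := degree_mul hf.1 hirr hα L hL
    refine ⟨?_, fun j => ⟨(minpoly L α).coeff j, coeff_integral hf.1 hα L j⟩, fun j => ?_, hβ, ?_⟩
    · rw [hf.2.1, hm] at hdeg
      rw [hdeg]; exact Nat.le_mul_of_pos_right _ (by omega)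
    · refine (Ht_coeff hf.1 hirr hα L hL j).trans ?_
      rw [hf.2.1, hY]
      have := MM_le hN hf
      push_cast
      nlinarith [pow_pos (show (0:ℝ) < 2 by norm_num) n]
    · rw [prod_identity hf.1 hirr hα L hL]
      refine Finset.prod_congr rfl (fun σ _ => ?_)
      congr 1
      have := (minpoly.monic hintL).as_sum
      rw [hm] at this
      refine this.trans ?_
      rw [Finset.sum_range]
      rfl
  obtain ⟨f0, hf0⟩ := hne
  have hen := (key f0 hf0).1
  replace key := fun f hf => (key f hf).2
  choose! φ h1 h2 h3 using key
  let H := hH.1.toFinset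
  let T : Finset (Fin m → 𝓞 L) := Fintype.piFinset
    (fun j => if j = ⟨j0, hj0⟩ then {φ f0 j} else H)
  have hmap : Set.MapsTo φ (MSet n N m L j0 β) T := by
    intro f hf
    simp only [T, Finset.mem_coe, Fintype.mem_piFinset]
    intro j
    split_ifs with hj
    · rw [Finset.mem_singleton, hj]
      apply RingOfIntegers.ext
      apply Subtype.ext
      rw [h2 f hf, h2 f0 hf0]
    · simp only [H, Set.Finite.mem_toFinset]
      exact h1 f hf j
  have hinj : Set.InjOn φ (MSet n N m L j0 β) := by
    intro f hf f' hf' heq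
    have e1 := h3 f hf
    rw [heq, ← h3 f' hf'] at e1
    exact map_injective _ (Int.cast_injective) e1
  have hc := Set.ncard_le_ncard_of_injOn φ hmap hinj T.finite_toSet
  have hT : T.card = H.card ^ (m - 1) := by
    rw [Fintype.card_piFinset]
    rw [← Finset.mul_prod_erase _ _ (Finset.mem_univ (⟨j0, hj0⟩ : Fin m))]
    simp only [if_true, Finset.card_singleton, one_mul]
    rw [Finset.prod_congr rfl (g := fun _ => H.card)]
    · simp
    · intro j hj
      rw [if_neg (Finset.ne_of_mem_erase hj)]
  rw [Set.ncard_coe_finset, hT] at hc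
  have hc' : ((MSet n N m L j0 β).ncard : ℝ) ≤ (H.card : ℝ) ^ (m - 1) := by exact_mod_cast hc
  refine hc'.trans (pow_le_pow_left₀ (by positivity) ?_ _)
  have := hH.2
  rw [Set.ncard_eq_toFinset_card _ hH.1] at this
  refine this.trans ?_
  have hlg := Lg_pow_mono Y hen
  have : (20:ℝ) ^ (Module.finrank ℚ L) ≤ 20 ^ n := pow_le_pow_right₀ (by norm_num) hen
  have := Lg_one_le Y
  gcongr

lemma not_bot_coeff {f : ℤ[X]} (hf : f.Monic) (hirr : Irreducible f) {α : ℂ} (hα : aeval α f = 0)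
    (L : IntermediateField ℚ ℂ) (hlt : (minpoly L α).natDegree < f.natDegree) :
    ∃ j < (minpoly L α).natDegree, (((minpoly L α).coeff j : L) : ℂ) ∉ (⊥ : IntermediateField ℚ ℂ) := by
  by_contra hcon
  push Not at hcon
  have hintL : IsIntegral L α := (integral_of_root hf hα).tower_top
  have hall : ∀ j, ∃ q : ℚ, algebraMap ℚ L q = (minpoly L α).coeff j := by
    intro j
    rcases lt_trichotomy j (minpoly L α).natDegree with h | h | h
    · obtain ⟨q, hq⟩ := mem_bot.mp (hcon j h)
      exact ⟨q, Subtype.ext hq⟩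
    · exact ⟨1, by rw [h, map_one, (minpoly.monic hintL).coeff_natDegree]⟩
    · exact ⟨0, by rw [map_zero, coeff_eq_zero_of_natDegree_lt h]⟩
  have hl : minpoly L α ∈ lifts (algebraMap ℚ L) := by
    rw [lifts_iff_coeff_lifts]; exact fun j => hall j
  obtain ⟨p, hp1, hp2, hp3⟩ := lifts_and_natDegree_eq_and_monic hl (minpoly.monic hintL)
  have hdvd : minpoly ℚ α ∣ p := by
    apply minpoly.dvd
    rw [← aeval_map_algebraMap L, hp1]; exact minpoly.aeval _ _
  have := natDegree_le_of_dvd hdvd hp3.ne_zero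
  rw [← minpoly_Q hf hirr hα, natDegree_map_eq_of_injective (algebraMap ℤ ℚ).injective_int, hp2] at this
  omega

/-- imprimitive irreducible polynomials are few -/
lemma mid_small (n : ℕ) : SmallP n (fun N => {f | f ∈ PBox n N ∧ Irreducible f ∧
    ∃ α : ℂ, aeval α f = 0 ∧ ¬ NoMid ℚ⟮α⟯}) := by
  classical
  set c := 2 ^ n * (n + 1) with hc
  have hc1 : 1 ≤ c := Nat.one_le_iff_ne_zero.mpr (by positivity)
  let I : Finset (ℕ × ℕ × ℕ) := (Finset.range (n+1) ×ˢ Finset.range (n+1) ×ˢ Finset.range (n+1)).filter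
    (fun t => 2 ≤ t.1 ∧ 2 ≤ t.2.1 ∧ t.1 * t.2.1 = n ∧ t.2.2 < t.2.1)
  let Q : ℕ → ℕ → Set ℤ[X] := fun e N => PBox e (2 ^ n * c * N)
  let V : ℕ × ℕ × ℕ → ℕ → Set ℤ[X] := fun t N =>
    ⋃ q ∈ (PBox_finite t.1 (2 ^ n * c * N)).toFinset, ⋃ β ∈ (q.map (Int.castRingHom ℂ)).roots.toFinset,
      {f | f ∈ MSet n N t.2.1 ℚ⟮β⟯ t.2.2 β}
  have hV : SmallP n (fun N => ⋃ t ∈ I, V t N) := by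
    apply SmallP.biUnion
    rintro ⟨e, m, j0⟩ ht
    simp only [I, Finset.mem_filter] at ht
    obtain ⟨-, he, hm, hem, hj0⟩ := ht
    set A : ℝ := 3 * 2 ^ n * c with hA
    set B : ℝ := 20 ^ n * c * Lg c ^ n with hB
    have hLc := Lg_one_le c
    have hB0 : 0 < B := by positivity
    refine ⟨A ^ e * n * B ^ (m - 1), by
      have : 0 < n := by rw [← hem]; positivity
      positivity, n * (m - 1), fun N hN => ?_⟩
    have hN0 : (1:ℝ) ≤ N := by exact_mod_cast (by omega : 1 ≤ N)
    have hfin : (V (e, m, j0) N).Finite := by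
      refine Set.Finite.biUnion (Finset.finite_toSet _) (fun q _ => ?_)
      refine Set.Finite.biUnion (Finset.finite_toSet _) (fun β _ => ?_)
      exact (PBox_finite n N).subset (fun f hf => hf.1)
    refine ⟨hfin, ?_⟩
    have hMS : ∀ q ∈ (PBox_finite e (2 ^ n * c * N)).toFinset,
        ∀ β ∈ (q.map (Int.castRingHom ℂ)).roots.toFinset,
        (({f | f ∈ MSet n N m ℚ⟮β⟯ j0 β}.ncard : ℕ) : ℝ) ≤ (B * N * Lg N ^ n) ^ (m - 1) := by
      intro q hq β hβ
      rw [Set.Finite.mem_toFinset] at hq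
      have hβ0 : aeval β q = 0 := by
        rw [Multiset.mem_toFinset, mem_roots (hq.1.map _).ne_zero, IsRoot.def, eval_map] at hβ
        exact hβ
      have := fd_of_root hq.1 hβ0
      refine (MSet_count (by omega) ℚ⟮β⟯ j0 hj0 β).trans ?_
      have h0 := Lg_one_le (c * N)
      refine pow_le_pow_left₀ (by positivity) ?_ _
      rw [← hc]
      have h1 := Lg_mul_le c N hc1 (by omega)
      calc (20:ℝ) ^ n * (c * N : ℕ) * Lg (c * N) ^ n ≤ 20 ^ n * (c * N : ℕ) * (Lg c * Lg N) ^ n := by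
            gcongr
        _ = B * N * Lg N ^ n := by rw [hB, mul_pow]; push_cast; ring
    have hLN := Lg_one_le N
    have h1 : ((V (e, m, j0) N).ncard : ℝ) ≤ ∑ q ∈ (PBox_finite e (2 ^ n * c * N)).toFinset,
        ∑ β ∈ (q.map (Int.castRingHom ℂ)).roots.toFinset, (({f | f ∈ MSet n N m ℚ⟮β⟯ j0 β}.ncard : ℕ) : ℝ) := by
      have : (V (e, m, j0) N).ncard ≤ ∑ q ∈ (PBox_finite e (2 ^ n * c * N)).toFinset,
        ∑ β ∈ (q.map (Int.castRingHom ℂ)).roots.toFinset, {f | f ∈ MSet n N m ℚ⟮β⟯ j0 β}.ncard := by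
        refine (Finset.set_ncard_biUnion_le _ _).trans (Finset.sum_le_sum (fun q _ => ?_))
        exact Finset.set_ncard_biUnion_le _ _
      exact_mod_cast this
    have hen : e ≤ n := by rw [← hem]; exact Nat.le_mul_of_pos_right _ (by omega)
    have h2 : ∀ q ∈ (PBox_finite e (2 ^ n * c * N)).toFinset,
        ∑ β ∈ (q.map (Int.castRingHom ℂ)).roots.toFinset, (({f | f ∈ MSet n N m ℚ⟮β⟯ j0 β}.ncard : ℕ) : ℝ)
        ≤ n * (B * N * Lg N ^ n) ^ (m - 1) := by
      intro q hq
      refine (Finset.sum_le_card_nsmul _ _ _ (hMS q hq)).trans ?_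
      rw [nsmul_eq_mul]
      rw [Set.Finite.mem_toFinset] at hq
      gcongr
      refine (Multiset.toFinset_card_le _).trans ((card_roots' _).trans ?_)
      rw [natDegree_map_eq_of_injective (Int.cast_injective), hq.2.1]; exact hen
    have h3 : (((PBox_finite e (2 ^ n * c * N)).toFinset.card : ℕ) : ℝ) ≤ (A * N) ^ e := by
      rw [← Set.ncard_eq_toFinset_card _ (PBox_finite e (2 ^ n * c * N))]
      have := PBox_card e (2 ^ n * c * N)
      have h4 : ((PBox e (2 ^ n * c * N)).ncard : ℝ) ≤ (2 * (2 ^ n * c * N) + 1) ^ e := by exact_mod_cast this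
      refine h4.trans (pow_le_pow_left₀ (by positivity) ?_ _)
      have : (1:ℝ) ≤ 2 ^ n * c * N := by exact_mod_cast Nat.one_le_iff_ne_zero.mpr (by positivity)
      rw [hA]; linarith
    calc _ ≤ _ := h1
      _ ≤ (A * N) ^ e * (n * (B * N * Lg N ^ n) ^ (m - 1)) := by
          refine (Finset.sum_le_card_nsmul _ _ _ h2).trans ?_
          rw [nsmul_eq_mul]
          gcongr
      _ = A ^ e * n * B ^ (m - 1) * (N:ℝ) ^ (e + (m - 1)) * Lg N ^ (n * (m - 1)) := by
          rw [mul_pow, mul_pow, mul_pow, ← pow_mul, pow_add]; ring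
      _ ≤ _ := by
          have : e + (m - 1) ≤ n - 1 := by
            rw [← hem]
            obtain ⟨a, rfl⟩ := Nat.exists_eq_add_of_le he
            obtain ⟨b, rfl⟩ := Nat.exists_eq_add_of_le hm
            have : (2 + a) * (2 + b) = 4 + 2 * a + 2 * b + a * b := by ring
            omega
          gcongr
  refine hV.mono (fun N hN f hf => ?_)
  obtain ⟨hf, hirr, α, hα, hmid⟩ := hf
  have := fd_of_root hf.1 hα
  obtain ⟨L, hLK, hLb, hLne, hfd, hno⟩ := exists_min_sub hmid
  have hdeg := degree_mul hf.1 hirr hα L hLK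
  set m := (minpoly L α).natDegree with hm
  set e := Module.finrank ℚ L with he
  rw [hf.2.1] at hdeg
  have hKn := finrank_of_root hf.1 hirr hα
  rw [hf.2.1] at hKn
  have hn0 : n ≠ 0 := by rw [← hKn]; exact Module.finrank_pos.ne'
  have he0 : e ≠ 0 := by rintro h; rw [h] at hdeg; simp at hdeg; omega
  have hm0 : m ≠ 0 := by rintro h; rw [h] at hdeg; simp at hdeg; omega
  have he1 : e ≠ 1 := fun h => hLb (finrank_eq_one_iff.mp h)
  have hm1 : m ≠ 1 := by
    intro h
    rw [h, mul_one] at hdeg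
    exact hLne (eq_of_le_of_finrank_eq hLK (by rw [hKn, hdeg]))
  have hmn : m < n := by
    rw [hdeg]; exact lt_mul_of_one_lt_left (by omega) (by omega)
  have hen : e < n := by
    rw [hdeg]; exact lt_mul_of_one_lt_right (by omega) (by omega)
  obtain ⟨j, hj, hjb⟩ := not_bot_coeff hf.1 hirr hα L (by rw [hf.2.1]; exact hmn)
  set b := (minpoly L α).coeff j with hb
  have hgen : ℚ⟮(b:ℂ)⟯ = L := hno.gen b.2 hjb
  have hbint : IsIntegral ℤ (b:ℂ) := by
    have := coeff_integral hf.1 hα L j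
    exact (isIntegral_algebraMap_iff (algebraMap L ℂ).injective).mpr this
  obtain ⟨q1, q2, q3⟩ := irr_minpolyZ hbint
  have hqdeg : (minpoly ℤ (b:ℂ)).natDegree = e := by
    rw [← finrank_of_root q1 q2 q3, hgen]
  have hMq : MM (minpoly ℤ (b:ℂ)) ≤ (c * N : ℕ) := by
    rw [← Ht_gen q1 q2 b q3 hgen]
    refine (Ht_coeff hf.1 hirr hα L hLK j).trans ?_
    rw [hf.2.1, hc]
    have := MM_le (by omega) hf
    push_cast
    nlinarith [pow_pos (show (0:ℝ) < 2 by norm_num) n]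
  refine Set.mem_iUnion₂.mpr ⟨(e, m, j), ?_, Set.mem_iUnion₂.mpr ⟨minpoly ℤ (b:ℂ), ?_,
    Set.mem_iUnion₂.mpr ⟨(b:ℂ), ?_, hf, hirr, α, hα, hgen.le.trans hLK, ?_⟩⟩⟩
  · simp only [I, Finset.mem_filter, Finset.mem_product, Finset.mem_range]
    refine ⟨⟨by omega, by omega, by omega⟩, by omega, by omega, hdeg.symm, hj⟩
  · rw [Set.Finite.mem_toFinset]
    have := coeff_mem_box q1 (n := n) (B := 2 ^ n * c * N) (by omega) hMq (by push_cast; linarith)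
    rwa [hqdeg] at this
  · rw [Multiset.mem_toFinset, mem_roots (q1.map _).ne_zero, IsRoot.def, eval_map]
    exact q3
  · have : ∀ L' : IntermediateField ℚ ℂ, L' = L → (minpoly L' α).natDegree = m ∧
        (((minpoly L' α).coeff j : L') : ℂ) = b := by
      rintro _ rfl
      exact ⟨rfl, rfl⟩
    exact this _ hgen

end
end ModM3

section ModD1
open Polynomial NumberField IntermediateField

noncomputable section

open NumberField.mixedEmbedding NumberField.InfinitePlace Module in
lemma mbound (K : Type*) [Field K] [NumberField K] :
    minkowskiBound K ↑1 ≤ NNReal.sqrt ‖discr K‖₊ * 2 ^ finrank ℚ K := by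
  classical
  rw [minkowskiBound, volume_fundamentalDomain_fractionalIdealLatticeBasis,
    Units.val_one, FractionalIdeal.absNorm_one, Rat.cast_one,
    ENNReal.ofReal_one, one_mul, mixedEmbedding.finrank, volume_fundamentalDomain_latticeBasis]
  gcongr
  conv_rhs => rw [← one_mul (ENNReal.ofNNReal _)]
  gcongr
  exact pow_le_one₀ (by positivity) (by simp)

open NumberField.mixedEmbedding NumberField.InfinitePlace Module in
lemma mink (K : Type*) [Field K] [NumberField K] (lam : ℕ) (hl : 1 ≤ lam)
    (h : 4 ^ (finrank ℚ K) * |discr K| < (lam:ℤ) ^ (2 * (finrank ℚ K - 1))) :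
    ∃ a : 𝓞 K, (∀ z : ℤ, (a : K) ≠ z) ∧ ∀ w : InfinitePlace K, w a ≤ 2 * lam := by
  classical
  have key : minkowskiBound K ↑1 < ((lam:NNReal) ^ (finrank ℚ K - 1) : NNReal) := by
    refine (mbound K).trans_lt ?_
    rw [← ENNReal.coe_ofNat, ← ENNReal.coe_pow, ← ENNReal.coe_mul, ENNReal.coe_lt_coe]
    rw [← NNReal.coe_lt_coe]
    push_cast
    apply lt_of_pow_lt_pow_left₀ 2 (by positivity)
    rw [mul_pow, Real.sq_sqrt (by positivity), ← pow_mul, ← pow_mul, mul_comm _ 2, pow_mul 2 2,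
      mul_comm (_ - 1) 2, Int.norm_eq_abs, mul_comm]
    have := (Int.cast_lt (R := ℝ)).2 h
    push_cast at this
    norm_num at this ⊢
    exact this
  have hn : 1 ≤ finrank ℚ K := finrank_pos
  have hlr : (1:ℝ) ≤ lam := by exact_mod_cast hl
  have hpr : ∀ w₀ : InfinitePlace K, ∏ w ∈ Finset.univ.erase w₀, (lam:NNReal) ^ mult w
      = (lam : NNReal) ^ (finrank ℚ K - mult w₀) := by
    intro w₀
    rw [Finset.prod_pow_eq_pow_sum]
    congr 1
    have := sum_mult_eq (K := K)
    rw [← Finset.sum_erase_add _ _ (Finset.mem_univ w₀)] at this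
    omega
  obtain ⟨w₀⟩ : Nonempty (InfinitePlace K) := inferInstance
  by_cases hw₀ : IsReal w₀
  · have hv : minkowskiBound K ↑1 < MeasureTheory.volume
        (convexBodyLT K (fun w ↦ if w = w₀ then 1 else (lam:NNReal))) := by
      rw [convexBodyLT_volume, ← Finset.prod_erase_mul _ _ (Finset.mem_univ w₀)]
      rw [Finset.prod_congr rfl (g := fun w => (lam:NNReal) ^ mult w)
        (fun w hw => by rw [if_neg (Finset.ne_of_mem_erase hw)]), hpr]
      simp only [if_true, one_pow, mul_one, mult, hw₀]
      refine key.trans_le ?_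
      conv_lhs => rw [← one_mul (ENNReal.ofNNReal _)]
      gcongr
      exact_mod_cast one_le_convexBodyLTFactor K
    obtain ⟨a, h_nz, h_le⟩ := exists_ne_zero_mem_ringOfIntegers_lt K hv
    refine ⟨a, fun z hz => h_nz ?_, fun w => ?_⟩
    · have h1 := h_le w₀
      rw [if_pos rfl, hz, ← norm_embedding_eq] at h1
      simp only [map_intCast, Complex.norm_intCast, NNReal.coe_one] at h1
      have : |z| < 1 := by exact_mod_cast h1
      have hz0 : z = 0 := Int.abs_lt_one_iff.1 this
      rw [hz0] at hz
      exact_mod_cast hz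
    · refine (h_le w).le.trans ?_
      split_ifs
      · simp; linarith
      · simp; linarith
  · have hc := not_isReal_iff_isComplex.mp hw₀
    have hv : minkowskiBound K ↑1 < MeasureTheory.volume
        (convexBodyLT' K (fun w ↦ if w = w₀ then NNReal.sqrt lam else (lam:NNReal)) ⟨w₀, hc⟩) := by
      rw [convexBodyLT'_volume, ← Finset.prod_erase_mul _ _ (Finset.mem_univ w₀)]
      rw [Finset.prod_congr rfl (g := fun w => (lam:NNReal) ^ mult w)
        (fun w hw => by rw [if_neg (Finset.ne_of_mem_erase hw)]), hpr]
      simp only [if_true, mult, hw₀, if_false, NNReal.sq_sqrt]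
      refine key.trans_le ?_
      have h2 : 2 ≤ finrank ℚ K := by
        rw [← sum_mult_eq (K := K)]
        refine le_trans ?_ (Finset.single_le_sum (fun _ _ => Nat.zero_le _) (Finset.mem_univ w₀))
        simp [mult, hw₀]
      rw [← pow_succ, show finrank ℚ K - 2 + 1 = finrank ℚ K - 1 by omega]
      conv_lhs => rw [← one_mul (ENNReal.ofNNReal _)]
      gcongr
      exact_mod_cast one_le_convexBodyLT'Factor K
    obtain ⟨a, h_nz, h_le, h_re, h_im⟩ := exists_ne_zero_mem_ringOfIntegers_lt' K ⟨w₀, hc⟩ hv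
    refine ⟨a, fun z hz => h_nz ?_, fun w => ?_⟩
    · rw [hz] at h_re
      simp only [map_intCast, Complex.intCast_re] at h_re
      have : |z| < 1 := by exact_mod_cast h_re
      have hz0 : z = 0 := Int.abs_lt_one_iff.1 this
      rw [hz0] at hz
      exact_mod_cast hz
    · by_cases h_eq : w = w₀
      · rw [if_pos rfl] at h_im
        subst h_eq
        rw [← norm_embedding_eq]
        refine (Complex.norm_le_abs_re_add_abs_im _).trans ?_
        have : ((NNReal.sqrt (lam:NNReal) : NNReal) : ℝ) ^ 2 = lam := by
          exact_mod_cast NNReal.sq_sqrt (lam : NNReal)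
        rw [this] at h_im
        dsimp only at h_re h_im
        linarith
      · refine (h_le w h_eq).le.trans ?_
        rw [if_neg h_eq]; simp; linarith

/-- trace zero generator with small conjugates -/
lemma small_gen {n : ℕ} (hn : 2 ≤ n) (L : IntermediateField ℚ ℂ) [FiniteDimensional ℚ L]
    (hL : Module.finrank ℚ L = n) (hm : NoMid L) (lam : ℕ) (hl : 1 ≤ lam)
    (h : 4 ^ n * |discr L| < (lam:ℤ) ^ (2 * (n - 1))) :
    ∃ γ : ℂ, ℚ⟮γ⟯ = L ∧ ∃ q : ℤ[X], q.Monic ∧ q.natDegree = n ∧ Irreducible q ∧ aeval γ q = 0 ∧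
      q.coeff (n-1) = 0 ∧ ∀ x : ℂ, aeval x q = 0 → ‖x‖ ≤ (4 * n * lam : ℕ) := by
  subst hL
  set n := Module.finrank ℚ L with hndef
  obtain ⟨a, ha, hw⟩ := mink L lam hl h
  have hφ : ∀ φ : L →+* ℂ, ‖φ a‖ ≤ 2 * lam := fun φ => by
    have := hw (InfinitePlace.mk φ)
    rwa [InfinitePlace.apply] at this
  set t : ℤ := Algebra.trace ℤ (𝓞 L) a with ht
  have htQ : ((t:ℤ) : ℚ) = Algebra.trace ℚ L (a : L) := Algebra.coe_trace_int a
  set b : 𝓞 L := (n:𝓞 L) * a - (t : 𝓞 L) with hb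
  have hbL : (b : L) = (n:L) * (a:L) - (t:L) := by simp [hb]
  have htrb : Algebra.trace ℚ L (b : L) = 0 := by
    rw [hbL, map_sub]
    have e1 : (n : L) * (a:L) = (n:ℚ) • (a:L) := by rw [Algebra.smul_def]; simp
    have e2 : (t : L) = algebraMap ℚ L (t:ℚ) := by simp
    rw [e1, e2, map_smul, Algebra.trace_algebraMap, ← htQ, ← hndef]
    simp
  have htn : ‖((t:ℤ):ℂ)‖ ≤ n * (2 * lam) := by
    have := trace_eq_sum_embeddings (K := ℚ) (L := L) (E := ℂ) (x := (a:L))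
    rw [← htQ] at this
    have e : ((t:ℤ):ℂ) = algebraMap ℚ ℂ ((t:ℤ):ℚ) := by simp
    rw [e, this]
    refine (norm_sum_le _ _).trans ?_
    refine (Finset.sum_le_card_nsmul Finset.univ (fun σ : L →ₐ[ℚ] ℂ => ‖σ a‖) (2 * (lam:ℝ))
      (fun σ _ => hφ (σ : L →+* ℂ))).trans ?_
    rw [Finset.card_univ, AlgHom.card, nsmul_eq_mul]
  have hbn : ∀ φ : L →+* ℂ, ‖φ b‖ ≤ (4 * n * lam : ℕ) := fun φ => by
    rw [hbL, map_sub, map_mul, map_natCast, map_intCast]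
    refine (norm_sub_le _ _).trans ?_
    rw [norm_mul, Complex.norm_natCast]
    have := mul_le_mul_of_nonneg_left (hφ φ) (Nat.cast_nonneg (α := ℝ) n)
    push_cast
    linarith
  have hn0 : (n : L) ≠ 0 := by exact_mod_cast (by omega : n ≠ 0)
  have hbz : ∀ r : ℚ, (b : L) ≠ algebraMap ℚ L r := by
    intro r hr
    have : (a : L) = algebraMap ℚ L ((r + t) / n) := by
      rw [hbL] at hr
      simp only [map_div₀, map_add, map_natCast, map_intCast]
      rw [← hr]; field_simp; ring
    have hint : IsIntegral ℤ (((r + t) / n : ℚ)) := by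
      have h3 : IsIntegral ℤ (algebraMap ℚ L ((r + t) / n)) := this ▸ a.isIntegral_coe
      exact (isIntegral_algebraMap_iff (algebraMap ℚ L).injective).1 h3
    obtain ⟨z, hz⟩ := IsIntegrallyClosed.isIntegral_iff.1 hint
    apply ha z
    rw [this, ← hz]; simp
  have hgen : ℚ⟮((b : L) : ℂ)⟯ = L := by
    rcases hm ℚ⟮((b : L) : ℂ)⟯ (by
      rw [adjoin_simple_le_iff]; exact (b : L).2) with h | h
    · exfalso
      rw [adjoin_simple_eq_bot_iff, mem_bot] at h
      obtain ⟨r, hr⟩ := h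
      apply hbz r
      apply Subtype.ext
      rw [← hr]; simp
    · exact h
  have hintb : IsIntegral ℤ ((b : L) : ℂ) := b.isIntegral_coe.map (L.val.restrictScalars ℤ)
  have hintL : IsIntegral ℤ (b : L) := b.isIntegral_coe
  have hmp : minpoly ℤ ((b : L) : ℂ) = minpoly ℤ (b : L) :=
    minpoly.algebraMap_eq (A := ℤ) (B := L) (B' := ℂ) (algebraMap L ℂ).injective (b:L)
  have hmQ : (minpoly ℤ (b:L)).map (algebraMap ℤ ℚ) = minpoly ℚ (b:L) :=
    (minpoly.isIntegrallyClosed_eq_field_fractions' ℚ hintL).symm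
  have hmon := minpoly.monic hintL
  have hdeg : (minpoly ℤ (b:L)).natDegree = n := by
    rw [← hmp, ← (minpoly.monic hintb).natDegree_map (algebraMap ℤ ℚ),
      ← minpoly.isIntegrallyClosed_eq_field_fractions' ℚ hintb,
      ← adjoin.finrank (hintb.tower_top), hgen]
  refine ⟨((b : L) : ℂ), hgen, minpoly ℤ (b : L), hmon, hdeg, minpoly.irreducible hintL, ?_, ?_, ?_⟩
  · rw [← hmp]; exact minpoly.aeval _ _
  · have hprim : ℚ⟮(b:L)⟯ = ⊤ := by
      rw [Field.primitive_element_iff_minpoly_natDegree_eq, ← hmQ, hmon.natDegree_map, hdeg]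
    have h1 := trace_eq_finrank_mul_minpoly_nextCoeff ℚ (b:L)
    rw [htrb, ← hmQ] at h1
    have hfr : Module.finrank ℚ⟮(b:L)⟯ L ≠ 0 := Module.finrank_pos.ne'
    have h2 : ((minpoly ℤ (b:L)).map (algebraMap ℤ ℚ)).nextCoeff = 0 := by
      have := mul_eq_zero.1 h1.symm
      rcases this with h | h
      · exact absurd (by exact_mod_cast h) hfr
      · linarith
    rw [nextCoeff_map (algebraMap ℤ ℚ).injective_int, nextCoeff_of_natDegree_pos (by omega), hdeg] at h2
    simpa using h2
  · intro x hx
    have hx' : aeval x (minpoly ℚ (b:L)) = 0 := by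
      rw [← hmQ, aeval_map_algebraMap]; exact hx
    have := (NumberField.Embeddings.range_eval_eq_rootSet_minpoly L ℂ (b:L))
    have hxr : x ∈ (minpoly ℚ (b:L)).rootSet ℂ := by
      rw [mem_rootSet]; exact ⟨minpoly.ne_zero hintL.tower_top, hx'⟩
    rw [← this] at hxr
    obtain ⟨φ, rfl⟩ := hxr
    exact hbn φ

end
end ModD1

section ModD2
open Polynomial NumberField IntermediateField

noncomputable section

lemma choose_lam (m A : ℕ) (hm : 1 ≤ m) (hA : 1 ≤ A) : ∃ lam : ℕ, 1 ≤ lam ∧ A < lam ^ m ∧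
    lam ^ m ≤ 2 ^ m * A := by
  have hex : ∃ l : ℕ, A < l ^ m := ⟨A + 1, (Nat.lt_succ_self A).trans_le (Nat.le_self_pow (by omega) _)⟩
  refine ⟨Nat.find hex, ?_, Nat.find_spec hex, ?_⟩
  · by_contra h
    have h0 : Nat.find hex = 0 := by omega
    have := Nat.find_spec hex
    rw [h0, zero_pow (by omega)] at this; omega
  · set l := Nat.find hex with hl
    have h1 : A < l ^ m := Nat.find_spec hex
    have h2 : 2 ≤ l := by
      by_contra h
      have : l ^ m ≤ 1 ^ m := Nat.pow_le_pow_left (by omega) m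
      rw [one_pow] at this; omega
    have h3 : ¬ A < (l - 1) ^ m := Nat.find_min hex (by omega)
    calc l ^ m ≤ (2 * (l - 1)) ^ m := Nat.pow_le_pow_left (by omega) m
      _ = 2 ^ m * (l-1) ^ m := mul_pow _ _ _
      _ ≤ _ := Nat.mul_le_mul_left _ (by omega)

lemma ncard_biUnion_le_real {ι β : Type*} (s : Finset ι) (T : ι → Set β) (c : ℝ)
    (h : ∀ i ∈ s, ((T i).ncard : ℝ) ≤ c) : ((⋃ i ∈ s, T i).ncard : ℝ) ≤ s.card * c := by
  have : ((⋃ i ∈ s, T i).ncard : ℝ) ≤ ∑ i ∈ s, ((T i).ncard : ℝ) := by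
    exact_mod_cast Finset.set_ncard_biUnion_le s T
  refine this.trans ((Finset.sum_le_card_nsmul _ _ _ h).trans ?_)
  rw [nsmul_eq_mul]

lemma caseII {n : ℕ} (hn : 2 ≤ n) (Pf : ℤ[X] → Prop) (Q : ℕ → Set ℤ[X]) (C0 : ℝ) (hC0 : 0 < C0)
    (W : ℕ) (hW : 1 ≤ W)
    (hQ : ∀ lam : ℕ, 1 ≤ lam →
      (Q lam).Finite ∧ ((Q lam).ncard : ℝ) ≤ C0 * (lam:ℝ) ^ ((n-1)*(n-2)))
    (hQ2 : ∀ (f q : ℤ[X]) (α γ : ℂ) (lam : ℕ), 1 ≤ lam → Pf f → f.Monic → f.natDegree = n →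
      Irreducible f → aeval α f = 0 →
      ℚ⟮γ⟯ = ℚ⟮α⟯ → q.Monic → q.natDegree = n → Irreducible q → aeval γ q = 0 →
      q.coeff (n-1) = 0 → (∀ x : ℂ, aeval x q = 0 → ‖x‖ ≤ (4 * n * lam : ℕ)) → q ∈ Q lam) :
    SmallP n (fun N => {f | f ∈ PBox n N ∧ Irreducible f ∧ Pf f ∧ ∃ α : ℂ, aeval α f = 0 ∧
      NoMid ℚ⟮α⟯ ∧ ∃ _ : FiniteDimensional ℚ ℚ⟮α⟯, |discr ℚ⟮α⟯| ≤ (W * N ^ 2 : ℕ)}) := by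
  classical
  refine ⟨C0 * (2 ^ (n-1) * (2 ^ n * W)) ^ (n-2) * (n * (20 ^ n * ((n+1:ℕ) * Lg (n+1) ^ n))),
    by have := Lg_one_le (n+1); positivity, n, fun N hN => ⟨(PBox_finite n N).subset fun f hf => hf.1, ?_⟩⟩
  obtain ⟨lam, hl1, hl2, hl3⟩ := choose_lam (n-1) (2 ^ n * W * N) (by omega)
    (Nat.one_le_iff_ne_zero.2 (by positivity))
  obtain ⟨hfin, hcard⟩ := hQ lam hl1
  let Q' : Finset ℤ[X] := hfin.toFinset.filter
    (fun q => q.Monic ∧ q.natDegree = n ∧ Irreducible q)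
  let R : Finset ℂ := Q'.biUnion (fun q => (q.map (algebraMap ℤ ℂ)).roots.toFinset)
  have hR : (R.card : ℝ) ≤ C0 * (lam:ℝ) ^ ((n-1)*(n-2)) * n := by
    have h1 : R.card ≤ Q'.card * n := by
      apply Finset.card_biUnion_le_card_mul
      intro q hq
      refine (Multiset.toFinset_card_le _).trans ((card_roots' _).trans ?_)
      have hq2 := (Finset.mem_filter.1 hq).2
      rw [hq2.1.natDegree_map, hq2.2.1]
    have h2 : Q'.card ≤ (Q lam).ncard := by
      rw [Set.ncard_eq_toFinset_card _ hfin]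
      exact Finset.card_filter_le _ _
    calc (R.card : ℝ) ≤ Q'.card * n := by exact_mod_cast h1
      _ ≤ (Q lam).ncard * n := by gcongr
      _ ≤ _ := by gcongr
  have hsub : {f | f ∈ PBox n N ∧ Irreducible f ∧ Pf f ∧ ∃ α : ℂ, aeval α f = 0 ∧
      NoMid ℚ⟮α⟯ ∧ ∃ _ : FiniteDimensional ℚ ℚ⟮α⟯, |discr ℚ⟮α⟯| ≤ (W * N ^ 2 : ℕ)} ⊆
      ⋃ γ ∈ R, {f | f ∈ PBox n N ∧ Irreducible f ∧ ∃ α : ℂ, aeval α f = 0 ∧ ℚ⟮α⟯ = ℚ⟮γ⟯} := by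
    rintro f ⟨hf, hirr, hPf, α, hα, hno, hfd, hdisc⟩
    have hfr : Module.finrank ℚ ℚ⟮α⟯ = n := by rw [finrank_of_root hf.1 hirr hα, hf.2.1]
    have hlt : 4 ^ n * |discr ℚ⟮α⟯| < (lam:ℤ) ^ (2 * (n - 1)) := by
      have h1 : 4 ^ n * (W * N^2) < lam ^ (2 * (n-1)) := by
        calc 4 ^ n * (W * N^2) ≤ 4 ^ n * (W^2 * N^2) := by
              gcongr; exact Nat.le_self_pow (by omega) _
          _ = (2 ^ n * W * N) ^ 2 := by
              rw [show (4:ℕ) = 2^2 by norm_num, ← pow_mul, mul_pow, mul_pow, ← pow_mul]; ring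
          _ < (lam ^ (n-1))^2 := Nat.pow_lt_pow_left hl2 (by omega)
          _ = _ := by rw [← pow_mul, mul_comm]
      calc (4:ℤ) ^ n * |discr ℚ⟮α⟯| ≤ 4 ^ n * ((W * N^2 : ℕ):ℤ) := by gcongr
        _ < _ := by exact_mod_cast h1
    obtain ⟨γ, hγ, q, hq1, hq2, hq3, hq4, hq5, hq6⟩ := small_gen hn ℚ⟮α⟯ hfr hno lam hl1 hlt
    have hqQ := hQ2 f q α γ lam hl1 hPf hf.1 hf.2.1 hirr hα hγ hq1 hq2 hq3 hq4 hq5 hq6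
    simp only [Set.mem_iUnion]
    refine ⟨γ, ?_, hf, hirr, α, hα, hγ.symm⟩
    rw [Finset.mem_biUnion]
    refine ⟨q, Finset.mem_filter.2 ⟨hfin.mem_toFinset.2 hqQ, hq1, hq2, hq3⟩, ?_⟩
    rw [Multiset.mem_toFinset, mem_roots (hq1.map _).ne_zero, IsRoot, eval_map_algebraMap, hq4]
  have hfc : ∀ γ ∈ R, (({f | f ∈ PBox n N ∧ Irreducible f ∧ ∃ α : ℂ, aeval α f = 0 ∧
      ℚ⟮α⟯ = ℚ⟮γ⟯} : Set ℤ[X]).ncard : ℝ) ≤ 20 ^ n * ((n+1) * N : ℕ) * Lg ((n+1)*N) ^ n := by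
    intro γ hγ
    obtain ⟨q, hq, hr⟩ := Finset.mem_biUnion.1 hγ
    obtain ⟨-, hq1, hq2, hq3⟩ := Finset.mem_filter.1 hq
    rw [Multiset.mem_toFinset, mem_roots (hq1.map _).ne_zero, IsRoot, eval_map_algebraMap] at hr
    have := fd_of_root hq1 hr
    exact field_count N (by omega) ℚ⟮γ⟯ (by rw [finrank_of_root hq1 hq3 hr, hq2])
  have hfinU : (⋃ γ ∈ R, {f | f ∈ PBox n N ∧ Irreducible f ∧ ∃ α : ℂ, aeval α f = 0 ∧
      ℚ⟮α⟯ = ℚ⟮γ⟯}).Finite := (PBox_finite n N).subset fun f hf => by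
    simp only [Set.mem_iUnion] at hf
    obtain ⟨_, _, h, _⟩ := hf; exact h
  refine le_trans (Nat.cast_le.2 (Set.ncard_le_ncard hsub hfinU)) ?_
  refine (ncard_biUnion_le_real R _ _ hfc).trans ?_
  have hlamR : (lam:ℝ) ^ ((n-1)*(n-2)) ≤ (2 ^ (n-1) * (2 ^ n * W)) ^ (n-2) * (N:ℝ) ^ (n-2) := by
    rw [pow_mul, ← mul_pow]
    gcongr
    have : ((lam ^ (n-1) : ℕ):ℝ) ≤ ((2 ^ (n-1) * (2 ^ n * W * N) : ℕ) : ℝ) := by exact_mod_cast hl3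
    push_cast at this
    linarith
  have hLg : Lg ((n+1)*N) ^ n ≤ Lg (n+1) ^ n * Lg N ^ n := by
    rw [← mul_pow]
    have := Lg_one_le ((n+1)*N)
    exact pow_le_pow_left₀ (by linarith) (Lg_mul_le _ _ (by omega) (by omega)) n
  have hN1 : (N:ℝ) ^ (n-1) = N ^ (n-2) * N := by rw [← pow_succ]; congr 1; omega
  have p1 := Lg_one_le (n+1)
  have p2 := Lg_one_le N
  have p3 := Lg_one_le ((n+1)*N)
  calc (R.card:ℝ) * (20 ^ n * ((n+1) * N : ℕ) * Lg ((n+1)*N) ^ n)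
      ≤ (C0 * ((2 ^ (n-1) * (2 ^ n * W)) ^ (n-2) * (N:ℝ) ^ (n-2)) * n) *
        (20 ^ n * ((n+1) * N : ℕ) * (Lg (n+1) ^ n * Lg N ^ n)) := by
        gcongr
        exact hR.trans (by gcongr)
    _ = _ := by rw [hN1]; push_cast; ring

lemma wbox_of_roots {n lam : ℕ} {q : ℤ[X]} (hq1 : q.Monic) (hq2 : q.natDegree = n)
    (hq6 : ∀ x : ℂ, aeval x q = 0 → ‖x‖ ≤ (4 * n * lam : ℕ)) (i : ℕ) :
    |q.coeff i| ≤ (2 ^ n * (4 * n * lam) ^ (n - i) : ℕ) := by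
  have h := coeff_le_of_roots_le (f := algebraMap ℤ ℂ) (p := q) i hq1 (IsAlgClosed.splits _)
    (B := (4 * n * lam : ℕ)) (by
      intro z hz
      rw [mem_roots (hq1.map _).ne_zero, IsRoot, eval_map_algebraMap] at hz
      exact hq6 z hz)
  rw [coeff_map, hq2] at h
  simp only [algebraMap_int_eq, eq_intCast, Complex.norm_intCast] at h
  have h2 : ((n.choose i : ℕ):ℝ) ≤ 2 ^ n := by exact_mod_cast Nat.choose_le_two_pow n i
  have : ((|q.coeff i| : ℤ):ℝ) ≤ ((2 ^ n * (4 * n * lam) ^ (n - i) : ℕ) : ℝ) := by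
    push_cast
    push_cast at h
    refine h.trans ?_
    rw [mul_comm]; gcongr
  exact_mod_cast this

lemma caseII_six {n : ℕ} (hn : 6 ≤ n) (W : ℕ) (hW : 1 ≤ W) :
    SmallP n (fun N => {f | f ∈ PBox n N ∧ Irreducible f ∧ True ∧ ∃ α : ℂ, aeval α f = 0 ∧
      NoMid ℚ⟮α⟯ ∧ ∃ _ : FiniteDimensional ℚ ℚ⟮α⟯, |discr ℚ⟮α⟯| ≤ (W * N ^ 2 : ℕ)}) := by
  let B : ℕ → ℕ → ℕ := fun lam i => if i = n - 1 then 0 else 2 ^ n * (4 * n * lam) ^ (n - i)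
  refine caseII (by omega) (fun _ => True) (fun lam => WBox n (B lam))
    (((∏ i ∈ Finset.range (n-1), (3 * (2 ^ n * (4 * n) ^ (n-i))) : ℕ)):ℝ) ?_ W hW ?_ ?_
  · exact_mod_cast Finset.prod_pos fun i _ => by positivity
  · intro lam hl
    refine ⟨(WBox_finite_card n _).1, ?_⟩
    have h1 := (WBox_finite_card n (B lam)).2
    have h2 : ∏ i ∈ Finset.range n, (2 * B lam i + 1) ≤
        (∏ i ∈ Finset.range (n-1), (3 * (2 ^ n * (4 * n) ^ (n-i)))) * lam ^ ((n-1)*(n-2)) := by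
      obtain ⟨m, rfl⟩ : ∃ m, n = m + 1 := ⟨n-1, by omega⟩
      rw [Finset.prod_range_succ]
      have hB : B lam m = 0 := by simp [B]
      rw [hB, mul_zero, zero_add, mul_one]
      have h3 : ∀ i ∈ Finset.range m, 2 * B lam i + 1 ≤
          3 * (2 ^ (m+1) * (4 * (m+1)) ^ (m+1-i)) * lam ^ (m+1-i) := by
        intro i hi
        have hi' := Finset.mem_range.1 hi
        have : B lam i = 2 ^ (m+1) * (4 * (m+1)) ^ (m+1-i) * lam ^ (m+1-i) := by
          simp only [B]; rw [if_neg (by omega), mul_pow, ← mul_assoc]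
        rw [this]
        have : 1 ≤ 2 ^ (m+1) * (4 * (m+1)) ^ (m+1-i) * lam ^ (m+1-i) :=
          Nat.one_le_iff_ne_zero.2 (by positivity)
        nlinarith
      refine (Finset.prod_le_prod' h3).trans ?_
      rw [Finset.prod_mul_distrib]
      simp only [Nat.add_sub_cancel]
      gcongr
      rw [Finset.prod_pow_eq_pow_sum]
      apply Nat.pow_le_pow_right hl
      have h4 : ∑ i ∈ Finset.range m, (m + 1 - i) = ∑ i ∈ Finset.range m, (i + 2) := by
        rw [← Finset.sum_range_reflect]
        apply Finset.sum_congr rfl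
        intro i hi
        have hi' := Finset.mem_range.1 hi
        omega
      rw [h4, Finset.sum_add_distrib]
      have h5 := Finset.sum_range_id_mul_two m
      simp only [Finset.sum_const, Finset.card_range, smul_eq_mul]
      obtain ⟨r, rfl⟩ : ∃ r, m = r + 5 := ⟨m-5, by omega⟩
      have : r + 5 + 1 - 2 = r + 4 := by omega
      rw [this]
      have : r + 5 - 1 = r + 4 := by omega
      rw [this] at h5
      nlinarith
    exact_mod_cast h1.trans h2
  · intro f q α γ lam hl _ _ _ _ _ _ hq1 hq2 _ _ hq5 hq6
    refine ⟨hq1, hq2, fun i hi => ?_⟩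
    simp only [B]
    split_ifs with h
    · rw [h, hq5]; simp
    · exact wbox_of_roots hq1 hq2 hq6 i

end
end ModD2

section ModT1
open Polynomial NumberField IntermediateField

lemma local_zmod (l m : ℕ) [hl : Fact l.Prime] (hm : m ≠ 0) : IsLocalRing (ZMod (l ^ m)) := by
  have : Fact (1 < l ^ m) := ⟨Nat.one_lt_pow hm hl.out.one_lt⟩
  have : Nontrivial (ZMod (l ^ m)) := ZMod.nontrivial _
  exact IsLocalRing.of_surjective' (PadicInt.toZModPow (p := l) m)
    (ZMod.ringHom_surjective _)

lemma trace_idem {l m n : ℕ} [hl : Fact l.Prime] (hm : m ≠ 0) (hn : n < l ^ m)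
    (A : Matrix (Fin n) (Fin n) (ZMod (l ^ m))) (hA : A * A = A) (h0 : A ≠ 0) : A.trace ≠ 0 := by
  have := local_zmod l m hm
  let R := ZMod (l ^ m)
  set e := Matrix.toLin' A with he
  have hid : IsIdempotentElem e := by
    unfold IsIdempotentElem
    rw [he, Module.End.mul_eq_comp, ← Matrix.toLin'_mul, hA]
  have hproj := LinearMap.IsIdempotentElem.isProj_range _ hid
  have hid' : IsIdempotentElem (1 - e) := hid.one_sub
  have hker : LinearMap.ker e = LinearMap.range (1 - e) := by
    ext x
    constructor
    · intro hx
      exact ⟨x, by simp [LinearMap.mem_ker.1 hx]⟩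
    · rintro ⟨y, rfl⟩
      rw [LinearMap.mem_ker, ← Module.End.mul_apply, mul_sub, mul_one, hid.eq, sub_self]; rfl
  have hfree : ∀ g : (Fin n → R) →ₗ[R] (Fin n → R), IsIdempotentElem g →
      Module.Free R (LinearMap.range g) := by
    intro g hg
    have : Module.Projective R (LinearMap.range g) := by
      refine Module.Projective.of_split (LinearMap.range g).subtype g.rangeRestrict ?_
      ext ⟨x, y, rfl⟩
      have := LinearMap.congr_fun hg.eq y
      simp only [Module.End.mul_apply] at this
      simp [this]
    exact Module.free_of_flat_of_isLocalRing
  have i1 := hfree e hid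
  have i2 : Module.Free R (LinearMap.ker e) := by rw [hker]; exact hfree _ hid'
  have i3 : Module.Finite R (LinearMap.ker e) := by rw [hker]; infer_instance
  have ht := hproj.trace
  rw [he, Matrix.trace_toLin'_eq, ← he] at ht
  rw [ht]
  intro hz
  rw [ZMod.natCast_eq_zero_iff] at hz
  have hle : Module.finrank R (LinearMap.range e) ≤ n := by
    have := LinearMap.finrank_range_le e
    simpa using this
  rcases Nat.eq_zero_or_pos (Module.finrank R (LinearMap.range e)) with h | h
  · rw [Module.finrank_eq_zero_iff_of_free, Submodule.subsingleton_iff_eq_bot,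
      LinearMap.range_eq_bot] at h
    apply h0
    exact (Matrix.toLin' : Matrix (Fin n) (Fin n) R ≃ₗ[R] _).map_eq_zero_iff.1 h
  · have := Nat.le_of_dvd h hz
    omega

lemma not_dvd_diff (K : Type*) [Field K] [NumberField K] {l m e : ℕ} [hl : Fact l.Prime] (hm : m ≠ 0)
    (he : e ≠ 0)
    (hn : Module.finrank ℚ K < l ^ m) (P Q : Ideal (𝓞 K)) (hP : P ≠ ⊤) (hPQ : IsCoprime P Q)
    (h : P ^ e * Q = Ideal.span {(l : 𝓞 K)}) :
    ¬ P ^ (e * m) ∣ differentIdeal ℤ (𝓞 K) := by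
  have hpow : P ^ (e * m) * Q ^ m = Ideal.map (algebraMap ℤ (𝓞 K)) (Ideal.span {((l:ℤ) ^ m)}) := by
    rw [pow_mul, ← mul_pow, h, Ideal.map_span, Ideal.span_singleton_pow]; simp
  have hcop : IsCoprime (P ^ (e*m)) (Q ^ m) := hPQ.pow
  obtain ⟨u, hu, x, hx, hux⟩ := Ideal.isCoprime_iff_exists.1 hcop
  refine not_dvd_differentIdeal_of_intTrace_not_mem ℤ _ _ hpow x hx ?_
  rw [Algebra.intTrace_eq_trace, Ideal.mem_span_singleton]
  have hdvd : (((l:ℤ)^m : ℤ) : 𝓞 K) ∣ x * x - x := by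
    rw [← Ideal.mem_span_singleton]
    have : x * x - x = - (u * x) := by linear_combination x * hux
    rw [this]
    have h2 := neg_mem (Ideal.mul_mem_mul hu hx)
    rw [hpow, Ideal.map_span] at h2
    simpa using h2
  obtain ⟨y, hy⟩ := hdvd
  have hxn : ¬ (((l:ℤ)^m : ℤ) : 𝓞 K) ∣ x := by
    intro hd
    rw [← Ideal.mem_span_singleton] at hd
    have h3 : x ∈ P ^ (e*m) := by
      have : x ∈ P ^ (e * m) * Q ^ m := by rw [hpow, Ideal.map_span]; simpa using hd
      exact (Ideal.mul_le_left (I := P ^ (e*m)) (J := Q ^ m)) this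
    have h1 : (1 : 𝓞 K) ∈ P ^ (e*m) := by rw [← hux]; exact add_mem hu h3
    exact hP ((Ideal.eq_top_iff_one _).2 (Ideal.pow_le_self (by positivity) h1))
  let b : Module.Basis (Fin (Module.finrank ℚ K)) ℤ (𝓞 K) :=
    (RingOfIntegers.basis K).reindex (Fintype.equivFinOfCardEq (by
      rw [← Module.finrank_eq_card_chooseBasisIndex, RingOfIntegers.rank]))
  rw [Algebra.trace_eq_matrix_trace b]
  set A := Algebra.leftMulMatrix b x with hA
  let φ := Int.castRingHom (ZMod (l ^ m))
  have hφ : ∀ z : ℤ, φ z = 0 ↔ (l:ℤ)^m ∣ z := fun z => by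
    simp only [φ, eq_intCast]
    rw [ZMod.intCast_zmod_eq_zero_iff_dvd]; push_cast; rfl
  have hsm : ∀ y : 𝓞 K, (Algebra.leftMulMatrix b ((((l:ℤ)^m : ℤ) : 𝓞 K) * y)).map φ = 0 := by
    intro y
    have : (((l:ℤ)^m : ℤ) : 𝓞 K) * y = ((l:ℤ)^m) • y := by rw [zsmul_eq_mul]
    rw [this, map_smul]
    ext i j
    simp only [Matrix.map_apply, Matrix.smul_apply, Matrix.zero_apply]
    rw [hφ]; exact ⟨_, rfl⟩
  have hidem : A.map φ * A.map φ = A.map φ := by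
    rw [← Matrix.map_mul, hA, ← map_mul]
    have : x * x = x + (((l:ℤ)^m : ℤ) : 𝓞 K) * y := by rw [← hy]; ring
    rw [this, map_add, Matrix.map_add _ (map_add φ), hsm, add_zero]
  have hne : A.map φ ≠ 0 := by
    intro hz
    apply hxn
    have h1 : ∀ i, (l:ℤ)^m ∣ b.repr x i := by
      have hx1 : x = x * 1 := (mul_one x).symm
      intro i
      have : b.repr x i = ∑ j, A i j * b.repr 1 j := by
        conv_lhs => rw [hx1]
        rw [← Algebra.leftMulMatrix_mulVec_repr b]; rfl
      rw [this]
      apply Finset.dvd_sum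
      intro j _
      apply Dvd.dvd.mul_right
      rw [← hφ]
      have := congr_fun (congr_fun hz i) j
      simpa using this
    choose c hc using h1
    refine ⟨∑ i, c i • b i, ?_⟩
    conv_lhs => rw [← b.sum_repr x]
    rw [Finset.mul_sum]
    refine Finset.sum_congr rfl fun i _ => ?_
    rw [hc i, mul_smul, zsmul_eq_mul]
  have hfin := trace_idem hm hn _ hidem hne
  intro hd
  apply hfin
  rw [← hφ] at hd
  rw [← hd]
  simp [Matrix.trace, map_sum]
end ModT1

section ModT2
open Polynomial NumberField IntermediateField

lemma ideal_dvd_of {R : Type*} [CommRing R] [IsDedekindDomain R] {I M : Ideal R} (hI : I ≠ 0)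
    (h : ∀ P : Ideal R, Prime P → ∀ k, P ^ k ∣ I → P ^ k ∣ M) : I ∣ M := by
  rw [UniqueFactorizationMonoid.dvd_iff_emultiplicity_le hI]
  intro P hP
  exact emultiplicity_le_emultiplicity_iff.2 (fun k hk => h P hP k hk)

lemma exists_l {K : Type*} [Field K] [NumberField K] {P : Ideal (𝓞 K)} (hP : Prime P) :
    ∃ l : ℕ, l.Prime ∧ (l : 𝓞 K) ∈ P := by
  have hPr := Ideal.isPrime_of_prime hP
  have h1 : ((Ideal.absNorm P : ℕ) : 𝓞 K) ∈ P := Ideal.absNorm_mem P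
  have h0 : Ideal.absNorm P ≠ 0 := by
    rw [Ne, Ideal.absNorm_eq_zero_iff]; exact hP.ne_zero
  rw [← Nat.prod_primeFactorsList h0, Nat.cast_list_prod] at h1
  obtain ⟨x, hx, hxP⟩ : ∃ x ∈ (Ideal.absNorm P).primeFactorsList.map (Nat.cast : ℕ → 𝓞 K), x ∈ P := by
    have h2 := (hPr.multiset_prod_mem_iff_exists_mem
      (((Ideal.absNorm P).primeFactorsList.map (Nat.cast : ℕ → 𝓞 K)))).1 (by simpa using h1)
    simpa using h2
  obtain ⟨l, hl, rfl⟩ := List.mem_map.1 hx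
  exact ⟨l, Nat.prime_of_mem_primeFactorsList hl, hxP⟩

/-- local bound -/
lemma diff_local {K : Type*} [Field K] [NumberField K] {P : Ideal (𝓞 K)} (hP : Prime P) {l : ℕ}
    (hl : l.Prime) (hlP : (l : 𝓞 K) ∈ P) (m : ℕ) (hm : m ≠ 0) (hn : Module.finrank ℚ K < l ^ m)
    (k : ℕ) (hk : P ^ k ∣ differentIdeal ℤ (𝓞 K)) :
    P ^ (k + 1) ∣ Ideal.span {((l ^ m : ℕ) : 𝓞 K)} := by
  have hPr := Ideal.isPrime_of_prime hP
  have : Fact l.Prime := ⟨hl⟩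
  have hl0 : Ideal.span {(l : 𝓞 K)} ≠ 0 := by
    simp [hl.ne_zero]
  have hfm : FiniteMultiplicity P (Ideal.span {(l : 𝓞 K)}) :=
    FiniteMultiplicity.of_prime_left hP hl0
  obtain ⟨Q, hQ, hPQ⟩ := hfm.exists_eq_pow_mul_and_not_dvd
  set e := multiplicity P (Ideal.span {(l : 𝓞 K)})
  have he : e ≠ 0 := by
    intro h0
    rw [h0, pow_zero, one_mul] at hQ
    apply hPQ
    rw [← hQ, Ideal.dvd_span_singleton]; exact hlP
  have hmax : P.IsMaximal := hPr.isMaximal hP.ne_zero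
  have hcop : IsCoprime P Q := by
    rw [Ideal.isCoprime_iff_sup_eq]
    by_contra h
    have := hmax.eq_of_le h le_sup_left
    apply hPQ
    rw [Ideal.dvd_iff_le, this]; exact le_sup_right
  have := not_dvd_diff K hm he hn P Q hPr.ne_top hcop hQ.symm
  have hlt : k < e * m := by
    by_contra hge
    exact this ((pow_dvd_pow P (by omega)).trans hk)
  refine (pow_dvd_pow P (show k + 1 ≤ e * m by omega)).trans ?_
  rw [Nat.cast_pow, ← Ideal.span_singleton_pow, hQ, mul_pow, ← pow_mul]
  exact dvd_mul_right _ _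

/-- primes over `l` -/
noncomputable def PO (K : Type*) [Field K] [NumberField K] (l : ℕ) : Finset (Ideal (𝓞 K)) :=
  if h : l = 0 then ∅ else
  (Ideal.finite_factors (I := Ideal.span {(l : 𝓞 K)}) (by simpa using h)).toFinset.image
    (fun v => v.asIdeal)

lemma mem_PO {K : Type*} [Field K] [NumberField K] {l : ℕ} (hl : l ≠ 0) {P : Ideal (𝓞 K)} :
    P ∈ PO K l ↔ Prime P ∧ (l : 𝓞 K) ∈ P := by
  unfold PO
  rw [dif_neg hl, Finset.mem_image]
  constructor
  · rintro ⟨v, hv, rfl⟩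
    rw [Set.Finite.mem_toFinset] at hv
    exact ⟨v.prime, (Ideal.dvd_span_singleton).1 hv⟩
  · rintro ⟨h1, h2⟩
    refine ⟨⟨P, Ideal.isPrime_of_prime h1, h1.ne_zero⟩, ?_, rfl⟩
    rw [Set.Finite.mem_toFinset]
    exact (Ideal.dvd_span_singleton).2 h2

lemma cop_false {R : Type*} [CommRing R] {P : Ideal R} (hP : P ≠ ⊤) {a b : ℕ} (h : Nat.Coprime a b)
    (ha : (a : R) ∈ P) (hb : (b : R) ∈ P) : False := by
  obtain ⟨u, v, huv⟩ := Nat.isCoprime_iff_coprime.2 h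
  apply hP
  rw [Ideal.eq_top_iff_one]
  have : (1 : R) = (u : R) * a + (v : R) * b := by
    exact_mod_cast congrArg (Int.cast : ℤ → R) huv.symm
  rw [this]
  exact add_mem (Ideal.mul_mem_left _ _ ha) (Ideal.mul_mem_left _ _ hb)

lemma eq_l {K : Type*} [Field K] [NumberField K] {P : Ideal (𝓞 K)} (hP : Prime P) {l l' : ℕ}
    (hl : l.Prime) (hl' : l'.Prime) (h : (l : 𝓞 K) ∈ P) (h' : (l' : 𝓞 K) ∈ P) : l = l' := by
  by_contra hne
  exact cop_false (Ideal.isPrime_of_prime hP).ne_top ((Nat.coprime_primes hl hl').2 hne) h h'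

/-- the relevant primes -/
noncomputable def BP (K : Type*) [Field K] [NumberField K] : Finset ℕ :=
  (discr K).natAbs.primeFactors.filter (fun l => Module.finrank ℚ K < l)

lemma discr_bound (K : Type*) [Field K] [NumberField K] :
    (discr K).natAbs * ∏ l ∈ BP K, ∏ P ∈ PO K l, Ideal.absNorm P ≤
      (∏ l ∈ BP K, l) ^ Module.finrank ℚ K *
      ((∏ l ∈ (Finset.range (Module.finrank ℚ K + 1)).filter Nat.Prime,
        l ^ Module.finrank ℚ K)) ^ Module.finrank ℚ K := by
  classical
  set n := Module.finrank ℚ K with hn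
  have hn1 : 1 ≤ n := Module.finrank_pos
  set d := differentIdeal ℤ (𝓞 K)
  have hd0 : d ≠ 0 := differentIdeal_ne_bot
  have hnd : Ideal.absNorm d = (discr K).natAbs := absNorm_differentIdeal K (𝓞 K)
  have hBP : ∀ l ∈ BP K, l.Prime ∧ l ∣ (discr K).natAbs ∧ n < l := by
    intro l hl
    obtain ⟨h1, h2⟩ := Finset.mem_filter.1 hl
    exact ⟨Nat.prime_of_mem_primeFactors h1, Nat.dvd_of_mem_primeFactors h1, h2⟩
  let PP := (BP K).biUnion (PO K)
  have hPP : ∀ P ∈ PP, Prime P := by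
    intro P hP
    obtain ⟨l, hl, hP⟩ := Finset.mem_biUnion.1 hP
    exact ((mem_PO (hBP l hl).1.ne_zero).1 hP).1
  let J : Ideal (𝓞 K) := ∏ P ∈ PP, P
  have hJ0 : J ≠ 0 := Finset.prod_ne_zero_iff.2 fun P hP => (hPP P hP).ne_zero
  have hJn : Ideal.absNorm J = ∏ l ∈ BP K, ∏ P ∈ PO K l, Ideal.absNorm P := by
    rw [map_prod, Finset.prod_biUnion]
    intro l hl l' hl' hne
    rw [Function.onFun, Finset.disjoint_left]
    intro P h1 h2
    have h1 := (mem_PO (hBP l hl).1.ne_zero).1 h1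
    have h2 := (mem_PO (hBP l' hl').1.ne_zero).1 h2
    exact hne (eq_l h1.1 (hBP l hl).1 (hBP l' hl').1 h1.2 h2.2)
  set S := (Finset.range (n + 1)).filter Nat.Prime
  let M : ℕ := (∏ l ∈ BP K, l) * ∏ l ∈ S, l ^ n
  have hM0 : M ≠ 0 := by
    refine mul_ne_zero (Finset.prod_ne_zero_iff.2 fun l hl => (hBP l hl).1.ne_zero)
      (Finset.prod_ne_zero_iff.2 fun l hl => pow_ne_zero _ (Finset.mem_filter.1 hl).2.ne_zero)
  have hspan : ∀ {a : ℕ}, a ∣ M → Ideal.span {((a:ℕ) : 𝓞 K)} ∣ Ideal.span {((M:ℕ) : 𝓞 K)} := by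
    rintro a ⟨c, hc⟩
    rw [hc, Nat.cast_mul, ← Ideal.span_singleton_mul_span_singleton]; exact dvd_mul_right _ _
  have key : d * J ∣ Ideal.span {((M:ℕ) : 𝓞 K)} := by
    apply ideal_dvd_of (mul_ne_zero hd0 hJ0)
    intro P hP k hk
    obtain ⟨l, hl, hlP⟩ := exists_l hP
    by_cases hmem : P ∈ PP
    · have hlB : l ∈ BP K := by
        obtain ⟨l', hl', hP'⟩ := Finset.mem_biUnion.1 hmem
        have h' := ((mem_PO (hBP l' hl').1.ne_zero).1 hP').2
        rwa [eq_l hP hl (hBP l' hl').1 hlP h']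
      rcases k with _ | k
      · simp
      have hJP : J = P * ∏ P' ∈ PP.erase P, P' := (Finset.mul_prod_erase PP id hmem).symm
      have hndv : ¬ P ∣ ∏ P' ∈ PP.erase P, P' := by
        intro hdv
        obtain ⟨P', hP', hdv⟩ := (hP.dvd_finsetProd_iff _).1 hdv
        have hP'2 := hPP P' (Finset.mem_of_mem_erase hP')
        have : P = P' := associated_iff_eq.1 (hP.associated_of_dvd hP'2 hdv)
        exact Finset.ne_of_mem_erase hP' this.symm
      rw [hJP, ← mul_assoc] at hk
      have hk2 := hP.pow_dvd_of_dvd_mul_right _ hndv hk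
      rw [pow_succ, mul_dvd_mul_iff_right hP.ne_zero] at hk2
      have h3 := diff_local hP hl hlP 1 one_ne_zero (by rw [pow_one]; exact (hBP l hlB).2.2) k hk2
      rw [pow_one] at h3
      refine h3.trans (hspan ?_)
      exact (Finset.dvd_prod_of_mem (fun l => l) hlB).trans (dvd_mul_right _ _)
    · have hndv : ¬ P ∣ J := by
        intro hdv
        obtain ⟨P', hP', hdv⟩ := (hP.dvd_finsetProd_iff _).1 hdv
        have : P = P' := associated_iff_eq.1 (hP.associated_of_dvd (hPP P' hP') hdv)
        exact hmem (this ▸ hP')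
      have hk2 := hP.pow_dvd_of_dvd_mul_right _ hndv hk
      rcases k with _ | k
      · simp
      have hPd : P ∣ d := (dvd_pow_self P (by omega)).trans hk2
      have hlD : l ∣ (discr K).natAbs := by
        have h4 : ((discr K).natAbs : 𝓞 K) ∈ P := by
          rw [← hnd]
          exact (Ideal.dvd_iff_le.1 hPd) (Ideal.absNorm_mem d)
        by_contra hnd'
        exact cop_false (Ideal.isPrime_of_prime hP).ne_top
          ((Nat.Prime.coprime_iff_not_dvd hl).2 hnd') hlP h4
      have hln : l ≤ n := by
        by_contra hgt
        apply hmem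
        refine Finset.mem_biUnion.2 ⟨l, Finset.mem_filter.2 ⟨Nat.mem_primeFactors.2
          ⟨hl, hlD, by rw [← hnd]; simpa [Ideal.absNorm_eq_zero_iff] using hd0⟩, by omega⟩, ?_⟩
        exact (mem_PO hl.ne_zero).2 ⟨hP, hlP⟩
      have h3 := diff_local hP hl hlP n (by omega)
        (lt_of_lt_of_le Nat.lt_two_pow_self (Nat.pow_le_pow_left hl.two_le n)) (k+1) hk2
      refine (pow_dvd_pow P (by omega)).trans (h3.trans (hspan ?_))
      exact (Finset.dvd_prod_of_mem (fun l => l ^ n) (Finset.mem_filter.2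
        ⟨Finset.mem_range.2 (by omega), hl⟩)).trans (dvd_mul_left _ _)
  have hnorm := map_dvd Ideal.absNorm key
  rw [map_mul, hnd, hJn, Ideal.absNorm_span_singleton] at hnorm
  have hMn : (Algebra.norm ℤ ((M:ℕ) : 𝓞 K)).natAbs = M ^ n := by
    have : ((M:ℕ) : 𝓞 K) = algebraMap ℤ (𝓞 K) (M:ℤ) := by simp
    rw [this, Algebra.norm_algebraMap, RingOfIntegers.rank]
    simp [hn]
  rw [hMn] at hnorm
  have := Nat.le_of_dvd (by positivity) hnorm
  rwa [mul_pow] at this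
end ModT2

section ModT3
open Polynomial NumberField IntermediateField

/-- size of the radical of `f` mod `l` -/
noncomputable def sR (l : ℕ) (f : ℤ[X]) : ℕ :=
  sInf {s | ∃ r : (ZMod l)[X], r.Monic ∧ r.natDegree = s ∧
    f.map (Int.castRingHom (ZMod l)) ∣ r ^ f.natDegree}

lemma sR_spec {l : ℕ} {f : ℤ[X]} (hl : l.Prime) (hf : f.Monic) (hn : f.natDegree ≠ 0) :
    ∃ r : (ZMod l)[X], r.Monic ∧ r.natDegree = sR l f ∧
    f.map (Int.castRingHom (ZMod l)) ∣ r ^ f.natDegree := by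
  have : Fact l.Prime := ⟨hl⟩
  have : sR l f ∈ {s | ∃ r : (ZMod l)[X], r.Monic ∧ r.natDegree = s ∧
    f.map (Int.castRingHom (ZMod l)) ∣ r ^ f.natDegree} :=
    Nat.sInf_mem ⟨_, f.map (Int.castRingHom (ZMod l)), hf.map _, rfl, dvd_pow_self _ hn⟩
  exact this

lemma sR_le {l : ℕ} {f : ℤ[X]} {r : (ZMod l)[X]} (hr : r.Monic)
    (h : f.map (Int.castRingHom (ZMod l)) ∣ r ^ f.natDegree) : sR l f ≤ r.natDegree :=
  Nat.sInf_le ⟨r, hr, rfl, h⟩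

lemma sR_le_deg {l : ℕ} {f : ℤ[X]} (hl : l.Prime) (hf : f.Monic) (hn : f.natDegree ≠ 0) :
    sR l f ≤ f.natDegree := by
  have : Fact l.Prime := ⟨hl⟩
  have := sR_le (f := f) (hf.map (Int.castRingHom (ZMod l))) (dvd_pow_self _ hn)
  rwa [hf.natDegree_map] at this

lemma dvd_pow_of_roots {l : ℕ} [Fact l.Prime] {k : Type*} [Field k] {f : ℤ[X]} (hf : f.Monic)
    (ι : ZMod l →+* k) (ρ : Multiset k)
    (hρ : f.map (Int.castRingHom k) = (ρ.map (fun a => X - C a)).prod) (r : (ZMod l)[X])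
    (h : ∀ a ∈ ρ, eval₂ ι a r = 0) :
    f.map (Int.castRingHom (ZMod l)) ∣ r ^ f.natDegree := by
  have hcomp : ι.comp (Int.castRingHom (ZMod l)) = Int.castRingHom k := RingHom.ext_int _ _
  rw [← Polynomial.map_dvd_map' ι, Polynomial.map_map, hcomp, hρ, Polynomial.map_pow]
  have hcard : f.natDegree = ρ.card := by
    rw [← hf.natDegree_map (Int.castRingHom k), hρ, natDegree_multiset_prod_X_sub_C_eq_card]
  rw [hcard, ← Multiset.prod_replicate, ← Multiset.map_const']
  exact Multiset.prod_dvd_prod_of_dvd _ _ fun a ha => by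
    rw [dvd_iff_isRoot, IsRoot, eval_map]; exact h a ha

lemma sR_le_card {l : ℕ} (hl : l.Prime) {k : Type*} [Field k] [CharP k l] {f : ℤ[X]} (hf : f.Monic)
    (ρ : Multiset k) [DecidableEq k]
    (hρ : f.map (Int.castRingHom k) = (ρ.map (fun a => X - C a)).prod) :
    sR l f ≤ ρ.toFinset.card := by
  have : Fact l.Prime := ⟨hl⟩
  let ι := ZMod.castHom (dvd_refl l) k
  have hcomp : ι.comp (Int.castRingHom (ZMod l)) = Int.castRingHom k := RingHom.ext_int _ _
  set g := f.map (Int.castRingHom (ZMod l)) with hg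
  have hg0 : g ≠ 0 := (hf.map _).ne_zero
  have hgk : g.map ι = (ρ.map (fun a => X - C a)).prod := by
    rw [hg, Polynomial.map_map, hcomp, hρ]
  let r0 := UniqueFactorizationMonoid.radical g
  have hr00 : r0 ≠ 0 := UniqueFactorizationMonoid.radical_ne_zero
  have hsep : r0.Separable := PerfectField.separable_iff_squarefree.2
    UniqueFactorizationMonoid.squarefree_radical
  let r := r0 * C r0.leadingCoeff⁻¹
  have hrm : r.Monic := monic_mul_leadingCoeff_inv hr00
  have hrd : r.natDegree = r0.natDegree := natDegree_mul_leadingCoeff_inv r0 hr00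
  have hroot : ∀ a : k, eval₂ ι a r0 = 0 ↔ a ∈ ρ := by
    intro a
    have e1 : a ∈ ρ ↔ eval₂ ι a g = 0 := by
      rw [← eval_map, hgk, eval_multiset_prod, Multiset.prod_eq_zero_iff]
      simp [sub_eq_zero]
    rw [e1]
    constructor
    · intro h
      obtain ⟨c, hc⟩ := UniqueFactorizationMonoid.radical_dvd_self (a := g)
      rw [hc, eval₂_mul, h, zero_mul]
    · intro h
      obtain ⟨m, hm⟩ := UniqueFactorizationMonoid.exists_dvd_radical_self_pow hg0
      obtain ⟨c, hc⟩ := hm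
      have : eval₂ ι a (r0 ^ m) = 0 := by
        change eval₂ ι a ((UniqueFactorizationMonoid.radical g) ^ m) = 0
        rw [hc, eval₂_mul, h, zero_mul]
      rw [eval₂_pow] at this
      exact (pow_eq_zero_iff (n := m) (by
        rintro h0
        subst h0; simp at this)).1 this
  have hd : sR l f ≤ r.natDegree := by
    apply sR_le hrm
    apply dvd_pow_of_roots hf ι ρ hρ
    intro a ha
    rw [eval₂_mul, (hroot a).2 ha, zero_mul]
  refine hd.trans ?_
  rw [hrd, ← natDegree_map ι]
  have hspl : (r0.map ι).Splits := by
    refine Splits.of_dvd (g := g.map ι) ?_ ?_ (Polynomial.map_dvd ι UniqueFactorizationMonoid.radical_dvd_self)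
    · rw [hgk]
      exact Splits.multisetProd (by
        intro p hp
        obtain ⟨a, _, rfl⟩ := Multiset.mem_map.1 hp
        exact Splits.X_sub_C a)
    · exact (Polynomial.map_ne_zero hg0)
  rw [hspl.natDegree_eq_card_roots]
  have hnd : (r0.map ι).roots.Nodup := nodup_roots hsep.map
  rw [← Multiset.toFinset_card_of_nodup hnd]
  apply Finset.card_le_card
  intro a ha
  rw [Multiset.mem_toFinset] at ha ⊢
  rw [mem_roots (Polynomial.map_ne_zero hr00), IsRoot, eval_map] at ha
  exact (hroot a).1 ha

lemma exR {K : Type*} [Field K] [NumberField K] {P : Ideal (𝓞 K)} (hP : Prime P) {l : ℕ}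
    (hl : l.Prime) (hlP : (l : 𝓞 K) ∈ P) (α : 𝓞 K) :
    ∃ R : ℤ[X], (R.map (Int.castRingHom (ZMod l))).Monic ∧
      l ^ (R.map (Int.castRingHom (ZMod l))).natDegree ≤ Ideal.absNorm P ∧ aeval α R ∈ P := by
  have : Fact l.Prime := ⟨hl⟩
  have hPr := Ideal.isPrime_of_prime hP
  have hmax : P.IsMaximal := hPr.isMaximal hP.ne_zero
  let : Field (𝓞 K ⧸ P) := Ideal.Quotient.field P
  have hchar : CharP (𝓞 K ⧸ P) l := by
    refine (CharP.charP_iff_prime_eq_zero hl).2 ?_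
    rw [← map_natCast (Ideal.Quotient.mk P), Ideal.Quotient.eq_zero_iff_mem]; exact hlP
  let : Algebra (ZMod l) (𝓞 K ⧸ P) := ZMod.algebra _ l
  have hfin : Finite (𝓞 K ⧸ P) := Ideal.finiteQuotientOfFreeOfNeBot P hP.ne_zero
  have : Fintype (𝓞 K ⧸ P) := Fintype.ofFinite _
  have : Module.Finite (ZMod l) (𝓞 K ⧸ P) := Module.Finite.of_finite
  set a : 𝓞 K ⧸ P := Ideal.Quotient.mk P α
  have hint : IsIntegral (ZMod l) a := Algebra.IsIntegral.isIntegral a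
  obtain ⟨R, hR⟩ := Polynomial.map_surjective (Int.castRingHom (ZMod l))
    (ZMod.ringHom_surjective _) (minpoly (ZMod l) a)
  refine ⟨R, ?_, ?_, ?_⟩
  · rw [hR]; exact minpoly.monic hint
  · rw [hR, Ideal.absNorm_apply, Submodule.cardQuot_apply]
    have h1 : (minpoly (ZMod l) a).natDegree ≤ Module.finrank (ZMod l) (𝓞 K ⧸ P) :=
      minpoly.natDegree_le a
    have h2 : Nat.card (𝓞 K ⧸ P) = l ^ Module.finrank (ZMod l) (𝓞 K ⧸ P) := by
      rw [Module.natCard_eq_pow_finrank (K := ZMod l), Nat.card_zmod]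
    rw [h2]
    exact Nat.pow_le_pow_right hl.pos h1
  · rw [← Ideal.Quotient.eq_zero_iff_mem]
    have h3 := minpoly.aeval (ZMod l) a
    rw [← hR, aeval_def, eval₂_map, RingHom.ext_int
      ((algebraMap (ZMod l) (𝓞 K ⧸ P)).comp (Int.castRingHom (ZMod l)))
      ((Ideal.Quotient.mk P).comp (algebraMap ℤ (𝓞 K)))] at h3
    rw [aeval_def, hom_eval₂]; exact h3

/-- the key lower bound -/
lemma norm_rad_ge {K F : Type*} [Field K] [NumberField K] [Field F] [NumberField F] {f : ℤ[X]}
    (hf : f.Monic) (α : 𝓞 K) (ρ : Multiset (𝓞 F))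
    (hρ : f.map (Int.castRingHom (𝓞 F)) = (ρ.map (fun a => X - C a)).prod)
    (hφ : ∀ a ∈ ρ, ∃ φ : K →+* F, φ α = a) {l : ℕ} (hl : l.Prime) :
    l ^ sR l f ≤ ∏ P ∈ PO K l, Ideal.absNorm P := by
  have : Fact l.Prime := ⟨hl⟩
  have hspan : Ideal.span {(l : 𝓞 F)} ≠ ⊤ := by
    rw [Ne, Ideal.span_singleton_eq_top]
    intro hu
    have h1 := hu.map (Algebra.norm ℤ)
    have h2 : (l : 𝓞 F) = algebraMap ℤ (𝓞 F) (l:ℤ) := by simp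
    rw [h2, Algebra.norm_algebraMap, RingOfIntegers.rank, isUnit_pow_iff Module.finrank_pos.ne',
      Int.isUnit_iff_natAbs_eq] at h1
    exact hl.one_lt.ne' (by simpa using h1)
  obtain ⟨m, hm, hlm⟩ := Ideal.exists_le_maximal _ hspan
  have hlm' : (l : 𝓞 F) ∈ m := hlm (Ideal.mem_span_singleton_self _)
  let : Field (𝓞 F ⧸ m) := Ideal.Quotient.field m
  have hchar : CharP (𝓞 F ⧸ m) l := by
    refine (CharP.charP_iff_prime_eq_zero hl).2 ?_
    rw [← map_natCast (Ideal.Quotient.mk m), Ideal.Quotient.eq_zero_iff_mem]; exact hlm'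
  let ι := ZMod.castHom (dvd_refl l) (𝓞 F ⧸ m)
  have hex : ∀ P : Ideal (𝓞 K), ∃ R : ℤ[X], P ∈ PO K l →
      (R.map (Int.castRingHom (ZMod l))).Monic ∧
      l ^ (R.map (Int.castRingHom (ZMod l))).natDegree ≤ Ideal.absNorm P ∧ aeval α R ∈ P := by
    intro P
    by_cases hP : P ∈ PO K l
    · have h := (mem_PO hl.ne_zero).1 hP
      obtain ⟨R, hR⟩ := exR h.1 hl h.2 α
      exact ⟨R, fun _ => hR⟩
    · exact ⟨0, fun h => absurd h hP⟩
  choose R hR using hex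
  let r : (ZMod l)[X] := ∏ P ∈ PO K l, (R P).map (Int.castRingHom (ZMod l))
  have hrm : r.Monic := monic_prod_of_monic _ _ fun P hP => (hR P hP).1
  have hs : sR l f ≤ r.natDegree := by
    apply sR_le hrm
    apply dvd_pow_of_roots hf ι (ρ.map (Ideal.Quotient.mk m))
    · rw [Multiset.map_map, RingHom.ext_int (Int.castRingHom (𝓞 F ⧸ m))
        ((Ideal.Quotient.mk m).comp (Int.castRingHom (𝓞 F))), ← Polynomial.map_map, hρ,
        Polynomial.map_multiset_prod, Multiset.map_map]
      congr 1
      apply Multiset.map_congr rfl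
      intro a _
      simp
    · intro b hb
      obtain ⟨a, ha, rfl⟩ := Multiset.mem_map.1 hb
      obtain ⟨φ, hφa⟩ := hφ a ha
      let ψ := RingOfIntegers.mapRingHom φ
      have hψ : ψ α = a := by
        apply RingOfIntegers.ext
        rw [← hφa]; rfl
      let P := m.comap ψ
      have hlP : (l : 𝓞 K) ∈ P := by
        rw [Ideal.mem_comap, map_natCast]; exact hlm'
      have hPp : P.IsPrime := Ideal.IsPrime.comap ψ
      have hP0 : P ≠ ⊥ := by
        intro h0
        rw [h0, Ideal.mem_bot] at hlP
        exact hl.ne_zero (by exact_mod_cast hlP)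
      have hPO : P ∈ PO K l := (mem_PO hl.ne_zero).2 ⟨(Ideal.prime_iff_isPrime hP0).2 hPp, hlP⟩
      have h3 := (hR P hPO).2.2
      rw [Ideal.mem_comap, aeval_def, hom_eval₂, hψ] at h3
      rw [← Ideal.Quotient.eq_zero_iff_mem, hom_eval₂] at h3
      rw [eval₂_finsetProd]
      apply Finset.prod_eq_zero hPO
      rw [eval₂_map, RingHom.ext_int (ι.comp (Int.castRingHom (ZMod l)))
        ((Ideal.Quotient.mk m).comp (ψ.comp (algebraMap ℤ (𝓞 K))))]
      exact h3
  calc l ^ sR l f ≤ l ^ r.natDegree := Nat.pow_le_pow_right hl.pos hs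
    _ = ∏ P ∈ PO K l, l ^ ((R P).map (Int.castRingHom (ZMod l))).natDegree := by
      rw [natDegree_prod_of_monic _ _ fun P hP => (hR P hP).1, Finset.prod_pow_eq_pow_sum]
    _ ≤ _ := Finset.prod_le_prod' fun P hP => (hR P hP).2.1
end ModT3

section ModT4
open Polynomial NumberField IntermediateField Polynomial.Gal

attribute [local instance] Polynomial.Gal.splits_ℚ_ℂ

lemma inertia_ex (F : Type*) [Field F] [NumberField F] [IsGalois ℚ F] {l : ℕ} (hl : l.Prime)
    (h : (l:ℤ) ∣ discr F) : ∃ 𝔓 : Ideal (𝓞 F), 𝔓.IsPrime ∧ (l : 𝓞 F) ∈ 𝔓 ∧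
      ∃ g ∈ 𝔓.inertia Gal(F/ℚ), g ≠ 1 := by
  have hlp : Prime (l:ℤ) := Nat.prime_iff_prime_int.1 hl
  have h1 := (not_congr (not_dvd_discr_iff_forall_mem F (𝓞 F) hlp)).1 (not_not.2 h)
  push Not at h1
  obtain ⟨P, hP, hlP, hram⟩ := h1
  have := IsGaloisGroup.of_isFractionRing Gal(F/ℚ) ℤ (𝓞 F) ℚ F
  refine ⟨P, hP, by simpa using hlP, ?_⟩
  by_contra hcon
  push Not at hcon
  have hbot : P.inertia Gal(F/ℚ) = ⊥ := (Subgroup.eq_bot_iff_forall _).2 hcon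
  have hc := Ideal.card_inertia_eq_ramificationIdxIn (G := Gal(F/ℚ)) (P.under ℤ) P
  rw [Ideal.ramificationIdxIn_eq_ramificationIdx (P.under ℤ) P Gal(F/ℚ)] at hc
  apply hram
  rw [← Ideal.ramificationIdx_eq_one_iff, ← hc, hbot]
  exact Subgroup.card_bot

lemma swap_abs {R Y : Type*} [Fintype R] [DecidableEq R] [DecidableEq Y] (σ : Equiv.Perm R) (π : R → Y)
    (h : ∀ x, π (σ x) = π x) (hc : Fintype.card R ≤ (Finset.univ.image π).card + 1) (h1 : σ ≠ 1) :
    σ.IsSwap := by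
  have hp : (Set.univ : Set R).ncard ≤ (π '' Set.univ).ncard + 1 := by
    have : π '' Set.univ = ((Finset.univ.image π : Finset Y) : Set Y) := by simp
    rw [this, Set.ncard_coe_finset, Set.ncard_univ, Nat.card_eq_fintype_card]; exact hc
  rw [Set.ncard_le_ncard_image_add_one_iff] at hp
  rw [Ne, Equiv.ext_iff, not_forall] at h1
  obtain ⟨x, hx⟩ := h1
  have hx : σ x ≠ x := hx
  refine ⟨σ x, x, hx, ?_⟩
  ext z
  simp only [Equiv.swap_apply_def]
  split_ifs with hz hz'
  · subst hz
    have key := hp (σ (σ x)) trivial (σ x) trivial (σ x) trivial x trivial (by simp [h]) (by simp [h])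
      (by simpa using hx) hx
    grind
  · rw [hz']
  · by_contra hne
    have key := hp (σ z) trivial z trivial (σ x) trivial x trivial (by simp [h]) (by simp [h])
      hne hx
    grind

noncomputable abbrev fQ (f : ℤ[X]) : ℚ[X] := f.map (Int.castRingHom ℚ)
abbrev RR (f : ℤ[X]) : Type := (fQ f).rootSet ℂ
abbrev FF (f : ℤ[X]) : Type := (fQ f).SplittingField

noncomputable instance FF_nf (f : ℤ[X]) : NumberField (FF f) where
  to_charZero := charZero_of_injective_algebraMap (algebraMap ℚ (FF f)).injective
  to_finiteDimensional := inferInstance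

lemma fQ_monic {f : ℤ[X]} (hf : f.Monic) : (fQ f).Monic := hf.map _

lemma lf_int {f : ℤ[X]} (hf : f.Monic) (x : (fQ f).rootSet (FF f)) :
    IsIntegral ℤ (x : FF f) := by
  refine ⟨f, hf, ?_⟩
  have := aeval_eq_zero_of_mem_rootSet x.2
  rw [aeval_def, eval₂_map] at this
  have e : (algebraMap ℚ (FF f)).comp (Int.castRingHom ℚ) = algebraMap ℤ (FF f) := RingHom.ext_int _ _
  rwa [e] at this

/-- root of `f` in the ring of integers of the splitting field -/
noncomputable def lf {f : ℤ[X]} (hf : f.Monic) (x : RR f) : 𝓞 (FF f) :=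
  ⟨((rootsEquivRoots (fQ f) ℂ).symm x : FF f), lf_int hf _⟩

lemma lf_coe {f : ℤ[X]} (hf : f.Monic) (x : RR f) :
    (lf hf x : FF f) = ((rootsEquivRoots (fQ f) ℂ).symm x : FF f) := rfl

lemma prod_lf {f : ℤ[X]} (hf : f.Monic) (hirr : Irreducible f) :
    f.map (Int.castRingHom (𝓞 (FF f))) =
      (((Finset.univ : Finset (RR f)).val.map (lf hf)).map (fun a => X - C a)).prod := by
  apply Polynomial.map_injective (algebraMap (𝓞 (FF f)) (FF f)) RingOfIntegers.coe_injective
  have hsep : (fQ f).Separable := (irr_Q hf hirr).separable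
  have hspl : ((fQ f).map (algebraMap ℚ (FF f))).Splits := SplittingField.splits _
  have h1 := hspl.eq_prod_roots_of_monic ((fQ_monic hf).map _)
  have h2 : (f.map (Int.castRingHom (𝓞 (FF f)))).map (algebraMap (𝓞 (FF f)) (FF f)) =
      (fQ f).map (algebraMap ℚ (FF f)) := by
    rw [Polynomial.map_map, Polynomial.map_map]
    congr 1
  rw [h2, h1, Polynomial.map_multiset_prod, Multiset.map_map, Multiset.map_map]
  have hnd : ((fQ f).map (algebraMap ℚ (FF f))).roots.Nodup := nodup_roots hsep.map
  have h3 : ((fQ f).map (algebraMap ℚ (FF f))).roots =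
      (Finset.univ : Finset (RR f)).val.map (fun x => (lf hf x : FF f)) := by
    apply (Multiset.Nodup.ext hnd ?_).2
    · intro a
      simp only [Multiset.mem_map, Finset.mem_val, Finset.mem_univ, true_and, lf_coe]
      constructor
      · intro ha
        have ha' : a ∈ (fQ f).rootSet (FF f) := by
          rw [mem_rootSet_of_ne (fQ_monic hf).ne_zero]
          rw [mem_roots ((fQ_monic hf).map _).ne_zero, IsRoot, eval_map_algebraMap] at ha
          exact ha
        exact ⟨rootsEquivRoots (fQ f) ℂ ⟨a, ha'⟩, by simp⟩
      · rintro ⟨x, rfl⟩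
        rw [mem_roots ((fQ_monic hf).map _).ne_zero, IsRoot, eval_map_algebraMap]
        exact aeval_eq_zero_of_mem_rootSet (Subtype.prop _)
    · apply Multiset.Nodup.map _ Finset.univ.nodup
      intro x y hxy
      exact (rootsEquivRoots (fQ f) ℂ).symm.injective (Subtype.ext hxy)
  rw [h3, Multiset.map_map]
  congr 1
  apply Multiset.map_congr rfl
  intro x _
  simp

lemma card_RR {f : ℤ[X]} (hf : f.Monic) (hirr : Irreducible f) : Fintype.card (RR f) = f.natDegree := by
  have h := congrArg natDegree (prod_lf hf hirr)
  rw [hf.natDegree_map, natDegree_multiset_prod_X_sub_C_eq_card] at h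
  simpa using h.symm

lemma mem_RR {f : ℤ[X]} (hf : f.Monic) {α : ℂ} (hα : aeval α f = 0) : α ∈ (fQ f).rootSet ℂ := by
  rw [mem_rootSet_of_ne (fQ_monic hf).ne_zero]
  have : fQ f = f.map (algebraMap ℤ ℚ) := rfl
  rw [this, aeval_map_algebraMap]; exact hα

lemma lf_smul {f : ℤ[X]} (hf : f.Monic) (g : (fQ f).Gal) (x : RR f) :
    (lf hf (galActionHom (fQ f) ℂ g x) : FF f) = g (lf hf x : FF f) := by
  have h1 : galActionHom (fQ f) ℂ g x = g • x := rfl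
  have h2 : (rootsEquivRoots (fQ f) ℂ).symm (g • x) = g • (rootsEquivRoots (fQ f) ℂ).symm x := by
    rw [Gal.smul_def, Equiv.symm_apply_apply]
  rw [h1, lf_coe, lf_coe, h2]
  rfl

lemma swap_ex {f : ℤ[X]} (hf : f.Monic) (hirr : Irreducible f) {l : ℕ} (hl : l.Prime)
    (h : (l:ℤ) ∣ discr (FF f)) (hs : f.natDegree ≤ sR l f + 1) :
    ∃ g : (fQ f).Gal, (galActionHom (fQ f) ℂ g).IsSwap := by
  classical
  have hsf : IsSplittingField ℚ (FF f) (fQ f) := IsSplittingField.splittingField (fQ f)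
  have : IsGalois ℚ (FF f) := IsGalois.of_separable_splitting_field (p := fQ f) (irr_Q hf hirr).separable
  obtain ⟨𝔓, hP, hlP, g, hg, hg1⟩ := inertia_ex (FF f) hl h
  refine ⟨g, ?_⟩
  have hne : 𝔓 ≠ ⊥ := by
    rintro rfl
    rw [Ideal.mem_bot] at hlP
    exact hl.ne_zero (by exact_mod_cast hlP)
  have hmax : 𝔓.IsMaximal := hP.isMaximal hne
  let : Field (𝓞 (FF f) ⧸ 𝔓) := Ideal.Quotient.field 𝔓
  have hchar : CharP (𝓞 (FF f) ⧸ 𝔓) l := by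
    refine (CharP.charP_iff_prime_eq_zero hl).2 ?_
    rw [← map_natCast (Ideal.Quotient.mk 𝔓), Ideal.Quotient.eq_zero_iff_mem]; exact hlP
  let π : RR f → 𝓞 (FF f) ⧸ 𝔓 := fun x => Ideal.Quotient.mk 𝔓 (lf hf x)
  apply swap_abs _ π
  · intro x
    change Ideal.Quotient.mk 𝔓 _ = Ideal.Quotient.mk 𝔓 _
    rw [Ideal.Quotient.mk_eq_mk_iff_sub_mem]
    have h1 := lf_smul hf g x
    have h2 := hg (lf hf x)
    have h3 : lf hf (galActionHom (fQ f) ℂ g x) = g • lf hf x := RingOfIntegers.coe_injective h1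
    exact h3 ▸ h2
  · have h1 := congrArg (Polynomial.map (Ideal.Quotient.mk 𝔓)) (prod_lf hf hirr)
    rw [Polynomial.map_map, Polynomial.map_multiset_prod, Multiset.map_map, Multiset.map_map] at h1
    have h2 := sR_le_card hl hf ((Finset.univ : Finset (RR f)).val.map π) (k := 𝓞 (FF f) ⧸ 𝔓) (by
      rw [Subsingleton.elim (Int.castRingHom (𝓞 (FF f) ⧸ 𝔓)) _, h1, Multiset.map_map]
      congr 1
      apply Multiset.map_congr rfl
      intro x _
      simp [π])
    rw [card_RR hf hirr]
    have h3 : ((Finset.univ : Finset (RR f)).val.map π).toFinset = Finset.univ.image π := rfl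
    rw [h3] at h2
    omega
  · intro h0
    apply hg1
    have := galActionHom_injective (fQ f) ℂ (a₁ := g) (a₂ := 1) (by rw [h0, map_one])
    exact this
end ModT4

section ModT5
open Polynomial NumberField IntermediateField Polynomial.Gal

attribute [local instance] Polynomial.Gal.splits_ℚ_ℂ

/-- integral generator -/
noncomputable def gen0 {f : ℤ[X]} (hf : f.Monic) {α : ℂ} (hα : aeval α f = 0) : 𝓞 ℚ⟮α⟯ :=
  ⟨AdjoinSimple.gen ℚ α, by
    have := integral_of_root hf hα
    exact (isIntegral_algHom_iff (ℚ⟮α⟯.val.restrictScalars ℤ) Subtype.val_injective).1 this⟩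

lemma emb_ex {f : ℤ[X]} (hf : f.Monic) (hirr : Irreducible f) {α : ℂ} (hα : aeval α f = 0)
    (x : RR f) : ∃ φ : ℚ⟮α⟯ →+* FF f, φ (gen0 hf hα) = lf hf x := by
  have hint : IsIntegral ℚ α := (integral_of_root hf hα).tower_top
  have hroot : aeval (lf hf x : FF f) (fQ f) = 0 := 
    aeval_eq_zero_of_mem_rootSet ((rootsEquivRoots (fQ f) ℂ).symm x).2
  have hm : fQ f = minpoly ℚ α := minpoly_Q hf hirr hα
  refine ⟨((adjoin.powerBasis hint).lift (lf hf x : FF f) ?_ : ℚ⟮α⟯ →ₐ[ℚ] FF f), ?_⟩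
  · rw [adjoin.powerBasis_gen, minpoly_gen, ← hm]; exact hroot
  · have := (adjoin.powerBasis hint).lift_gen (lf hf x : FF f) (by
      rw [adjoin.powerBasis_gen, minpoly_gen, ← hm]; exact hroot)
    exact this

lemma disc_dvd {f : ℤ[X]} (hf : f.Monic) (hirr : Irreducible f) {α : ℂ} (hα : aeval α f = 0)
    [FiniteDimensional ℚ ℚ⟮α⟯] : discr ℚ⟮α⟯ ∣ discr (FF f) := by
  obtain ⟨φ, -⟩ := emb_ex hf hirr hα ⟨α, mem_RR hf hα⟩
  let : Algebra ℚ⟮α⟯ (FF f) := φ.toAlgebra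
  exact discr_dvd_discr ℚ⟮α⟯ (FF f)

noncomputable def Wn (n : ℕ) : ℕ := (∏ l ∈ (Finset.range (n + 1)).filter Nat.Prime, l ^ n) ^ n

lemma E_bound {f : ℤ[X]} (hf : f.Monic) (hirr : Irreducible f) {α : ℂ} (hα : aeval α f = 0)
    [FiniteDimensional ℚ ℚ⟮α⟯] :
    (discr ℚ⟮α⟯).natAbs ≤ Wn f.natDegree * ∏ l ∈ BP ℚ⟮α⟯, l ^ (f.natDegree - sR l f) := by
  have hn := finrank_of_root hf hirr hα
  have h := discr_bound ℚ⟮α⟯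
  rw [hn] at h
  have hpr : ∀ l ∈ BP ℚ⟮α⟯, l.Prime := fun l hl => Nat.prime_of_mem_primeFactors (Finset.mem_filter.1 hl).1
  have hn0 : f.natDegree ≠ 0 := by rw [← hn]; exact Module.finrank_pos.ne'
  have h1 : ∏ l ∈ BP ℚ⟮α⟯, l ^ sR l f ≤ ∏ l ∈ BP ℚ⟮α⟯, ∏ P ∈ PO ℚ⟮α⟯ l, Ideal.absNorm P := by
    apply Finset.prod_le_prod' fun l hl => ?_
    apply norm_rad_ge (F := FF f) hf (gen0 hf hα) _ (prod_lf hf hirr) _ (hpr l hl)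
    intro a ha
    obtain ⟨x, -, rfl⟩ := Multiset.mem_map.1 ha
    exact emb_ex hf hirr hα x
  have h2 : (∏ l ∈ BP ℚ⟮α⟯, l) ^ f.natDegree =
      (∏ l ∈ BP ℚ⟮α⟯, l ^ (f.natDegree - sR l f)) * ∏ l ∈ BP ℚ⟮α⟯, l ^ sR l f := by
    rw [← Finset.prod_pow, ← Finset.prod_mul_distrib]
    apply Finset.prod_congr rfl fun l hl => ?_
    rw [← pow_add, Nat.sub_add_cancel (sR_le_deg (hpr l hl) hf hn0)]
  have h3 : 0 < ∏ l ∈ BP ℚ⟮α⟯, l ^ sR l f := Finset.prod_pos fun l hl => pow_pos (hpr l hl).pos _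
  refine Nat.le_of_mul_le_mul_right ?_ h3
  calc _ ≤ (discr ℚ⟮α⟯).natAbs * ∏ l ∈ BP ℚ⟮α⟯, ∏ P ∈ PO ℚ⟮α⟯ l, Ideal.absNorm P :=
        Nat.mul_le_mul_left _ h1
    _ ≤ _ := h
    _ = _ := by rw [h2, Wn]; ring

lemma coatom_gen {F : Type*} [Field F] [Algebra ℚ F] [FiniteDimensional ℚ F] [IsGalois ℚ F] (a : F)
    (S : Subgroup Gal(F/ℚ)) (hS : ∀ g, g ∈ S ↔ g a = a) (h0 : ℚ⟮a⟯ ≠ ⊥)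
    (h3 : ∀ L : IntermediateField ℚ F, L ≤ ℚ⟮a⟯ → L = ⊥ ∨ L = ℚ⟮a⟯) : IsCoatom S := by
  have hS : S = ℚ⟮a⟯.fixingSubgroup := by
    ext g
    rw [hS]
    constructor
    · intro h
      have : ℚ⟮a⟯ ≤ fixedField (Subgroup.zpowers g) := by
        rw [adjoin_simple_le_iff, mem_fixedField_iff]
        intro k hk
        have : Subgroup.zpowers g ≤ MulAction.stabilizer Gal(F/ℚ) a := by
          rw [Subgroup.zpowers_le]; exact h
        exact this hk
      rw [IntermediateField.le_iff_le] at this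
      exact this (Subgroup.mem_zpowers g)
    · intro h
      exact (IntermediateField.mem_fixingSubgroup_iff _ _).1 h a (mem_adjoin_simple_self ℚ a)
  rw [hS]
  constructor
  · intro h
    apply h0
    rw [← IsGalois.fixedField_fixingSubgroup ℚ⟮a⟯, h, IsGalois.fixedField_top]
  · intro H hH
    have h4 : fixedField H ≤ ℚ⟮a⟯ := by
      rw [← IsGalois.fixedField_fixingSubgroup ℚ⟮a⟯]
      exact fixedField_antitone hH.le
    have := fixingSubgroup_fixedField H
    rcases h3 _ h4 with h | h
    · rw [h, fixingSubgroup_bot] at this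
      exact this.symm
    · rw [h] at this
      exact absurd this hH.ne

lemma prim {f : ℤ[X]} (hf : f.Monic) (hirr : Irreducible f) {α : ℂ} (hα : aeval α f = 0)
    (hmid : NoMid ℚ⟮α⟯) (h2 : 2 ≤ f.natDegree) : MulAction.IsPreprimitive (fQ f).Gal (RR f) := by
  have hsf : IsSplittingField ℚ (FF f) (fQ f) := IsSplittingField.splittingField (fQ f)
  have : IsGalois ℚ (FF f) := IsGalois.of_separable_splitting_field (p := fQ f) (irr_Q hf hirr).separable
  have : MulAction.IsPretransitive (fQ f).Gal (RR f) := galAction_isPretransitive _ _ (irr_Q hf hirr)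
  have : Nontrivial (RR f) := by
    rw [← Fintype.one_lt_card_iff_nontrivial, card_RR hf hirr]; omega
  let x : RR f := ⟨α, mem_RR hf hα⟩
  rw [← MulAction.isCoatom_stabilizer_iff_preprimitive _ x]
  let φ : FF f →ₐ[ℚ] ℂ := IsScalarTower.toAlgHom ℚ (FF f) ℂ
  let a : FF f := lf hf x
  have hφ : φ a = α := by
    have : (rootsEquivRoots (fQ f) ℂ ((rootsEquivRoots (fQ f) ℂ).symm x) : ℂ) = α := by
      rw [Equiv.apply_symm_apply]
    exact this
  have hstab : ∀ g : (fQ f).Gal, g ∈ MulAction.stabilizer (fQ f).Gal x ↔ g a = a := by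
    intro g
    rw [MulAction.mem_stabilizer_iff]
    have h1 := lf_smul hf g x
    constructor
    · intro h
      have h2 : galActionHom (fQ f) ℂ g x = x := h
      rw [h2] at h1; exact h1.symm
    · intro h
      have h2 : (lf hf (galActionHom (fQ f) ℂ g x) : FF f) = lf hf x := h1.trans h
      rw [lf_coe, lf_coe] at h2
      exact (rootsEquivRoots (fQ f) ℂ).symm.injective (Subtype.ext h2)
  have hmap : (ℚ⟮a⟯).map φ = ℚ⟮α⟯ := by rw [adjoin_map, Set.image_singleton, hφ]
  let S' : Subgroup Gal(FF f/ℚ) := MulAction.stabilizer (fQ f).Gal x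
  suffices h : IsCoatom S' from h
  refine coatom_gen a S' hstab ?_ ?_
  · intro h
    rw [h, IntermediateField.map_bot] at hmap
    have := finrank_of_root hf hirr hα
    rw [← hmap, IntermediateField.finrank_bot] at this
    omega
  · intro L hL
    rcases hmid (L.map φ) (by rw [← hmap]; exact map_mono _ hL) with h | h
    · left; apply map_injective φ; rw [h, IntermediateField.map_bot]
    · right; apply map_injective φ; rw [h, hmap]

lemma surj_of {f : ℤ[X]} (hf : f.Monic) (hirr : Irreducible f) {α : ℂ} (hα : aeval α f = 0)
    (hmid : NoMid ℚ⟮α⟯) (h2 : 2 ≤ f.natDegree) [FiniteDimensional ℚ ℚ⟮α⟯] {l : ℕ}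
    (hl : l ∈ BP ℚ⟮α⟯) (hs : f.natDegree ≤ sR l f + 1) :
    Function.Surjective (galActionHom (fQ f) ℂ) := by
  have hl' := Finset.mem_filter.1 hl
  have hlp := Nat.prime_of_mem_primeFactors hl'.1
  have hdvd : (l:ℤ) ∣ discr (FF f) :=
    (Int.natCast_dvd.2 (Nat.dvd_of_mem_primeFactors hl'.1)).trans (disc_dvd hf hirr hα)
  obtain ⟨g, hg⟩ := swap_ex hf hirr hlp hdvd hs
  have hp := prim hf hirr hα hmid h2
  rw [← MonoidHom.range_eq_top]
  refine Equiv.Perm.subgroup_eq_top_of_isPreprimitive_of_isSwap_mem ?_ _ hg (MonoidHom.mem_range.2 ⟨g, rfl⟩)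
  let e : RR f →ₑ[(galActionHom (fQ f) ℂ).rangeRestrict] RR f :=
    { toFun := id, map_smul' := fun g x => rfl }
  exact MulAction.IsPreprimitive.of_surjective (f := e) Function.surjective_id
end ModT5

section ModC1
open Polynomial

/-- sets of primes with product at most N -/
def PS (N : ℕ) : Finset (Finset ℕ) :=
  (((Finset.range (N + 1)).filter Nat.Prime).powerset).filter (fun S => ∏ l ∈ S, l ≤ N)

lemma mem_PS {N : ℕ} {S : Finset ℕ} (hN : 1 ≤ N) :
    S ∈ PS N ↔ (∀ l ∈ S, l.Prime) ∧ ∏ l ∈ S, l ≤ N := by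
  simp only [PS, Finset.mem_filter, Finset.mem_powerset, and_congr_left_iff]
  intro h
  constructor
  · intro h1 l hl
    exact (Finset.mem_filter.1 (h1 hl)).2
  · intro h1 l hl
    refine Finset.mem_filter.2 ⟨Finset.mem_range.2 ?_, h1 l hl⟩
    have h2 : l ∣ ∏ l ∈ S, l := Finset.dvd_prod_of_mem _ hl
    have h3 : 0 < ∏ l ∈ S, l := Finset.prod_pos fun l hl => (h1 l hl).pos
    have := Nat.le_of_dvd h3 h2
    omega

lemma PS_subset {N : ℕ} {S T : Finset ℕ} (hN : 1 ≤ N) (h : S ∈ PS N) (hT : T ⊆ S) : T ∈ PS N := by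
  rw [mem_PS hN] at h ⊢
  refine ⟨fun l hl => h.1 l (hT hl), (Finset.prod_le_prod_of_subset_of_one_le' hT ?_).trans h.2⟩
  intro l hl _
  exact (h.1 l hl).one_lt.le

lemma divsum (N : ℕ) (hN : 1 ≤ N) (B : ℕ) :
    ∑ S ∈ PS N, ((B:ℝ) ^ S.card / ((∏ l ∈ S, l : ℕ) : ℝ)) ≤ Lg N ^ B := by
  classical
  have h1 : ∑ S ∈ PS N, (1 / ((∏ l ∈ S, l : ℕ) : ℝ)) ≤ Lg N := by
    have : ∑ S ∈ PS N, (1 / ((∏ l ∈ S, l : ℕ) : ℝ)) ≤ ∑ m ∈ Finset.Icc 1 N, (1 / (m:ℝ)) := by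
      rw [← Finset.sum_image (f := fun m : ℕ => (1 / (m:ℝ))) (g := fun S : Finset ℕ => ∏ l ∈ S, l)]
      · apply Finset.sum_le_sum_of_subset_of_nonneg
        · intro m hm
          obtain ⟨S, hS, rfl⟩ := Finset.mem_image.1 hm
          rw [mem_PS hN] at hS
          exact Finset.mem_Icc.2 ⟨Finset.prod_pos fun l hl => (hS.1 l hl).pos, hS.2⟩
        · intros; positivity
      · intro S hS T hT h
        rw [Finset.mem_coe, mem_PS hN] at hS hT
        rw [← Nat.primeFactors_prod hS.1, ← Nat.primeFactors_prod hT.1]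
        exact congrArg _ h
    refine this.trans ?_
    have h := harmonic_le_one_add_log N
    rw [harmonic_eq_sum_Icc] at h
    push_cast at h
    simpa [Lg] using h
  have hL : 1 ≤ Lg N := Lg_one_le N
  induction B with
  | zero =>
    rw [Finset.sum_eq_single ∅]
    · simp
    · intro S _ hS
      simp [Finset.card_eq_zero, hS]
    · intro h
      exfalso; apply h
      rw [mem_PS hN]; simpa using hN
  | succ B ih =>
    have e1 : ∀ S ∈ PS N, (((B+1:ℕ):ℝ) ^ S.card / ((∏ l ∈ S, l : ℕ) : ℝ)) =
        ∑ T ∈ S.powerset, ((B:ℝ) ^ T.card / ((∏ l ∈ T, l : ℕ) : ℝ)) * (1 / ((∏ l ∈ S \ T, l : ℕ) : ℝ)) := by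
      intro S hS
      push_cast
      rw [← Finset.sum_pow_mul_eq_add_pow, Finset.sum_div]
      apply Finset.sum_congr rfl
      intro T hT
      rw [← Finset.prod_sdiff (Finset.mem_powerset.1 hT), one_pow, mul_one]
      rw [div_mul_div_comm, mul_one, mul_comm]
    rw [Finset.sum_congr rfl e1, Finset.sum_sigma']
    calc _ = ∑ p ∈ ((PS N).sigma fun S => S.powerset).image (fun p => (p.2, p.1 \ p.2)),
          ((B:ℝ) ^ p.1.card / ((∏ l ∈ p.1, l : ℕ) : ℝ)) * (1 / ((∏ l ∈ p.2, l : ℕ) : ℝ)) := by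
          rw [Finset.sum_image]
          rintro ⟨S, T⟩ h ⟨S', T'⟩ h' heq
          simp only [Prod.mk.injEq] at heq
          simp only [Finset.coe_sigma, Set.mem_sigma_iff, Finset.mem_coe, Finset.mem_powerset] at h h'
          obtain ⟨rfl, h2⟩ := heq
          have : S = S' := by
            rw [← Finset.sdiff_union_of_subset h.2, h2, Finset.sdiff_union_of_subset h'.2]
          subst this; rfl
      _ ≤ ∑ p ∈ (PS N) ×ˢ (PS N),
          ((B:ℝ) ^ p.1.card / ((∏ l ∈ p.1, l : ℕ) : ℝ)) * (1 / ((∏ l ∈ p.2, l : ℕ) : ℝ)) := by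
          apply Finset.sum_le_sum_of_subset_of_nonneg
          · intro p hp
            obtain ⟨⟨S, T⟩, h, rfl⟩ := Finset.mem_image.1 hp
            simp only [Finset.mem_sigma, Finset.mem_powerset] at h
            exact Finset.mem_product.2 ⟨PS_subset hN h.1 h.2, PS_subset hN h.1 Finset.sdiff_subset⟩
          · intros; positivity
      _ = (∑ S ∈ PS N, ((B:ℝ) ^ S.card / ((∏ l ∈ S, l : ℕ) : ℝ))) *
          ∑ S ∈ PS N, (1 / ((∏ l ∈ S, l : ℕ) : ℝ)) := by
          rw [Finset.sum_product, Finset.sum_mul_sum]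
      _ ≤ Lg N ^ B * Lg N := by
          apply mul_le_mul ih h1 (Finset.sum_nonneg fun _ _ => by positivity) (by positivity)
      _ = _ := (pow_succ _ _).symm

/-- integer box -/
noncomputable def IB (n N : ℕ) : Finset (Fin n → ℤ) := Fintype.piFinset (fun _ => Finset.Icc (-(N : ℤ)) N)

lemma mem_IB {n N : ℕ} {a : Fin n → ℤ} : a ∈ IB n N ↔ ∀ i, |a i| ≤ (N:ℤ) := by
  simp [IB, abs_le]

lemma card_IB (n N : ℕ) : (IB n N).card = (2*N+1)^n := by
  have : ((N:ℤ) + 1 + N).toNat = 2 * N + 1 := by omega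
  simp [IB, this]

lemma class_card (N q : ℕ) (hq : 0 < q) (v : ℤ) :
    ((Finset.Icc (-(N:ℤ)) N).filter (fun x => (q:ℤ) ∣ x - v)).card ≤ (2*N+1)/q + 1 := by
  have hq' : (0:ℤ) < q := by exact_mod_cast hq
  rw [← Finset.card_image_of_injOn (f := fun x : ℤ => (x + N) / (q:ℤ))]
  · have : ((Finset.Icc (-(N:ℤ)) N).filter (fun x => (q:ℤ) ∣ x - v)).image
        (fun x : ℤ => (x + N) / (q:ℤ)) ⊆ Finset.Icc 0 ((((2*N+1)/q : ℕ)) : ℤ) := by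
      intro y hy
      obtain ⟨x, hx, rfl⟩ := Finset.mem_image.1 hy
      have := Finset.mem_Icc.1 (Finset.mem_filter.1 hx).1
      refine Finset.mem_Icc.2 ⟨Int.ediv_nonneg (by linarith) hq'.le, ?_⟩
      push_cast
      exact Int.ediv_le_ediv hq' (by linarith)
    refine (Finset.card_le_card this).trans ?_
    rw [Int.card_Icc, sub_zero]
    generalize (2*N+1)/q = m
    omega
  · intro x hx y hy h
    have hx := (Finset.mem_filter.1 hx).2
    have hy := (Finset.mem_filter.1 hy).2
    have h1 : (q:ℤ) ∣ (x + N) - (y + N) := by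
      have := dvd_sub hx hy
      ring_nf at this ⊢; exact this
    have h3 : (x + N) % (q:ℤ) = (y + N) % q :=
      Int.emod_eq_emod_iff_emod_sub_eq_zero.2 (Int.emod_eq_zero_of_dvd h1)
    have e1 := Int.mul_ediv_add_emod (x+N) q
    have e2 := Int.mul_ediv_add_emod (y+N) q
    simp only at h
    rw [h, h3] at e1
    linarith

lemma crt_count (n N : ℕ) (S : Finset ℕ) (hS : ∀ l ∈ S, l.Prime)
    (g : (l : ℕ) → (Fin n → ZMod l) → ℕ) (G : ℕ → ℕ)
    (hG : ∀ l ∈ S, ∀ s : Finset (Fin n → ZMod l), ∑ b ∈ s, g l b ≤ G l) :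
    ∑ a ∈ IB n N, ∏ l ∈ S, g l (fun i => (a i : ZMod l)) ≤
      ((2*N+1)/(∏ l ∈ S, l) + 1)^n * ∏ l ∈ S, G l := by
  classical
  let T : (l : ℕ) → Finset (Fin n → ZMod l) := fun l => (IB n N).image (fun a i => (a i : ZMod l))
  let φ : (Fin n → ℤ) → ((l : ℕ) → l ∈ S → (Fin n → ZMod l)) := fun a l _ i => (a i : ZMod l)
  have hmap : ∀ a ∈ IB n N, φ a ∈ S.pi T := by
    intro a ha
    rw [Finset.mem_pi]
    intro l hl
    exact Finset.mem_image_of_mem _ ha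
  have hpos : 0 < ∏ l ∈ S, l := Finset.prod_pos fun l hl => (hS l hl).pos
  have hfib : ∀ β ∈ S.pi T, ((IB n N).filter (fun a => φ a = β)).card ≤
      ((2*N+1)/(∏ l ∈ S, l) + 1)^n := by
    intro β hβ
    rcases ((IB n N).filter (fun a => φ a = β)).eq_empty_or_nonempty with h | ⟨v, hv⟩
    · rw [h]; simp
    have hv := (Finset.mem_filter.1 hv).2
    have : (IB n N).filter (fun a => φ a = β) ⊆ Fintype.piFinset (fun i : Fin n =>
        (Finset.Icc (-(N:ℤ)) N).filter (fun x => ((∏ l ∈ S, l : ℕ):ℤ) ∣ x - v i)) := by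
      intro a ha
      obtain ⟨h1, h2⟩ := Finset.mem_filter.1 ha
      rw [Fintype.mem_piFinset]
      intro i
      refine Finset.mem_filter.2 ⟨Finset.mem_Icc.2 (abs_le.1 (mem_IB.1 h1 i)), ?_⟩
      push_cast
      apply Finset.prod_dvd_of_coprime
      · intro l hl m hm hne
        have := (Nat.coprime_primes (hS l hl) (hS m hm)).2 hne
        exact Nat.isCoprime_iff_coprime.2 this
      · intro l hl
        rw [← hv] at h2
        have := congrFun (congrFun (congrFun h2 l) hl) i
        simp only [φ] at this
        rw [← sub_eq_zero, ← Int.cast_sub] at this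
        exact (ZMod.intCast_zmod_eq_zero_iff_dvd _ _).1 this
    refine (Finset.card_le_card this).trans ?_
    rw [Fintype.card_piFinset]
    refine (Finset.prod_le_prod' (fun i _ => class_card N _ hpos (v i))).trans ?_
    simp
  rw [← Finset.sum_fiberwise_of_maps_to hmap]
  calc _ ≤ ∑ β ∈ S.pi T, ((2*N+1)/(∏ l ∈ S, l) + 1)^n * ∏ l ∈ S.attach, g l.1 (β l.1 l.2) := by
        apply Finset.sum_le_sum
        intro β hβ
        calc _ = ∑ a ∈ (IB n N).filter (fun a => φ a = β), ∏ l ∈ S.attach, g l.1 (β l.1 l.2) := by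
              apply Finset.sum_congr rfl
              intro a ha
              rw [← Finset.prod_attach]
              apply Finset.prod_congr rfl
              intro l _
              rw [← (Finset.mem_filter.1 ha).2]
          _ ≤ _ := by
              rw [Finset.sum_const, smul_eq_mul]
              exact Nat.mul_le_mul_right _ (hfib β hβ)
    _ = ((2*N+1)/(∏ l ∈ S, l) + 1)^n * ∏ l ∈ S, ∑ b ∈ T l, g l b := by
        rw [← Finset.mul_sum, Finset.prod_sum]
    _ ≤ _ := by
        apply Nat.mul_le_mul_left
        exact Finset.prod_le_prod' fun l hl => hG l hl _
end ModC1

section ModC2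
open Polynomial

/-- monic polynomial with given lower coefficients -/
noncomputable def vp {R : Type*} [CommRing R] (n : ℕ) (a : Fin n → R) : R[X] :=
  X ^ n + ∑ i : Fin n, C (a i) * X ^ (i : ℕ)

lemma vp_monic {R : Type*} [CommRing R] (n : ℕ) (a : Fin n → R) : (vp n a).Monic :=
  monic_X_pow_add (degree_sum_fin_lt a)

lemma vp_natDegree {R : Type*} [CommRing R] [Nontrivial R] (n : ℕ) (a : Fin n → R) :
    (vp n a).natDegree = n := by
  unfold vp
  rw [natDegree_add_eq_left_of_degree_lt, natDegree_X_pow]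
  rw [degree_X_pow]; exact degree_sum_fin_lt a

lemma vp_map {R S : Type*} [CommRing R] [CommRing S] (φ : R →+* S) (n : ℕ) (a : Fin n → R) :
    (vp n a).map φ = vp n (fun i => φ (a i)) := by
  simp [vp, Polynomial.map_sum]

lemma vp_coeffs {R : Type*} [CommRing R] {n : ℕ} {f : R[X]} (hf : f.Monic) (hn : f.natDegree = n) :
    vp n (fun i => f.coeff i) = f := by
  subst hn
  conv_rhs => rw [hf.as_sum]
  rw [vp, ← Fin.sum_univ_eq_sum_range (fun i => C (f.coeff i) * X ^ i)]

lemma vp_inj {R : Type*} [CommRing R] {n : ℕ} {a b : Fin n → R} (h : vp n a = vp n b) : a = b := by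
  have key : ∀ (a : Fin n → R) (i : Fin n), (vp n a).coeff i = a i := by
    intro a i
    have : ∀ x : Fin n, ((i:ℕ) = (x:ℕ)) = (i = x) := fun x => by rw [Fin.ext_iff]
    simp [vp, coeff_X_pow, i.2.ne, coeff_C_mul, this]
  funext i
  rw [← key a i, ← key b i, h]

lemma divisors_count {k : Type*} [Field k] (n : ℕ) (p : k[X]) (hp : p ≠ 0) (s : Finset (Fin n → k))
    (h : ∀ b ∈ s, vp n b ∣ p) : s.card ≤ 2 ^ p.natDegree := by
  classical
  let K := AlgebraicClosure k
  let q : K[X] := p.map (algebraMap k K)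
  have hq : q ≠ 0 := Polynomial.map_ne_zero hp
  have h1 : s.card ≤ q.roots.powerset.toFinset.card := by
    apply Finset.card_le_card_of_injOn (fun b => ((vp n b).map (algebraMap k K)).roots)
    · intro b hb
      simp only [Finset.mem_coe, Multiset.mem_toFinset, Multiset.mem_powerset]
      exact roots.le_of_dvd hq (Polynomial.map_dvd _ (h b hb))
    · intro b hb c hc hbc
      simp only at hbc
      apply vp_inj
      apply Polynomial.map_injective _ (algebraMap k K).injective
      rw [(IsAlgClosed.splits _).eq_prod_roots_of_monic ((vp_monic n b).map (algebraMap k K)),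
        (IsAlgClosed.splits _).eq_prod_roots_of_monic ((vp_monic n c).map (algebraMap k K)), hbc]
  refine h1.trans ((Multiset.toFinset_card_le _).trans ?_)
  rw [Multiset.card_powerset]
  refine Nat.pow_le_pow_right (by norm_num) ((card_roots' q).trans natDegree_map_le)

/-- minimal radical degree for residue vectors -/
noncomputable def sB (n l : ℕ) (b : Fin n → ZMod l) : ℕ :=
  sInf {s | ∃ r : (ZMod l)[X], r.Monic ∧ r.natDegree = s ∧ vp n b ∣ r ^ n}

lemma sB_eq {n l : ℕ} {f : ℤ[X]} (hf : f.Monic) (hn : f.natDegree = n) :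
    sR l f = sB n l (fun i => (f.coeff i : ZMod l)) := by
  have : f.map (Int.castRingHom (ZMod l)) = vp n (fun i => (f.coeff i : ZMod l)) := by
    conv_lhs => rw [← vp_coeffs hf hn]
    rw [vp_map]; rfl
  unfold sR sB
  rw [this, hn]

lemma sB_sum {n l : ℕ} (hn : n ≠ 0) (hl : l.Prime) (s : Finset (Fin n → ZMod l)) :
    ∑ b ∈ s, l ^ (n - sB n l b) ≤ ((n+1) * 2^(n*n)) * l ^ n := by
  classical
  have : Fact l.Prime := ⟨hl⟩
  have hspec : ∀ b : Fin n → ZMod l, sB n l b ∈ {s | ∃ r : (ZMod l)[X], r.Monic ∧ r.natDegree = s ∧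
      vp n b ∣ r ^ n} := fun b =>
    Nat.sInf_mem ⟨_, vp n b, vp_monic n b, rfl, dvd_pow_self _ hn⟩
  have hle : ∀ b : Fin n → ZMod l, sB n l b ≤ n := fun b =>
    Nat.sInf_le ⟨vp n b, vp_monic n b, vp_natDegree n b, dvd_pow_self _ hn⟩
  have hmap : ∀ b ∈ s, sB n l b ∈ Finset.range (n+1) := fun b _ =>
    Finset.mem_range.2 (Nat.lt_succ_of_le (hle b))
  rw [← Finset.sum_fiberwise_of_maps_to hmap]
  have hb : ∀ t ∈ Finset.range (n+1), ∑ b ∈ s.filter (fun b => sB n l b = t), l ^ (n - sB n l b) ≤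
      2^(n*n) * l^n := by
    intro t ht
    have ht' : t ≤ n := Nat.lt_succ_iff.1 (Finset.mem_range.1 ht)
    have h1 : ∑ b ∈ s.filter (fun b => sB n l b = t), l ^ (n - sB n l b) =
        (s.filter (fun b => sB n l b = t)).card * l^(n-t) := by
      rw [Finset.sum_congr rfl (g := fun _ => l^(n-t)) (fun b hb => by rw [(Finset.mem_filter.1 hb).2])]
      simp
    rw [h1]
    have h2 : (s.filter (fun b => sB n l b = t)).card ≤ l^t * 2^(n*n) := by
      have hsub : s.filter (fun b => sB n l b = t) ⊆
          (Finset.univ : Finset (Fin t → ZMod l)).biUnion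
            (fun c => s.filter (fun b => vp n b ∣ (vp t c)^n)) := by
        intro b hb
        obtain ⟨hb1, hb2⟩ := Finset.mem_filter.1 hb
        obtain ⟨r, hr, hrn, hd⟩ := hspec b
        rw [hb2] at hrn
        refine Finset.mem_biUnion.2 ⟨fun i => r.coeff i, Finset.mem_univ _, Finset.mem_filter.2 ⟨hb1, ?_⟩⟩
        rw [vp_coeffs hr hrn]; exact hd
      refine (Finset.card_le_card hsub).trans (Finset.card_biUnion_le.trans ?_)
      calc _ ≤ ∑ c : Fin t → ZMod l, 2^(n*n) := by
            apply Finset.sum_le_sum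
            intro c _
            refine (divisors_count n ((vp t c)^n) ((vp_monic t c).pow n).ne_zero _
              (fun b hb => (Finset.mem_filter.1 hb).2)).trans ?_
            rw [(vp_monic t c).natDegree_pow, vp_natDegree]
            exact Nat.pow_le_pow_right (by norm_num) (Nat.mul_le_mul_left _ ht')
        _ = _ := by simp [ZMod.card]
    calc _ ≤ (l^t * 2^(n*n)) * l^(n-t) := Nat.mul_le_mul_right _ h2
      _ = 2^(n*n) * (l^t * l^(n-t)) := by ring
      _ = _ := by rw [← pow_add, Nat.add_sub_cancel' ht']
  refine (Finset.sum_le_sum hb).trans ?_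
  simp [mul_assoc]

lemma box_le (n N : ℕ) (q : ℕ) (hq : 1 ≤ q) (hqN : q ≤ N) :
    ((((2*N+1)/q + 1)^n : ℕ) : ℝ) ≤ (4 * N / q : ℝ)^n := by
  push_cast
  apply pow_le_pow_left₀ (by positivity)
  have h1 : (((2*N+1)/q : ℕ):ℝ) ≤ ((2*N+1 : ℕ):ℝ)/q := Nat.cast_div_le
  have hq0 : (0:ℝ) < q := by exact_mod_cast hq
  have h2 : ((2*N+1 : ℕ):ℝ)/q + 1 ≤ 4 * N / q := by
    rw [div_add_one hq0.ne']
    gcongr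
    push_cast
    have : (q:ℝ) ≤ N := by exact_mod_cast hqN
    have : (1:ℝ) ≤ q := by exact_mod_cast hq
    linarith
  linarith

lemma ncard_PBox_le {n N : ℕ} (T : Set ℤ[X]) (hT : T ⊆ PBox n N) (Q : (Fin n → ℤ) → Prop)
    [DecidablePred Q] (h : ∀ f ∈ T, Q (fun i => f.coeff i)) :
    T.ncard ≤ ((IB n N).filter Q).card := by
  rw [← Set.ncard_coe_finset]
  apply Set.ncard_le_ncard_of_injOn (fun f (i : Fin n) => f.coeff i)
  · intro f hf
    simp only [Finset.coe_filter, Set.mem_ofPred_eq]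
    exact ⟨mem_IB.2 fun i => (hT hf).2.2 i i.2, h f hf⟩
  · intro f hf g hg hfg
    exact coeffs_inj (hT hf).1 (hT hg).1 (hT hf).2.1 (hT hg).2.1 fun i hi => congrFun hfg ⟨i, hi⟩

lemma caseI (n : ℕ) (hn : n ≠ 0) : SmallP n (fun N => {f | f ∈ PBox n N ∧ ∃ S : Finset ℕ,
    (∀ l ∈ S, l.Prime) ∧ ∏ l ∈ S, l ≤ N ∧ N * ∏ l ∈ S, l ≤ ∏ l ∈ S, l ^ (n - sR l f)}) := by
  classical
  set B : ℕ := (n+1) * 2^(n*n) with hB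
  refine ⟨4^n, by positivity, B, fun N hN => ⟨(PBox_finite n N).subset fun f hf => hf.1, ?_⟩⟩
  have hN1 : 1 ≤ N := by omega
  have hN0 : (0:ℝ) < N := by exact_mod_cast hN1
  let w : Finset ℕ → (Fin n → ℤ) → ℕ := fun S a => ∏ l ∈ S, l ^ (n - sB n l (fun i => (a i : ZMod l)))
  refine (Nat.cast_le.2 (ncard_PBox_le (n := n) (N := N) _ (fun f hf => hf.1)
    (fun a => ∃ S ∈ PS N, N * ∏ l ∈ S, l ≤ w S a) ?_)).trans ?_
  · rintro f ⟨hf, S, hS, hSN, h⟩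
    refine ⟨S, (mem_PS hN1).2 ⟨hS, hSN⟩, ?_⟩
    refine h.trans (le_of_eq (Finset.prod_congr rfl fun l hl => ?_))
    rw [sB_eq hf.1 hf.2.1]
  have hq : ∀ S ∈ PS N, 0 < ∏ l ∈ S, l := fun S hS =>
    Finset.prod_pos fun l hl => (((mem_PS hN1).1 hS).1 l hl).pos
  calc ((((IB n N).filter (fun a => ∃ S ∈ PS N, N * ∏ l ∈ S, l ≤ w S a)).card : ℕ) : ℝ)
      = ∑ a ∈ IB n N, if (∃ S ∈ PS N, N * ∏ l ∈ S, l ≤ w S a) then (1:ℝ) else 0 := by simp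
    _ ≤ ∑ a ∈ IB n N, ∑ S ∈ PS N, (w S a : ℝ) / (N * (∏ l ∈ S, l : ℕ)) := by
        apply Finset.sum_le_sum
        intro a _
        split_ifs with h
        · obtain ⟨S, hS, h⟩ := h
          refine le_trans ?_ (Finset.single_le_sum (f := fun S => (w S a : ℝ) / (N * (∏ l ∈ S, l : ℕ)))
            (fun S _ => by positivity) hS)
          have := hq S hS
          rw [one_le_div (by positivity)]
          exact_mod_cast h
        · exact Finset.sum_nonneg fun S _ => by positivity
    _ = ∑ S ∈ PS N, ((∑ a ∈ IB n N, w S a : ℕ) : ℝ) / (N * (∏ l ∈ S, l : ℕ)) := by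
        rw [Finset.sum_comm]
        apply Finset.sum_congr rfl
        intro S _
        rw [Nat.cast_sum, Finset.sum_div]
    _ ≤ ∑ S ∈ PS N, (4^n * (N:ℝ)^(n-1)) * ((B:ℝ)^S.card / ((∏ l ∈ S, l : ℕ):ℝ)) := by
        apply Finset.sum_le_sum
        intro S hS
        obtain ⟨hS1, hS2⟩ := (mem_PS hN1).1 hS
        have h1 := crt_count n N S hS1 (fun l b => l ^ (n - sB n l b)) (fun l => B * l^n)
          (fun l hl s => sB_sum hn (hS1 l hl) s)
        have h2 := box_le n N (∏ l ∈ S, l) (hq S hS) hS2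
        rw [Finset.prod_mul_distrib, Finset.prod_const, Finset.prod_pow] at h1
        have h0 := hq S hS
        generalize (∏ l ∈ S, l) = q at *
        have h0' : (0:ℝ) < q := by exact_mod_cast h0
        have h3 : ((∑ a ∈ IB n N, w S a : ℕ) : ℝ) ≤ (4 * N / q : ℝ)^n * (B^S.card * q^n) := by
          refine (Nat.cast_le.2 h1).trans ?_
          rw [Nat.cast_mul]
          refine mul_le_mul h2 (by push_cast; rfl) (by positivity) (by positivity)
        rw [div_le_iff₀ (by positivity)]
        refine h3.trans (le_of_eq ?_)
        obtain ⟨m, rfl⟩ : ∃ m, n = m + 1 := ⟨n - 1, by omega⟩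
        simp only [Nat.add_sub_cancel]
        rw [div_pow, mul_pow]
        field_simp
        try ring
    _ ≤ (4^n * (N:ℝ)^(n-1)) * Lg N ^ B := by
        rw [← Finset.mul_sum]
        exact mul_le_mul_of_nonneg_left (divsum N hN1 B) (by positivity)
end ModC2

section ModC3
open Polynomial

/-- polynomial without constant term -/
noncomputable def F0 {R : Type*} [CommRing R] (m : ℕ) (a : Fin m → R) : R[X] :=
  vp (m+1) (Fin.cons 0 a)

/-- resultant in the constant term -/
noncomputable def Dl {R : Type*} [CommRing R] (m : ℕ) (a : Fin m → R) : R[X] :=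
  resultant ((derivative (F0 m a)).map C) ((F0 m a).map C + C X) m (m+1)

/-- iterated resultant -/
noncomputable def DD {R : Type*} [CommRing R] (m : ℕ) (a : Fin m → R) : R :=
  resultant (Dl m a) (derivative (Dl m a)) m (m-1)

lemma F0_map {R S : Type*} [CommRing R] [CommRing S] (φ : R →+* S) (m : ℕ) (a : Fin m → R) :
    (F0 m a).map φ = F0 m (fun i => φ (a i)) := by
  unfold F0
  rw [vp_map]
  congr 1
  funext i
  refine Fin.cases ?_ (fun j => ?_) i <;> simp

lemma Dl_map {R S : Type*} [CommRing R] [CommRing S] (φ : R →+* S) (m : ℕ) (a : Fin m → R) :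
    (Dl m a).map φ = Dl m (fun i => φ (a i)) := by
  unfold Dl
  rw [← coe_mapRingHom, ← resultant_map_map, ← F0_map φ]
  congr 1
  · rw [← Polynomial.derivative_map, ← Polynomial.derivative_map, ← Polynomial.derivative_map,
      Polynomial.map_map, Polynomial.map_map]
    congr 1
    congr 1
    ext x; simp
  · rw [Polynomial.map_add, Polynomial.map_map, Polynomial.map_map]
    congr 1
    · congr 1
      ext x; simp
    · simp

lemma DD_map {R S : Type*} [CommRing R] [CommRing S] (φ : R →+* S) (m : ℕ) (a : Fin m → R) :
    φ (DD m a) = DD m (fun i => φ (a i)) := by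
  unfold DD
  rw [← resultant_map_map, ← Polynomial.derivative_map, Dl_map]

lemma vp_cons {R : Type*} [CommRing R] (m : ℕ) (c : R) (a : Fin m → R) :
    vp (m+1) (Fin.cons c a) = F0 m a + C c := by
  simp [F0, vp, Fin.sum_univ_succ]
  ring

lemma Dl_formula {k : Type*} [Field k] (m : ℕ) (a : Fin m → k) (u : k) (τ : Fin m → k)
    (h : derivative (F0 m a) = C u * ∏ j, (X - C (τ j))) :
    Dl m a = C (u^(m+1)) * ∏ j, (X - C (-(F0 m a).eval (τ j))) := by
  unfold Dl
  have hdeg : ((F0 m a).map C + C X).natDegree ≤ m + 1 := by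
    refine (natDegree_add_le _ _).trans ?_
    simp only [natDegree_C]
    refine max_le (natDegree_map_le.trans ?_) (by omega)
    rw [F0, vp_natDegree]
  rw [h, Polynomial.map_mul, map_C, resultant_C_mul_left, Polynomial.map_prod]
  have h2 : (∏ i : Fin m, map (C : k →+* k[X]) (X - C (τ i))).natDegree = m := by
    rw [natDegree_prod_of_monic]
    · simp
    · intro i _
      exact (monic_X_sub_C _).map _
  have h1 := resultant_prod_left (Finset.univ) (fun i : Fin m => map (C : k →+* k[X]) (X - C (τ i)))
    ((F0 m a).map C + C X) (m+1) (by
      rw [Finset.prod_congr rfl (fun i _ => ((monic_X_sub_C (τ i)).map (C : k →+* k[X])).leadingCoeff)]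
      simp) hdeg
  rw [h2] at h1
  rw [h1, C_pow]
  congr 1
  apply Finset.prod_congr rfl
  intro i _
  have h3 := resultant_X_sub_C_pow_left (C (τ i)) ((F0 m a).map C + C X) 1 (m+1) hdeg
  rw [pow_one, pow_one] at h3
  have h4 : map (C : k →+* k[X]) (X - C (τ i)) = X - C (C (τ i)) := by simp
  rw [h4, natDegree_X_sub_C, h3]
  simp [eval_map]
  ring

lemma DD_iff {k : Type*} [Field k] (m : ℕ) (hm : 1 ≤ m) (hmk : (m : k) ≠ 0) (a : Fin m → k) (u : k)
    (hu : u ≠ 0) (τ : Fin m → k)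
    (h : derivative (F0 m a) = C u * ∏ j, (X - C (τ j))) :
    DD m a = 0 ↔ ¬ Function.Injective (fun j => (F0 m a).eval (τ j)) := by
  have hD := Dl_formula m a u τ h
  have hdeg : (Dl m a).natDegree = m := by
    rw [hD, natDegree_C_mul (pow_ne_zero _ hu), natDegree_prod_of_monic]
    · simp
    · intro i _; exact monic_X_sub_C _
  have hsep : (Dl m a).Separable ↔ Function.Injective (fun j => (F0 m a).eval (τ j)) := by
    rw [hD]
    have : Function.Injective (fun j => (F0 m a).eval (τ j)) ↔
        Function.Injective (fun j => -(F0 m a).eval (τ j)) := by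
      simp [Function.Injective]
    rw [this, ← separable_prod_X_sub_C_iff]
    have hun : IsUnit (C (u^(m+1)) : k[X]) := isUnit_C.2 (pow_ne_zero _ hu).isUnit
    constructor
    · intro h; exact h.of_mul_right
    · intro h; exact Separable.unit_mul hun h
  have hne : Dl m a ≠ 0 := by
    intro h0; rw [h0] at hdeg; simp at hdeg; omega
  have hd1 : (derivative (Dl m a)).natDegree = m - 1 := by
    apply le_antisymm
    · exact (natDegree_derivative_le _).trans (by rw [hdeg])
    · apply le_natDegree_of_ne_zero
      rw [coeff_derivative]
      have e : m - 1 + 1 = m := by omega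
      have e2 : ((m - 1 : ℕ) : k) + 1 = m := by rw [← e]; push_cast; simp
      rw [e, e2]
      refine mul_ne_zero ?_ hmk
      have := leadingCoeff_ne_zero.2 hne
      rwa [leadingCoeff, hdeg] at this
  have h3 := resultant_eq_zero_iff (f := Dl m a) (g := derivative (Dl m a))
  rw [hdeg, hd1] at h3
  unfold DD
  rw [h3, ← hsep, Separable]
  simp [hne]

lemma rad_split {k : Type*} [Field k] [IsAlgClosed k] (m : ℕ) (hm : 1 ≤ m)
    (hmk : ((m + 1 : ℕ) : k) ≠ 0) (a : Fin m → k) :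
    ∃ τ : Fin m → k, derivative (F0 m a) = C ((m + 1 : ℕ) : k) * ∏ j, (X - C (τ j)) := by
  have hmon : (F0 m a).Monic := vp_monic _ _
  have hnd : (F0 m a).natDegree = m + 1 := vp_natDegree _ _
  have hd1 : (derivative (F0 m a)).coeff m = ((m + 1 : ℕ) : k) := by
    rw [coeff_derivative]
    have := hmon.coeff_natDegree
    rw [hnd] at this
    rw [this]; push_cast; ring
  have hd : (derivative (F0 m a)).natDegree = m := by
    apply le_antisymm
    · exact (natDegree_derivative_le _).trans (by rw [hnd]; rfl)
    · exact le_natDegree_of_ne_zero (by rw [hd1]; exact hmk)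
  have hsp := (IsAlgClosed.splits (derivative (F0 m a)))
  have h1 := hsp.eq_prod_roots
  have h2 : (derivative (F0 m a)).roots.card = m := by
    rw [← hsp.natDegree_eq_card_roots, hd]
  obtain ⟨L, hL⟩ := Quot.exists_rep (derivative (F0 m a)).roots
  have hL' : (L : Multiset k) = (derivative (F0 m a)).roots := hL
  rw [← hL'] at h1 h2
  rw [Multiset.coe_card] at h2
  subst h2
  refine ⟨fun j => L.get j, ?_⟩
  rw [leadingCoeff, hd, hd1] at h1
  rw [h1]
  congr 1
  rw [Multiset.map_coe, Multiset.prod_coe, ← List.prod_ofFn]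
  congr 1
  conv_lhs => rw [← List.ofFn_get L]
  rw [List.map_ofFn]; rfl

lemma rad_two {k : Type*} [Field k] [IsAlgClosed k] [DecidableEq k] (m : ℕ) (a : Fin m → k) (u : k)
    (hu : u ≠ 0) (τ : Fin m → k) (h : derivative (F0 m a) = C u * ∏ j, (X - C (τ j)))
    (c : k) (r : k[X]) (hr : r ≠ 0) (hrm : r.natDegree + 2 ≤ m + 1) (M : ℕ)
    (hd : F0 m a + C c ∣ r ^ M) :
    2 ≤ (Finset.univ.filter (fun j => (F0 m a).eval (τ j) = -c)).card := by
  classical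
  set f := F0 m a + C c with hf
  have hmon : f.Monic := by rw [hf, ← vp_cons]; exact vp_monic _ _
  have hnd : f.natDegree = m + 1 := by rw [hf, ← vp_cons]; exact vp_natDegree _ _
  have hcard : f.roots.card = m + 1 := by
    rw [← (IsAlgClosed.splits f).natDegree_eq_card_roots, hnd]
  have hdist : f.roots.toFinset.card + 2 ≤ m + 1 := by
    have : f.roots.toFinset ⊆ r.roots.toFinset := by
      intro x hx
      rw [Multiset.mem_toFinset, mem_roots hmon.ne_zero] at hx
      rw [Multiset.mem_toFinset, mem_roots hr]
      have := hx.dvd hd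
      rw [IsRoot, eval_pow] at this
      exact eq_zero_of_pow_eq_zero this
    have h1 := (Finset.card_le_card this).trans ((Multiset.toFinset_card_le _).trans (card_roots' r))
    omega
  have hder : derivative f = C u * ∏ j, (X - C (τ j)) := by rw [hf]; simp [h]
  have hroots : (derivative f).roots = Finset.univ.val.map τ := by
    rw [hder, roots_C_mul _ hu]
    have := roots_multiset_prod_X_sub_C (Finset.univ.val.map τ)
    rw [Multiset.map_map] at this
    exact this
  have hle : ∀ x, f.roots.count x ≤ (Finset.univ.filter (fun j => τ j = x)).card + 1 := by
    intro x
    have h1 : (derivative f).roots.count x = (Finset.univ.filter (fun j => τ j = x)).card := by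
      rw [hroots, Multiset.count_map]
      simp [Finset.card, eq_comm]
    rw [← h1, count_roots, count_roots]
    have hdne : derivative f ≠ 0 := by
      rw [hder]
      exact mul_ne_zero (C_ne_zero.2 hu) (Finset.prod_ne_zero_iff.2 fun j _ => X_sub_C_ne_zero _)
    have := rootMultiplicity_sub_one_le_derivative_rootMultiplicity_of_ne_zero f x hdne
    omega
  have hsum : m + 1 ≤ ∑ x ∈ f.roots.toFinset, ((Finset.univ.filter (fun j => τ j = x)).card + 1) := by
    rw [← hcard, ← Multiset.toFinset_sum_count_eq]
    exact Finset.sum_le_sum fun x _ => hle x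
  rw [Finset.sum_add_distrib, Finset.sum_const, smul_eq_mul, mul_one] at hsum
  have hfin : ∑ x ∈ f.roots.toFinset, (Finset.univ.filter (fun j => τ j = x)).card ≤
      (Finset.univ.filter (fun j => (F0 m a).eval (τ j) = -c)).card := by
    rw [← Finset.card_biUnion]
    · apply Finset.card_le_card
      intro j hj
      simp only [Finset.mem_biUnion, Finset.mem_filter, Finset.mem_univ, true_and,
        Multiset.mem_toFinset] at hj ⊢
      obtain ⟨x, hx, rfl⟩ := hj
      rw [mem_roots hmon.ne_zero, IsRoot, hf] at hx
      simp at hx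
      exact eq_neg_of_add_eq_zero_left hx
    · intro x _ y _ hxy
      rw [Function.onFun, Finset.disjoint_left]
      intro j h1 h2
      apply hxy
      rw [← (Finset.mem_filter.1 h1).2, (Finset.mem_filter.1 h2).2]
  omega

lemma sB_DD {m l : ℕ} (hm : 1 ≤ m) (hl : l.Prime) (hml : m + 1 < l) (b : Fin m → ZMod l) :
    ∃ Z : Finset (ZMod l), Z.card ≤ m ∧
      ∀ c, sB (m+1) l (Fin.cons c b) + 2 ≤ m + 1 → c ∈ Z ∧ DD m b = 0 := by
  classical
  have : Fact l.Prime := ⟨hl⟩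
  let k := AlgebraicClosure (ZMod l)
  let φ : ZMod l →+* k := algebraMap (ZMod l) k
  have hφ : Function.Injective φ := φ.injective
  have hk : CharP k l := charP_of_injective_algebraMap hφ l
  have hm1 : ((m + 1 : ℕ) : k) ≠ 0 := by
    rw [Ne, CharP.cast_eq_zero_iff k l]
    intro h; have := Nat.le_of_dvd (by omega) h; omega
  have hm0 : ((m : ℕ) : k) ≠ 0 := by
    rw [Ne, CharP.cast_eq_zero_iff k l]
    intro h; have := Nat.le_of_dvd (by omega) h; omega
  obtain ⟨τ, hτ⟩ := rad_split m hm hm1 (fun i => φ (b i))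
  set a : Fin m → k := fun i => φ (b i) with ha
  refine ⟨Finset.univ.filter (fun c => φ c ∈ Finset.univ.image (fun j => -(F0 m a).eval (τ j))), ?_, ?_⟩
  · refine le_trans (Finset.card_le_card_of_injOn φ
      (t := Finset.univ.image (fun j => -(F0 m a).eval (τ j))) ?_ hφ.injOn) ?_
    · intro c hc
      exact (Finset.mem_filter.1 hc).2
    · refine Finset.card_image_le.trans (by simp)
  · intro c hc
    have hspec : sB (m+1) l (Fin.cons c b) ∈ {s | ∃ r : (ZMod l)[X], r.Monic ∧ r.natDegree = s ∧
      vp (m+1) (Fin.cons c b : Fin (m+1) → ZMod l) ∣ r ^ (m+1)} :=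
      Nat.sInf_mem ⟨_, vp (m+1) (Fin.cons c b), vp_monic _ _, rfl, dvd_pow_self _ (by omega)⟩
    obtain ⟨r, hr, hrn, hd⟩ := hspec
    have hd' := Polynomial.map_dvd φ hd
    rw [vp_cons, Polynomial.map_add, F0_map, map_C, Polynomial.map_pow] at hd'
    have h2 := rad_two m a _ hm1 τ hτ (φ c) (r.map φ) (hr.map φ).ne_zero
      (by rw [natDegree_map]; omega) (m+1) hd'
    constructor
    · obtain ⟨j, hj⟩ := Finset.card_pos.1 (lt_of_lt_of_le two_pos h2)
      refine Finset.mem_filter.2 ⟨Finset.mem_univ _, Finset.mem_image.2 ⟨j, Finset.mem_univ _, ?_⟩⟩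
      rw [(Finset.mem_filter.1 hj).2, neg_neg]
    · apply hφ
      rw [map_zero, DD_map, DD_iff m hm hm0 a _ hm1 τ hτ]
      intro hinj
      obtain ⟨i, hi, j, hj, hij⟩ := Finset.one_lt_card.1 (lt_of_lt_of_le one_lt_two h2)
      exact hij (hinj ((Finset.mem_filter.1 hi).2.trans (Finset.mem_filter.1 hj).2.symm))

/-- generic iterated discriminant -/
noncomputable def DDp (m : ℕ) : MvPolynomial (Fin m) ℤ := DD m (fun i => MvPolynomial.X i)

lemma DDp_eval {R : Type*} [CommRing R] (m : ℕ) (b : Fin m → R) :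
    MvPolynomial.eval₂ (Int.castRingHom R) b (DDp m) = DD m b := by
  have := DD_map (MvPolynomial.eval₂Hom (Int.castRingHom R) b) m (fun i => MvPolynomial.X i)
  rw [MvPolynomial.coe_eval₂Hom] at this
  simpa [DDp] using this

lemma DDp_ne_zero (m : ℕ) (hm : 1 ≤ m) : DDp m ≠ 0 := by
  intro h0
  obtain ⟨m, rfl⟩ : ∃ p, m = p + 1 := ⟨m - 1, by omega⟩
  let a : Fin (m+1) → ℂ := Fin.cons (-((m + 1 + 1 : ℕ) : ℂ)) 0
  have hF : F0 (m+1) a = X^(m+1+1) - C ((m + 1 + 1 : ℕ) : ℂ) * X := by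
    simp [F0, vp, Fin.sum_univ_succ, a]
    ring
  have h1 : DD (m+1) a = 0 := by rw [← DDp_eval, h0]; simp
  have hc : ((m + 1 + 1 : ℕ) : ℂ) ≠ 0 := Nat.cast_ne_zero.2 (by omega)
  have hc0 : ((m + 1 : ℕ) : ℂ) ≠ 0 := Nat.cast_ne_zero.2 (by omega)
  obtain ⟨τ, hτ⟩ := rad_split (m+1) hm hc a
  rw [DD_iff (m+1) hm hc0 a _ hc τ hτ] at h1
  apply h1
  have h2 : (X^(m+1) - 1 : ℂ[X]) = ∏ j, (X - C (τ j)) := by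
    apply mul_left_cancel₀ (C_ne_zero.2 hc)
    rw [← hτ, hF]
    simp
    ring
  have hsep : (X^(m+1) - 1 : ℂ[X]).Separable := by
    rw [X_pow_sub_one_separable_iff]; exact hc0
  rw [h2] at hsep
  have hinj : Function.Injective τ := separable_prod_X_sub_C_iff.1 hsep
  have hroot : ∀ j, (τ j)^(m+1) = 1 := by
    intro j
    have : eval (τ j) (X^(m+1) - 1 : ℂ[X]) = 0 := by
      rw [h2, eval_prod]
      exact Finset.prod_eq_zero (Finset.mem_univ j) (by simp)
    simpa [sub_eq_zero] using this
  intro i j hij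
  apply hinj
  simp only [hF] at hij
  simp [pow_succ _ (m+1), hroot] at hij
  have e : ((m:ℂ) + 1) * (τ i - τ j) = 0 := by linear_combination -hij
  rcases mul_eq_zero.1 e with h | h
  · exact absurd h (by exact_mod_cast hc0)
  · exact sub_eq_zero.1 h
end ModC3

section ModC4
open Polynomial

lemma mv_bound {m : ℕ} (P : MvPolynomial (Fin m) ℤ) : ∃ K : ℕ, ∀ N : ℕ, 2 ≤ N →
    ∀ a : Fin m → ℤ, (∀ i, |a i| ≤ N) → (MvPolynomial.eval a P).natAbs ≤ N ^ K := by
  induction P using MvPolynomial.induction_on with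
  | C c =>
    refine ⟨c.natAbs, fun N hN a _ => ?_⟩
    rw [MvPolynomial.eval_C]
    exact (Nat.lt_pow_self (by omega)).le
  | add p q hp hq =>
    obtain ⟨K, hK⟩ := hp
    obtain ⟨L, hL⟩ := hq
    refine ⟨max K L + 1, fun N hN a ha => ?_⟩
    rw [map_add]
    refine (Int.natAbs_add_le _ _).trans ?_
    have h1 := (hK N hN a ha).trans (Nat.pow_le_pow_right (by omega) (le_max_left K L))
    have h2 := (hL N hN a ha).trans (Nat.pow_le_pow_right (by omega) (le_max_right K L))
    rw [pow_succ]
    have := Nat.mul_le_mul_left (N ^ max K L) hN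
    omega
  | mul_X p i hp =>
    obtain ⟨K, hK⟩ := hp
    refine ⟨K + 1, fun N hN a ha => ?_⟩
    rw [map_mul, MvPolynomial.eval_X, Int.natAbs_mul, pow_succ]
    refine Nat.mul_le_mul (hK N hN a ha) ?_
    have := abs_le.1 (ha i)
    omega

lemma sz_int {m : ℕ} (P : MvPolynomial (Fin (m+1)) ℤ) (hP : P ≠ 0) (N : ℕ) :
    ((IB (m+1) N).filter (fun a => MvPolynomial.eval a P = 0)).card ≤ P.totalDegree * (2*N+1)^m := by
  classical
  have h := MvPolynomial.schwartz_zippel_totalDegree hP (Finset.Icc (-(N:ℤ)) N)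
  have hc : (Finset.Icc (-(N:ℤ)) N).card = 2*N+1 := by simp; omega
  rw [hc] at h
  have hpos : (0:ℚ≥0) < ((2*N+1 : ℕ):ℚ≥0) := by positivity
  rw [div_le_div_iff₀ (by positivity) hpos] at h
  have h' : ((IB (m+1) N).filter (fun a => MvPolynomial.eval a P = 0)).card * (2*N+1) ≤
      P.totalDegree * (2*N+1)^(m+1) := by
    exact_mod_cast h
  rw [pow_succ, ← mul_assoc] at h'
  exact Nat.le_of_mul_le_mul_right h' (by omega)

lemma sz_mod {m : ℕ} (P : MvPolynomial (Fin (m+1)) ℤ) (hP : P ≠ 0) : ∃ c : ℕ, ∀ l : ℕ, l.Prime →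
    ∀ s : Finset (Fin (m+1) → ZMod l),
    (∀ b ∈ s, MvPolynomial.eval₂ (Int.castRingHom (ZMod l)) b P = 0) → s.card ≤ c * l^m := by
  classical
  obtain ⟨d, hd⟩ := MvPolynomial.ne_zero_iff.1 hP
  refine ⟨P.totalDegree + (MvPolynomial.coeff d P).natAbs, fun l hl s hs => ?_⟩
  have : Fact l.Prime := ⟨hl⟩
  have hcard : s.card ≤ l^(m+1) := by
    refine (Finset.card_le_univ s).trans ?_
    simp [ZMod.card]
  by_cases h0 : MvPolynomial.map (Int.castRingHom (ZMod l)) P = 0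
  · have h1 : (l:ℤ) ∣ MvPolynomial.coeff d P := by
      have := congrArg (MvPolynomial.coeff d) h0
      rw [MvPolynomial.coeff_map, MvPolynomial.coeff_zero] at this
      exact (ZMod.intCast_zmod_eq_zero_iff_dvd _ _).1 this
    have h2 : l ≤ (MvPolynomial.coeff d P).natAbs :=
      Nat.le_of_dvd (Int.natAbs_pos.2 hd) (Int.natCast_dvd.1 h1)
    refine hcard.trans ?_
    rw [pow_succ, mul_comm]
    exact Nat.mul_le_mul_right _ (by omega)
  · have h := MvPolynomial.schwartz_zippel_totalDegree h0 (Finset.univ : Finset (ZMod l))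
    have hc : (Finset.univ : Finset (ZMod l)).card = l := by simp [ZMod.card]
    rw [hc] at h
    have hl0 : (0:ℚ≥0) < (l:ℚ≥0) := by exact_mod_cast hl.pos
    rw [div_le_div_iff₀ (by positivity) hl0] at h
    have h3 : s ⊆ (Fintype.piFinset fun _ : Fin (m+1) => (Finset.univ : Finset (ZMod l))).filter
        (fun b => MvPolynomial.eval b (MvPolynomial.map (Int.castRingHom (ZMod l)) P) = 0) := by
      intro b hb
      refine Finset.mem_filter.2 ⟨by simp, ?_⟩
      rw [MvPolynomial.eval_map]; exact hs b hb
    have h4 := Finset.card_le_card h3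
    have h5 : s.card * l ≤ (MvPolynomial.map (Int.castRingHom (ZMod l)) P).totalDegree * l^(m+1) := by
      refine (Nat.mul_le_mul_right _ h4).trans ?_
      exact_mod_cast h
    rw [pow_succ, ← mul_assoc] at h5
    have h6 := Nat.le_of_mul_le_mul_right h5 hl.pos
    have h7 : (MvPolynomial.map (Int.castRingHom (ZMod l)) P).totalDegree ≤ P.totalDegree :=
      Finset.sup_mono (MvPolynomial.support_map_subset _ _)
    exact h6.trans (Nat.mul_le_mul_right _ (by omega))

lemma block_prod (M t : ℕ) (K : ℕ) : ∀ P : Finset ℕ, (∀ l ∈ P, 1 ≤ l) →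
    (∀ T ⊆ P, T.card = t + 1 → M ≤ ∏ l ∈ T, l) → K * (t+1) ≤ P.card → M ^ K ≤ ∏ l ∈ P, l := by
  classical
  induction K with
  | zero =>
    intro P hP _ _
    rw [pow_zero]
    exact Nat.succ_le_of_lt (Finset.prod_pos fun l hl => Nat.lt_of_succ_le (hP l hl))
  | succ K ih =>
    intro P hP hT hc
    obtain ⟨T, hTP, hTc⟩ := Finset.exists_subset_card_eq (s := P) (n := t+1) (by nlinarith)
    rw [← Finset.prod_sdiff hTP, pow_succ]
    refine Nat.mul_le_mul (ih _ (fun l hl => hP l (Finset.sdiff_subset hl))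
      (fun U hU => hT U (hU.trans Finset.sdiff_subset)) ?_) (hT T hTP hTc)
    rw [Finset.card_sdiff_of_subset hTP, hTc]
    have : (K+1)*(t+1) = K*(t+1) + (t+1) := by ring
    omega

lemma omega_le (N K q : ℕ) (hN : 2 ≤ N) (hq : q ≠ 0) (h : q ≤ N^K) :
    ∃ T ∈ PS N, T ⊆ q.primeFactors ∧ q.primeFactors.card ≤ K * (T.card + 1) := by
  classical
  have hne : (q.primeFactors.powerset.filter (fun T => ∏ l ∈ T, l ≤ N)).Nonempty :=
    ⟨∅, by simp; omega⟩
  obtain ⟨T, hT, hmax⟩ := Finset.exists_max_image _ Finset.card hne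
  obtain ⟨hT1, hT2⟩ := Finset.mem_filter.1 hT
  rw [Finset.mem_powerset] at hT1
  refine ⟨T, (mem_PS (by omega)).2 ⟨fun l hl => Nat.prime_of_mem_primeFactors (hT1 hl), hT2⟩, hT1, ?_⟩
  by_contra! hlt
  have h1 := block_prod (N+1) T.card K q.primeFactors
    (fun l hl => (Nat.prime_of_mem_primeFactors hl).one_lt.le) (by
      intro U hU hUc
      by_contra! hcon
      have := hmax U (Finset.mem_filter.2 ⟨Finset.mem_powerset.2 hU, by omega⟩)
      omega) hlt.le
  have h2 : ∏ l ∈ q.primeFactors, l ≤ q := Nat.le_of_dvd (Nat.pos_of_ne_zero hq) (Nat.prod_primeFactors_dvd q)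
  have h3 : N^K ≤ (N+1)^K := Nat.pow_le_pow_left (by omega) K
  rcases Nat.eq_zero_or_pos K with rfl | hK
  · have : q = 1 := by simp at h; omega
    subst this; simp at hlt
  · have := Nat.pow_lt_pow_left (show N < N + 1 by omega) hK.ne'
    omega

lemma tail_count (m N : ℕ) (hm : 1 ≤ m) (P : Finset ℕ) (Z : (l : ℕ) → Finset (ZMod l))
    (hP : ∀ l ∈ P, l.Prime) (hZ : ∀ l ∈ P, (Z l).card ≤ m) :
    ((Finset.Icc (-(N:ℤ)) N).filter (fun c => ∃ S ⊆ P, N < ∏ l ∈ S, l ∧ ∀ l ∈ S, (c : ZMod l) ∈ Z l)).card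
      ≤ 3 * (m+1)^P.card := by
  classical
  have key : ∀ S ⊆ P, N < ∏ l ∈ S, l →
      ((Finset.Icc (-(N:ℤ)) N).filter (fun c => ∀ l ∈ S, (c : ZMod l) ∈ Z l)).card ≤ 3 * m^S.card := by
    intro S hS hN
    have h1 := crt_count 1 N S (fun l hl => hP l (hS hl)) (fun l b => if b 0 ∈ Z l then 1 else 0)
      (fun _ => m) (by
        intro l hl s
        rw [Finset.sum_boole]
        refine le_trans ?_ (hZ l (hS hl))
        refine Finset.card_le_card_of_injOn (fun b => b 0) ?_ ?_
        · intro b hb; exact (Finset.mem_filter.1 hb).2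
        · intro b _ b' _ h
          funext i; rw [Subsingleton.elim i 0]; exact h)
    have h2 : (2*N+1)/(∏ l ∈ S, l) + 1 ≤ 3 := by
      have : (2*N+1)/(∏ l ∈ S, l) < 3 := by
        rw [Nat.div_lt_iff_lt_mul (by omega)]; omega
      omega
    rw [pow_one, Finset.prod_const] at h1
    refine le_trans ?_ (h1.trans (Nat.mul_le_mul_right _ h2))
    rw [Finset.card_filter]
    have e : IB 1 N = (Finset.Icc (-(N:ℤ)) N).image (fun c => fun _ : Fin 1 => c) := by
      ext a
      rw [mem_IB, Finset.mem_image]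
      constructor
      · intro h
        exact ⟨a 0, Finset.mem_Icc.2 (abs_le.1 (h 0)), funext fun i => by rw [Subsingleton.elim i 0]⟩
      · rintro ⟨c, hc, rfl⟩ i
        exact abs_le.2 (Finset.mem_Icc.1 hc)
    rw [e, Finset.sum_image (fun x _ y _ h => congrFun h 0)]
    apply Finset.sum_le_sum
    intro c _
    split_ifs with h
    · rw [Finset.prod_congr rfl (g := fun _ => 1) (fun l hl => if_pos (h l hl))]
      simp
    · exact Nat.zero_le _
  calc _ ≤ ((P.powerset.filter (fun S => N < ∏ l ∈ S, l)).biUnion fun S =>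
        (Finset.Icc (-(N:ℤ)) N).filter (fun c => ∀ l ∈ S, (c : ZMod l) ∈ Z l)).card := by
        apply Finset.card_le_card
        intro c hc
        obtain ⟨hc1, S, hS, hN, h⟩ := Finset.mem_filter.1 hc
        exact Finset.mem_biUnion.2 ⟨S, Finset.mem_filter.2 ⟨Finset.mem_powerset.2 hS, hN⟩,
          Finset.mem_filter.2 ⟨hc1, h⟩⟩
    _ ≤ ∑ S ∈ P.powerset.filter (fun S => N < ∏ l ∈ S, l), 3 * m^S.card := by
        refine Finset.card_biUnion_le.trans (Finset.sum_le_sum fun S hS => ?_)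
        obtain ⟨h1, h2⟩ := Finset.mem_filter.1 hS
        exact key S (Finset.mem_powerset.1 h1) h2
    _ ≤ ∑ S ∈ P.powerset, 3 * m^S.card :=
        Finset.sum_le_sum_of_subset_of_nonneg (Finset.filter_subset _ _) (fun _ _ _ => Nat.zero_le _)
    _ = _ := by
        rw [← Finset.mul_sum, ← Finset.sum_pow_mul_eq_add_pow]
        simp

lemma avg_count (m N K A c : ℕ) (hN : 2 ≤ N) (P : MvPolynomial (Fin (m+1)) ℤ)
    (hK : ∀ a : Fin (m+1) → ℤ, (∀ i, |a i| ≤ N) → (MvPolynomial.eval a P).natAbs ≤ N ^ K)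
    (hA : 1 ≤ A)
    (hc : ∀ l : ℕ, l.Prime → ∀ s : Finset (Fin (m+1) → ZMod l),
      (∀ b ∈ s, MvPolynomial.eval₂ (Int.castRingHom (ZMod l)) b P = 0) → s.card ≤ c * l^m) :
    ((∑ a ∈ (IB (m+1) N).filter (fun a => MvPolynomial.eval a P ≠ 0),
      A ^ (MvPolynomial.eval a P).natAbs.primeFactors.card : ℕ) : ℝ) ≤
      A^K * (4^(m+1) * (N:ℝ)^(m+1)) * Lg N ^ (A^K * c) := by
  classical
  have hN1 : 1 ≤ N := by omega
  have hq : ∀ S ∈ PS N, 0 < ∏ l ∈ S, l := fun S hS =>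
    Finset.prod_pos fun l hl => (((mem_PS hN1).1 hS).1 l hl).pos
  let w : Finset ℕ → (Fin (m+1) → ℤ) → ℕ := fun T a => ∏ l ∈ T,
    if MvPolynomial.eval₂ (Int.castRingHom (ZMod l)) (fun i => (a i : ZMod l)) P = 0 then 1 else 0
  have hw : ∀ (l : ℕ) (a : Fin (m+1) → ℤ), (l:ℤ) ∣ MvPolynomial.eval a P →
      MvPolynomial.eval₂ (Int.castRingHom (ZMod l)) (fun i => (a i : ZMod l)) P = 0 := by
    intro l a h
    have h1 : Int.castRingHom (ZMod l) (MvPolynomial.eval a P) = 0 :=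
      (ZMod.intCast_zmod_eq_zero_iff_dvd _ _).2 h
    rw [← h1, ← MvPolynomial.eval₂_id, MvPolynomial.hom_eval₂]
    rfl
  have step1 : ∑ a ∈ (IB (m+1) N).filter (fun a => MvPolynomial.eval a P ≠ 0),
      A ^ (MvPolynomial.eval a P).natAbs.primeFactors.card ≤
      ∑ T ∈ PS N, A^K * (A^K)^T.card * ∑ a ∈ IB (m+1) N, w T a := by
    simp_rw [Finset.mul_sum]
    rw [Finset.sum_comm]
    refine le_trans ?_ (Finset.sum_le_sum_of_subset_of_nonneg
      (Finset.filter_subset (fun a => MvPolynomial.eval a P ≠ 0) _) (fun _ _ _ => Nat.zero_le _))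
    apply Finset.sum_le_sum
    intro a ha
    obtain ⟨ha1, ha2⟩ := Finset.mem_filter.1 ha
    obtain ⟨T, hT, hT1, hT2⟩ := omega_le N K _ hN (Int.natAbs_ne_zero.2 ha2) (hK a (mem_IB.1 ha1))
    refine le_trans ?_ (Finset.single_le_sum (f := fun T => A^K * (A^K)^T.card * w T a)
      (fun _ _ => Nat.zero_le _) hT)
    have : w T a = 1 := by
      apply Finset.prod_eq_one
      intro l hl
      rw [if_pos]
      apply hw
      exact Int.natCast_dvd.2 (Nat.dvd_of_mem_primeFactors (hT1 hl))
    simp only [this, mul_one]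
    refine (Nat.pow_le_pow_right hA hT2).trans (le_of_eq ?_)
    rw [← pow_mul, ← pow_add]; congr 1; ring
  refine (Nat.cast_le.2 step1).trans ?_
  rw [Nat.cast_sum]
  calc _ ≤ ∑ T ∈ PS N, (A^K * (4^(m+1) * (N:ℝ)^(m+1))) *
        (((A^K * c : ℕ):ℝ)^T.card / ((∏ l ∈ T, l : ℕ):ℝ)) := by
        apply Finset.sum_le_sum
        intro S hS
        obtain ⟨hS1, hS2⟩ := (mem_PS hN1).1 hS
        have h1 := crt_count (m+1) N S hS1 (fun l b =>
            if MvPolynomial.eval₂ (Int.castRingHom (ZMod l)) b P = 0 then 1 else 0) (fun l => c * l^m)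
          (fun l hl s => by
            rw [Finset.sum_boole]
            exact hc l (hS1 l hl) _ fun b hb => (Finset.mem_filter.1 hb).2)
        have h2 := box_le (m+1) N (∏ l ∈ S, l) (hq S hS) hS2
        rw [Finset.prod_mul_distrib, Finset.prod_const, Finset.prod_pow] at h1
        have h0 := hq S hS
        generalize (∏ l ∈ S, l) = q at *
        have h0' : (0:ℝ) < q := by exact_mod_cast h0
        have h3 : ((∑ a ∈ IB (m+1) N, w S a : ℕ) : ℝ) ≤ (4 * N / q : ℝ)^(m+1) * (c^S.card * q^m) := by
          refine (Nat.cast_le.2 h1).trans ?_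
          rw [Nat.cast_mul]
          refine mul_le_mul h2 (by push_cast; rfl) (by positivity) (by positivity)
        rw [Nat.cast_mul]
        refine (mul_le_mul_of_nonneg_left h3 (by positivity)).trans (le_of_eq ?_)
        push_cast
        rw [div_pow, mul_pow, mul_pow]
        field_simp
        try ring
    _ ≤ _ := by
        rw [← Finset.mul_sum]
        exact mul_le_mul_of_nonneg_left (divsum N hN1 _) (by positivity)

lemma caseIII (n : ℕ) (hn : 3 ≤ n) : SmallP n (fun N => {f | f ∈ PBox n N ∧ ∃ S : Finset ℕ,
    (∀ l ∈ S, l.Prime ∧ n < l ∧ sR l f + 2 ≤ n) ∧ N < ∏ l ∈ S, l}) := by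
  classical
  obtain ⟨m, rfl⟩ : ∃ m, n = m + 1 + 1 := ⟨n - 2, by omega⟩
  have hne := DDp_ne_zero (m+1) (by omega)
  obtain ⟨K, hK⟩ := mv_bound (DDp (m+1))
  obtain ⟨c, hc⟩ := sz_mod _ hne
  set P := DDp (m+1) with hPdef
  set A : ℕ := m + 1 + 1 with hA
  refine ⟨P.totalDegree * 3^(m+1) + 3 * (A^K * 4^(m+1)), by positivity, A^K*c, fun N hN =>
    ⟨(PBox_finite _ N).subset fun f hf => hf.1, ?_⟩⟩
  have hev : ∀ (l : ℕ) (a : Fin (m+1) → ℤ), DD (m+1) (fun i => (a i : ZMod l)) = 0 →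
      (l:ℤ) ∣ MvPolynomial.eval a P := by
    intro l a h
    rw [← ZMod.intCast_zmod_eq_zero_iff_dvd, ← h, ← DDp_eval, ← MvPolynomial.eval₂_id]
    exact MvPolynomial.hom_eval₂ _ _ (Int.castRingHom (ZMod l)) _
  have hZ : ∀ (l : ℕ) (b : Fin (m+1) → ZMod l), ∃ Z : Finset (ZMod l), l.Prime → m + 1 + 1 < l →
      Z.card ≤ m+1 ∧ ∀ c, sB (m+1+1) l (Fin.cons c b) + 2 ≤ m + 1 + 1 → c ∈ Z ∧ DD (m+1) b = 0 := by
    intro l b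
    by_cases h : l.Prime ∧ m + 1 + 1 < l
    · obtain ⟨Z, hZ1, hZ2⟩ := sB_DD (m := m+1) (by omega) h.1 h.2 b
      exact ⟨Z, fun _ _ => ⟨hZ1, hZ2⟩⟩
    · exact ⟨∅, fun h1 h2 => absurd ⟨h1, h2⟩ h⟩
  choose Z hZ using hZ
  let Q : (Fin (m+1) → ℤ) → Finset ℤ := fun a =>
    (Finset.Icc (-(N:ℤ)) N).filter (fun c => ∃ S ⊆ (MvPolynomial.eval a P).natAbs.primeFactors.filter (m+1+1 < ·),
      N < ∏ l ∈ S, l ∧ ∀ l ∈ S, (c : ZMod l) ∈ Z l (fun i => (a i : ZMod l)))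
  let G : Finset (Σ _ : Fin (m+1) → ℤ, ℤ) :=
    ((IB (m+1) N).filter (fun a => MvPolynomial.eval a P = 0)).sigma (fun _ => Finset.Icc (-(N:ℤ)) N) ∪
    ((IB (m+1) N).filter (fun a => MvPolynomial.eval a P ≠ 0)).sigma Q
  have hG : {f | f ∈ PBox (m+1+1) N ∧ ∃ S : Finset ℕ,
      (∀ l ∈ S, l.Prime ∧ m+1+1 < l ∧ sR l f + 2 ≤ m+1+1) ∧ N < ∏ l ∈ S, l}.ncard ≤ G.card := by
    rw [← Set.ncard_coe_finset]
    apply Set.ncard_le_ncard_of_injOn (fun f => (⟨fun i : Fin (m+1) => f.coeff ((i:ℕ)+1), f.coeff 0⟩ :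
      Σ _ : Fin (m+1) → ℤ, ℤ))
    · rintro f ⟨hf, S, hS, hNS⟩
      have hb0 : f.coeff 0 ∈ Finset.Icc (-(N:ℤ)) N := Finset.mem_Icc.2 (abs_le.1 (hf.2.2 0 (by omega)))
      have hb : (fun i : Fin (m+1) => f.coeff ((i:ℕ)+1)) ∈ IB (m+1) N :=
        mem_IB.2 fun i => hf.2.2 _ (by omega)
      rw [Finset.mem_coe]
      by_cases h0 : MvPolynomial.eval (fun i : Fin (m+1) => f.coeff ((i:ℕ)+1)) P = 0
      · exact Finset.mem_union_left _ (Finset.mem_sigma.2 ⟨Finset.mem_filter.2 ⟨hb, h0⟩, hb0⟩)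
      · refine Finset.mem_union_right _ (Finset.mem_sigma.2 ⟨Finset.mem_filter.2 ⟨hb, h0⟩, ?_⟩)
        have hmain : ∀ l ∈ S, (f.coeff 0 : ZMod l) ∈ Z l (fun i => (f.coeff ((i:ℕ)+1) : ZMod l)) ∧
            DD (m+1) (fun i : Fin (m+1) => (f.coeff ((i:ℕ)+1) : ZMod l)) = 0 := by
          intro l hl
          obtain ⟨h1, h2, h3⟩ := hS l hl
          apply (hZ l _ h1 h2).2
          rw [sB_eq hf.1 hf.2.1] at h3
          convert h3 using 3
          funext i
          refine Fin.cases ?_ (fun j => ?_) i <;> simp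
        refine Finset.mem_filter.2 ⟨hb0, S, fun l hl => ?_, hNS, fun l hl => (hmain l hl).1⟩
        obtain ⟨h1, h2, h3⟩ := hS l hl
        refine Finset.mem_filter.2 ⟨Nat.mem_primeFactors.2 ⟨h1, ?_, Int.natAbs_ne_zero.2 h0⟩, h2⟩
        exact Int.natCast_dvd.1 (hev l _ (hmain l hl).2)
    · rintro f ⟨hf, _⟩ g ⟨hg, _⟩ hfg
      simp only [Sigma.mk.injEq, heq_eq_eq] at hfg
      refine coeffs_inj hf.1 hg.1 hf.2.1 hg.2.1 fun i hi => ?_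
      rcases i with _ | i
      · exact hfg.2
      · exact congrFun hfg.1 ⟨i, by omega⟩
  have h1 : G.card ≤ P.totalDegree * (2*N+1)^m * (2*N+1) +
      3 * ∑ a ∈ (IB (m+1) N).filter (fun a => MvPolynomial.eval a P ≠ 0),
      A ^ (MvPolynomial.eval a P).natAbs.primeFactors.card := by
    refine (Finset.card_union_le _ _).trans (Nat.add_le_add ?_ ?_)
    · rw [Finset.card_sigma, Finset.sum_const, smul_eq_mul]
      refine Nat.mul_le_mul (sz_int P hne N) ?_
      simp; omega
    · rw [Finset.card_sigma, Finset.mul_sum]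
      apply Finset.sum_le_sum
      intro a ha
      refine (tail_count (m+1) N (by omega) _ (fun l => Z l (fun i => (a i : ZMod l))) ?_ ?_).trans ?_
      · intro l hl
        exact Nat.prime_of_mem_primeFactors (Finset.mem_filter.1 hl).1
      · intro l hl
        obtain ⟨h1, h2⟩ := Finset.mem_filter.1 hl
        exact (hZ l _ (Nat.prime_of_mem_primeFactors h1) h2).1
      · exact Nat.mul_le_mul_left _ (Nat.pow_le_pow_right (by omega)
          (Finset.card_le_card (Finset.filter_subset _ _)))
  have h2 := avg_count m N K A c hN P (hK N hN) (by omega) hc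
  refine (Nat.cast_le.2 (hG.trans h1)).trans ?_
  rw [Nat.cast_add, Nat.cast_mul 3]
  have hL : 1 ≤ Lg N ^ (A^K*c) := one_le_pow₀ (Lg_one_le N)
  have h3 : ((P.totalDegree * (2*N+1)^m * (2*N+1) : ℕ):ℝ) ≤ P.totalDegree * 3^(m+1) * (N:ℝ)^(m+1) * Lg N ^ (A^K*c) := by
    have e : (2*N+1 : ℝ)^(m+1) ≤ (3*N:ℝ)^(m+1) := by
      apply pow_le_pow_left₀ (by positivity)
      have : (2:ℝ) ≤ N := by exact_mod_cast hN
      linarith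
    push_cast
    rw [mul_assoc, ← pow_succ]
    calc _ ≤ (P.totalDegree:ℝ) * (3*N:ℝ)^(m+1) := by gcongr
      _ = P.totalDegree * 3^(m+1) * (N:ℝ)^(m+1) * 1 := by rw [mul_pow]; ring
      _ ≤ _ := by gcongr
  have e : m + 1 + 1 - 1 = m + 1 := rfl
  rw [e]
  calc _ ≤ P.totalDegree * 3^(m+1) * (N:ℝ)^(m+1) * Lg N ^ (A^K*c) +
        3 * (A^K * (4^(m+1) * (N:ℝ)^(m+1)) * Lg N ^ (A^K * c)) := by
        refine add_le_add h3 ?_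
        rw [Nat.cast_ofNat]
        exact mul_le_mul_of_nonneg_left h2 (by norm_num)
    _ = _ := by ring
end ModC4

section ModH1
open Polynomial

/-- dihedral invariants -/
def iz {R : Type*} [CommRing R] (x : Fin 5 → R) : R := ∑ i, x i * x (i + 1)
def iw {R : Type*} [CommRing R] (x : Fin 5 → R) : R := ∑ i, x i * x (i + 2)
def iU {R : Type*} [CommRing R] (x : Fin 5 → R) : R := ∑ k, x k * (2 * x k * x (k + 1)
  + 2 * x (k + 2) * x (k + 4) + x (k + 3) ^ 2 + 2 * x k * x (k + 4) + 2 * x (k + 1) * x (k + 3)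
  + x (k + 2) ^ 2)
def iV {R : Type*} [CommRing R] (x : Fin 5 → R) : R := ∑ k, x k * (2 * x k * x (k + 2)
  + x (k + 1) ^ 2 + 2 * x (k + 3) * x (k + 4) + 2 * x k * x (k + 3) + 2 * x (k + 1) * x (k + 2)
  + x (k + 4) ^ 2)

lemma om_ex : ∃ w : ℂ, 1 + w + w ^ 2 + w ^ 3 + w ^ 4 = 0 := by
  have h := Complex.isPrimitiveRoot_exp 5 (by norm_num)
  have := h.geom_sum_eq_zero (by norm_num)
  refine ⟨Complex.exp (2 * ↑Real.pi * Complex.I / (5:ℕ)), ?_⟩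
  simpa only [Finset.sum_range_succ, Finset.sum_range_zero, pow_zero, pow_one, zero_add] using this

noncomputable def om : ℂ := om_ex.choose
lemma om_eq : 1 + om + om ^ 2 + om ^ 3 + om ^ 4 = 0 := om_ex.choose_spec

noncomputable def ca (z w : ℂ) : ℂ := (om + om ^ 4 - 2) * z + (om ^ 2 + om ^ 3 - 2) * w
noncomputable def cb (z w : ℂ) : ℂ := (om ^ 2 + om ^ 3 - 2) * z + (om + om ^ 4 - 2) * w

lemma om5 : om ^ 5 = 1 := by linear_combination (om - 1) * om_eq

lemma ca_cb (z w : ℂ) : ca z w * cb z w = 5 * (z ^ 2 + 3 * z * w + w ^ 2) := by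
  unfold ca cb
  have h : om ^ 4 = -1 - om - om ^ 2 - om ^ 3 := by linear_combination om_eq
  have h5 := om5
  have h6 : om ^ 6 = om := by linear_combination om * om5
  have h7 : om ^ 7 = om ^ 2 := by linear_combination om ^ 2 * om5
  have h8 : om ^ 8 = om ^ 3 := by linear_combination om ^ 3 * om5
  ring_nf
  simp only [h8, h7, h6, h5, h]
  ring

lemma form_ne {z w : ℤ} (h : z ≠ 0 ∨ w ≠ 0) : z ^ 2 + 3 * z * w + w ^ 2 ≠ 0 := by
  intro h0
  have h1 : (2 * z + 3 * w) ^ 2 = 5 * w ^ 2 := by linear_combination 4 * h0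
  have hw : w ≠ 0 := by
    rintro rfl
    simp at h0
    simp_all
  have irr := Nat.Prime.irrational_sqrt (p := 5) (by norm_num)
  apply irr
  refine ⟨|(2 * z + 3 * w : ℚ) / w|, ?_⟩
  symm
  push_cast
  rw [Real.sqrt_eq_iff_mul_self_eq (by norm_num) (abs_nonneg _), abs_mul_abs_self]
  have hw' : (w : ℝ) ≠ 0 := by exact_mod_cast hw
  have h1' : (2 * (z:ℝ) + 3 * w) ^ 2 = 5 * w ^ 2 := by exact_mod_cast h1
  field_simp
  linarith

lemma ca_ne {z w : ℤ} (h : z ≠ 0 ∨ w ≠ 0) : ca z w * cb z w ≠ 0 := by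
  rw [ca_cb]
  have := form_ne h
  intro h
  apply this
  have : ((z:ℂ) ^ 2 + 3 * z * w + w ^ 2) = 0 := by simpa using h
  exact_mod_cast this

/-- the polynomial recovered from the resolvents -/
noncomputable def recP (a b : ℂ) (t : ℂ × ℂ) : ℂ[X] :=
  ∏ j : Fin 5, (X - C ((1 / 5) * (om ^ (4 * (j:ℕ)) * t.2 + om ^ (3 * (j:ℕ)) * (b * t.2 ^ 2 / t.1)
    + om ^ (2 * (j:ℕ)) * (t.1 / t.2 ^ 2) + om ^ (j:ℕ) * (a / t.2))))

noncomputable def recS (a b u v : ℂ) : Finset (ℂ × ℂ) :=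
  ((C 1 * X ^ 2 + C (-u) * X + C (a ^ 2 * b) : ℂ[X]).roots.toFinset ×ˢ
    (C 1 * X ^ 2 + C (-v) * X + C (a * b ^ 2) : ℂ[X]).roots.toFinset).biUnion (fun s =>
      (nthRoots 5 (s.1 ^ 2 * s.2 / b ^ 2)).toFinset.image (fun y => (s.1, y)))

lemma recS_card (a b u v : ℂ) : (recS a b u v).card ≤ 20 := by
  unfold recS
  have hq : ∀ u c : ℂ, (C 1 * X ^ 2 + C (-u) * X + C c : ℂ[X]).roots.toFinset.card ≤ 2 := by
    intro u c
    refine (Multiset.toFinset_card_le _).trans ((card_roots' _).trans ?_)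
    exact natDegree_quadratic_le
  refine Finset.card_biUnion_le.trans ?_
  have : ∀ s ∈ ((C 1 * X ^ 2 + C (-u) * X + C (a ^ 2 * b) : ℂ[X]).roots.toFinset ×ˢ
    (C 1 * X ^ 2 + C (-v) * X + C (a * b ^ 2) : ℂ[X]).roots.toFinset),
     ((nthRoots 5 (s.1 ^ 2 * s.2 / b ^ 2)).toFinset.image (fun y => (s.1, y))).card ≤ 5 := by
    intro s _
    exact Finset.card_image_le.trans ((Multiset.toFinset_card_le _).trans (card_nthRoots _ _))
  refine (Finset.sum_le_card_nsmul _ _ _ this).trans ?_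
  rw [Finset.card_product, smul_eq_mul]
  have := Nat.mul_le_mul (hq u (a ^ 2 * b)) (hq v (a * b ^ 2))
  omega

lemma mem_quad {u c P : ℂ} (h : P ^ 2 - u * P + c = 0) :
    P ∈ (C 1 * X ^ 2 + C (-u) * X + C c : ℂ[X]).roots.toFinset := by
  rw [Multiset.mem_toFinset, mem_roots]
  · simp [IsRoot]; linear_combination h
  · intro h0
    have := natDegree_quadratic (a := (1:ℂ)) (b := -u) (c := c) one_ne_zero
    rw [h0] at this; simp at this

set_option linter.unusedSimpArgs false in
set_option maxRecDepth 20000 in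
lemma rec_mem (x0 x1 x2 x3 x4 : ℂ) (hs : x0 + x1 + x2 + x3 + x4 = 0) {z w U V : ℂ}
    (hz : iz ![x0, x1, x2, x3, x4] = z) (hw : iw ![x0, x1, x2, x3, x4] = w)
    (hU : iU ![x0, x1, x2, x3, x4] = U) (hV : iV ![x0, x1, x2, x3, x4] = V)
    (hne : ca z w * cb z w ≠ 0) :
    ∃ t ∈ recS (ca z w) (cb z w) (ca U V) (cb U V),
      recP (ca z w) (cb z w) t = ∏ j : Fin 5, (X - C (![x0, x1, x2, x3, x4] j)) := by
  set o := om with ho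
  have h : o ^ 4 = -1 - o - o ^ 2 - o ^ 3 := by linear_combination om_eq
  have h5 : o ^ 5 = 1 := om5
  have hp : ∀ k, o ^ (k + 5) = o ^ k := fun k => by rw [pow_add, h5, mul_one]
  have e5 := hp 0
  have e6 := hp 1
  have e7 := hp 2
  have e8 := hp 3
  have e9 := hp 4
  have e10 := hp 5
  have e11 := hp 6
  have e12 := hp 7
  have e13 := hp 8
  have e14 := hp 9
  have e15 := hp 10
  have e16 := hp 11
  have e17 := hp 12
  have e18 := hp 13
  have e19 := hp 14
  have e20 := hp 15
  norm_num at e20 e19 e18 e17 e5 e6 e7 e8 e9 e10 e11 e12 e13 e14 e15 e16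
  have hx0 : x0 = -x1 - x2 - x3 - x4 := by linear_combination hs
  obtain ⟨y1, hy1⟩ : ∃ y, y = x0 + o * x1 + o ^ 2 * x2 + o ^ 3 * x3 + o ^ 4 * x4 := ⟨_, rfl⟩
  obtain ⟨y2, hy2⟩ : ∃ y, y = x0 + o ^ 2 * x1 + o ^ 4 * x2 + o * x3 + o ^ 3 * x4 := ⟨_, rfl⟩
  obtain ⟨y3, hy3⟩ : ∃ y, y = x0 + o ^ 3 * x1 + o * x2 + o ^ 4 * x3 + o ^ 2 * x4 := ⟨_, rfl⟩
  obtain ⟨y4, hy4⟩ : ∃ y, y = x0 + o ^ 4 * x1 + o ^ 3 * x2 + o ^ 2 * x3 + o * x4 := ⟨_, rfl⟩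
  have ha : ca z w = y1 * y4 := by
    rw [← hz, ← hw, hy1, hy4]
    simp only [ca, iz, iw, iU, iV, Fin.sum_univ_five, ← ho, Fin.reduceAdd, Fin.isValue, Matrix.cons_val, hx0]
    ring_nf
    simp only [e16, e15, e14, e13, e12, e11, e10, e9, e8, e7, e6, e5, h]
    ring
  have hb : cb z w = y2 * y3 := by
    rw [← hz, ← hw, hy2, hy3]
    simp only [cb, iz, iw, iU, iV, Fin.sum_univ_five, ← ho, Fin.reduceAdd, Fin.isValue, Matrix.cons_val, hx0]
    ring_nf
    simp only [e16, e15, e14, e13, e12, e11, e10, e9, e8, e7, e6, e5, h]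
    ring
  have hu : ca U V = y1 ^ 2 * y3 + y4 ^ 2 * y2 := by
    rw [← hU, ← hV, hy1, hy2, hy3, hy4]
    simp only [ca, iz, iw, iU, iV, Fin.sum_univ_five, ← ho, Fin.reduceAdd, Fin.isValue, Matrix.cons_val, hx0]
    ring_nf
    simp only [e16, e15, e14, e13, e12, e11, e10, e9, e8, e7, e6, e5, h]
    ring
  have hv : cb U V = y2 ^ 2 * y1 + y3 ^ 2 * y4 := by
    rw [← hU, ← hV, hy1, hy2, hy3, hy4]
    simp only [cb, iz, iw, iU, iV, Fin.sum_univ_five, ← ho, Fin.reduceAdd, Fin.isValue, Matrix.cons_val, hx0]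
    ring_nf
    simp only [e16, e15, e14, e13, e12, e11, e10, e9, e8, e7, e6, e5, h]
    ring
  rw [ha, hb] at hne ⊢
  rw [hu, hv]
  have n1 : y1 ≠ 0 := by rintro rfl; simp at hne
  have n2 : y2 ≠ 0 := by rintro rfl; simp at hne
  have n3 : y3 ≠ 0 := by rintro rfl; simp at hne
  have n4 : y4 ≠ 0 := by rintro rfl; simp at hne
  refine ⟨(y1 ^ 2 * y3, y1), ?_, ?_⟩
  · rw [recS, Finset.mem_biUnion]
    refine ⟨(y1 ^ 2 * y3, y2 ^ 2 * y1), Finset.mk_mem_product (mem_quad (by ring)) (mem_quad (by ring)), ?_⟩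
    rw [Finset.mem_image]
    refine ⟨y1, ?_, rfl⟩
    rw [Multiset.mem_toFinset, mem_nthRoots (by norm_num)]
    field_simp
  · have k2 : y2 * y3 * y1 ^ 2 / (y1 ^ 2 * y3) = y2 := by field_simp
    have k3 : y1 ^ 2 * y3 / y1 ^ 2 = y3 := by field_simp
    have k4 : y1 * y4 / y1 = y4 := by field_simp
    unfold recP
    simp only [k2, k3, k4, ← ho]
    refine Finset.prod_congr rfl fun j _ => ?_
    congr 2
    rw [hy1, hy2, hy3, hy4]
    fin_cases j <;> simp only [hx0, Fin.isValue, Matrix.cons_val, Fin.reduceFinMk, Fin.coe_ofNat_eq_mod, Nat.reduceMod, Nat.reduceMul, pow_zero, Fin.zero_eta, Fin.mk_one] <;> ring_nf <;> simp only [e20, e19, e18, e17, e16, e15, e14, e13, e12, e11, e10, e9, e8, e7, e6, e5, h] <;> ring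
end ModH1

section ModH2
open Polynomial

def DQ (z w U V : ℤ) : Set ℤ[X] := {q | ∃ x : Fin 5 → ℂ,
  q.map (Int.castRingHom ℂ) = ∏ j, (X - C (x j)) ∧ ∑ j, x j = 0 ∧
  iz x = z ∧ iw x = w ∧ iU x = U ∧ iV x = V}

lemma DQ_card {z w : ℤ} (h : z ≠ 0 ∨ w ≠ 0) (U V : ℤ) :
    (DQ z w U V).Finite ∧ (DQ z w U V).ncard ≤ 20 := by
  classical
  set F : Finset ℂ[X] := (recS (ca z w) (cb z w) (ca U V) (cb U V)).image (recP (ca z w) (cb z w)) with hF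
  have hinj : Function.Injective (fun q : ℤ[X] => q.map (Int.castRingHom ℂ)) :=
    map_injective _ (RingHom.injective_int _)
  have hsub : (fun q : ℤ[X] => q.map (Int.castRingHom ℂ)) '' DQ z w U V ⊆ F := by
    rintro _ ⟨q, ⟨x, hq, hs, h1, h2, h3, h4⟩, rfl⟩
    have hx : x = ![x 0, x 1, x 2, x 3, x 4] := by
      ext i; fin_cases i <;> rfl
    have hs' := hs
    rw [Fin.sum_univ_five] at hs'
    obtain ⟨t, ht, he⟩ := rec_mem (x 0) (x 1) (x 2) (x 3) (x 4) hs' (hx ▸ h1) (hx ▸ h2) (hx ▸ h3)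
      (hx ▸ h4) (ca_ne h)
    simp only [hq, hF, Finset.coe_image, Set.mem_image]
    refine ⟨t, ht, ?_⟩
    rw [he, ← hx]
  have hfin := F.finite_toSet.subset hsub
  refine ⟨hfin.of_finite_image hinj.injOn, ?_⟩
  rw [← Set.ncard_image_of_injective _ hinj]
  refine (Set.ncard_le_ncard hsub F.finite_toSet).trans ?_
  rw [Set.ncard_coe_finset]
  exact Finset.card_image_le.trans (recS_card _ _ _ _)

noncomputable def Bx (lam : ℕ) : Finset ((ℤ × ℤ) × (ℤ × ℤ)) :=
  ((Finset.Icc (-(2000 * lam ^ 2 : ℤ)) (2000 * lam ^ 2) ×ˢ Finset.Icc (-(2000 * lam ^ 2 : ℤ)) (2000 * lam ^ 2)) ×ˢ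
  (Finset.Icc (-(400000 * lam ^ 3 : ℤ)) (400000 * lam ^ 3) ×ˢ Finset.Icc (-(400000 * lam ^ 3 : ℤ)) (400000 * lam ^ 3))).filter
  (fun t => t.1.1 ≠ 0 ∨ t.1.2 ≠ 0)

def W5 (lam : ℕ) (i : ℕ) : ℕ := if 3 ≤ i then 0 else 2 ^ 5 * (4 * 5 * lam) ^ (5 - i)

noncomputable def Q5 (lam : ℕ) : Set ℤ[X] :=
  WBox 5 (W5 lam) ∪ ⋃ t ∈ Bx lam, DQ t.1.1 t.1.2 t.2.1 t.2.2

lemma Bx_card {lam : ℕ} (h : 1 ≤ lam) : (Bx lam).card ≤ 5000 ^ 2 * 1000000 ^ 2 * lam ^ 10 := by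
  refine (Finset.card_filter_le _ _).trans ?_
  rw [Finset.card_product, Finset.card_product, Finset.card_product, Int.card_Icc, Int.card_Icc]
  have h2 : 1 ≤ lam ^ 2 := Nat.one_le_pow _ _ h
  have h3 : 1 ≤ lam ^ 3 := Nat.one_le_pow _ _ h
  have e1 : ((2000 * (lam:ℤ) ^ 2) + 1 - -(2000 * (lam:ℤ) ^ 2)).toNat ≤ 5000 * lam ^ 2 := by
    zify at h2; rw [Int.toNat_le]; push_cast; linarith
  have e2 : ((400000 * (lam:ℤ) ^ 3) + 1 - -(400000 * (lam:ℤ) ^ 3)).toNat ≤ 1000000 * lam ^ 3 := by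
    zify at h3; rw [Int.toNat_le]; push_cast; linarith
  calc _ ≤ (5000 * lam ^ 2 * (5000 * lam ^ 2)) * ((1000000 * lam ^ 3) * (1000000 * lam ^ 3)) := by gcongr
    _ = _ := by ring

lemma Q5_card : ∃ C0 : ℝ, 0 < C0 ∧ ∀ lam : ℕ, 1 ≤ lam → (Q5 lam).Finite ∧
    ((Q5 lam).ncard : ℝ) ≤ C0 * (lam : ℝ) ^ ((5 - 1) * (5 - 2)) := by
  refine ⟨((100 ^ 3 * 20 ^ 12 + 5000 ^ 2 * 1000000 ^ 2 * 20 : ℕ) : ℝ), by positivity, fun lam h => ?_⟩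
  obtain ⟨f1, c1⟩ := WBox_finite_card 5 (W5 lam)
  have hne : ∀ t ∈ Bx lam, t.1.1 ≠ 0 ∨ t.1.2 ≠ 0 := fun t ht => (Finset.mem_filter.1 ht).2
  have f2 : (⋃ t ∈ Bx lam, DQ t.1.1 t.1.2 t.2.1 t.2.2).Finite :=
    Set.Finite.biUnion (Bx lam).finite_toSet fun t ht => (DQ_card (hne t ht) _ _).1
  have c2 : (⋃ t ∈ Bx lam, DQ t.1.1 t.1.2 t.2.1 t.2.2).ncard ≤ 5000 ^ 2 * 1000000 ^ 2 * lam ^ 10 * 20 := by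
    refine (Finset.set_ncard_biUnion_le _ _).trans ?_
    refine (Finset.sum_le_card_nsmul _ _ 20 fun t ht => (DQ_card (hne t ht) _ _).2).trans ?_
    rw [smul_eq_mul]
    exact Nat.mul_le_mul_right _ (Bx_card h)
  refine ⟨f1.union f2, ?_⟩
  have c3 : ∏ i ∈ Finset.range 5, (2 * W5 lam i + 1) ≤ 100 ^ 3 * 20 ^ 12 * lam ^ 12 := by
    simp only [Finset.prod_range_succ, Finset.prod_range_zero, W5]
    norm_num
    have k : ∀ m, 64 * (20 * lam) ^ m + 1 ≤ 100 * (20 * lam) ^ m := fun m => by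
      have : 1 ≤ (20 * lam) ^ m := Nat.one_le_pow _ _ (by omega)
      omega
    have k5 := k 5
    have k4 := k 4
    have k3 := k 3
    simp only [← mul_assoc] 
    norm_num
    calc _ = (64 * (20 * lam) ^ 5 + 1) * (64 * (20 * lam) ^ 4 + 1) * (64 * (20 * lam) ^ 3 + 1) := by ring
      _ ≤ (100 * (20 * lam) ^ 5) * (100 * (20 * lam) ^ 4) * (100 * (20 * lam) ^ 3) := by gcongr
      _ = _ := by ring
  have : (Q5 lam).ncard ≤ (100 ^ 3 * 20 ^ 12 + 5000 ^ 2 * 1000000 ^ 2 * 20) * lam ^ 12 := by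
    refine (Set.ncard_union_le _ _).trans ((Nat.add_le_add (c1.trans c3) c2).trans ?_)
    have : lam ^ 10 ≤ lam ^ 12 := Nat.pow_le_pow_right h (by norm_num)
    nlinarith
  norm_num only
  exact_mod_cast this
end ModH2

section ModH3
open Polynomial

lemma coeffs5 (x : Fin 5 → ℂ) : (∏ j, (X - C (x j))).coeff 4 = - ∑ j, x j ∧
    (∏ j, (X - C (x j))).coeff 3 = iz x + iw x := by
  have h : ∏ j, (X - C (x j)) = X ^ 5 + C (- ∑ j, x j) * X ^ 4 + C (iz x + iw x) * X ^ 3 +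
      C (-(x 0 * x 1 * x 2 + x 0 * x 1 * x 3 + x 0 * x 1 * x 4 + x 0 * x 2 * x 3 + x 0 * x 2 * x 4
        + x 0 * x 3 * x 4 + x 1 * x 2 * x 3 + x 1 * x 2 * x 4 + x 1 * x 3 * x 4 + x 2 * x 3 * x 4)) * X ^ 2 +
      C (x 0 * x 1 * x 2 * x 3 + x 0 * x 1 * x 2 * x 4 + x 0 * x 1 * x 3 * x 4 + x 0 * x 2 * x 3 * x 4
        + x 1 * x 2 * x 3 * x 4) * X + C (-(x 0 * x 1 * x 2 * x 3 * x 4)) := by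
    simp only [iz, iw, Fin.prod_univ_five, Fin.sum_univ_five, map_add, map_mul, map_neg, Fin.reduceAdd, Fin.isValue]
    ring
  rw [h]
  constructor <;>
  simp only [coeff_add, coeff_X_pow, coeff_C_mul, coeff_X, coeff_C] <;> norm_num

lemma sum_bd (g : Fin 5 → ℂ) (c : ℝ) (h : ∀ i, ‖g i‖ ≤ c) : ‖∑ i, g i‖ ≤ 5 * c := by
  refine (norm_sum_le _ _).trans ?_
  refine (Finset.sum_le_card_nsmul _ _ c fun i _ => h i).trans ?_
  simp

lemma m2 {a b : ℂ} {B : ℝ} (ha : ‖a‖ ≤ B) (hb : ‖b‖ ≤ B) : ‖a * b‖ ≤ B ^ 2 := by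
  rw [norm_mul, sq]; exact mul_le_mul ha hb (norm_nonneg _) ((norm_nonneg _).trans ha)

lemma m6 {a b c d e f g h i j k : ℂ} {B : ℝ} (ha : ‖a‖ ≤ B) (hb : ‖b‖ ≤ B) (hc : ‖c‖ ≤ B) (hd : ‖d‖ ≤ B)
    (he : ‖e‖ ≤ B) (hf : ‖f‖ ≤ B) (hg : ‖g‖ ≤ B) (hh : ‖h‖ ≤ B) (hi : ‖i‖ ≤ B) (hj : ‖j‖ ≤ B) (hk : ‖k‖ ≤ B) :
    ‖a * (2 * (b * c) + 2 * (d * e) + f * f + 2 * (g * h) + 2 * (i * j) + k * k)‖ ≤ 10 * B ^ 3 := by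
  have hB : 0 ≤ B := (norm_nonneg _).trans ha
  have e1 := m2 hb hc
  have e2 := m2 hd he
  have e3 := m2 hf hf
  have e4 := m2 hg hh
  have e5 := m2 hi hj
  have e6 := m2 hk hk
  have t : ∀ p : ℂ, ‖2 * p‖ = 2 * ‖p‖ := fun p => by simp
  have : ‖2 * (b * c) + 2 * (d * e) + f * f + 2 * (g * h) + 2 * (i * j) + k * k‖ ≤ 10 * B ^ 2 := by
    have a1 := norm_add_le (2 * (b * c) + 2 * (d * e) + f * f + 2 * (g * h) + 2 * (i * j)) (k * k)
    have a2 := norm_add_le (2 * (b * c) + 2 * (d * e) + f * f + 2 * (g * h)) (2 * (i * j))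
    have a3 := norm_add_le (2 * (b * c) + 2 * (d * e) + f * f) (2 * (g * h))
    have a4 := norm_add_le (2 * (b * c) + 2 * (d * e)) (f * f)
    have a5 := norm_add_le (2 * (b * c)) (2 * (d * e))
    simp only [t] at a1 a2 a3 a4 a5
    linarith
  rw [norm_mul]
  calc _ ≤ B * (10 * B ^ 2) := mul_le_mul ha this (norm_nonneg _) hB
    _ = _ := by ring

lemma int_bd {z : ℤ} {c : ℂ} {M : ℤ} (h : c = z) (hb : ‖c‖ ≤ (M:ℝ)) : z ∈ Finset.Icc (-M) M := by
  rw [h, Complex.norm_intCast] at hb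
  rw [Finset.mem_Icc, ← abs_le]
  exact_mod_cast hb

lemma mem_Q5 {q : ℤ[X]} {lam : ℕ} (hq : q.Monic) (hd : q.natDegree = 5) (h4 : q.coeff 4 = 0)
    (hr : ∀ x : ℂ, aeval x q = 0 → ‖x‖ ≤ (4 * 5 * lam : ℕ)) (x : Fin 5 → ℂ)
    (hx : q.map (Int.castRingHom ℂ) = ∏ j, (X - C (x j))) {z w U V : ℤ}
    (hz : iz x = z) (hw : iw x = w) (hU : iU x = U) (hV : iV x = V) : q ∈ Q5 lam := by
  have hc4 := (coeffs5 x).1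
  have hc3 := (coeffs5 x).2
  rw [← hx, coeff_map] at hc4 hc3
  rw [h4] at hc4
  have hs : ∑ j, x j = 0 := by simpa using hc4.symm
  by_cases h0 : z ≠ 0 ∨ w ≠ 0
  · right
    rw [Set.mem_iUnion₂]
    refine ⟨((z, w), (U, V)), ?_, ⟨x, hx, hs, hz, hw, hU, hV⟩⟩
    have hb : ∀ j, ‖x j‖ ≤ 20 * lam := by
      intro j
      have := hr (x j) ?_
      · push_cast at this; linarith
      · have e : eval (x j) (q.map (Int.castRingHom ℂ)) = 0 := by
          rw [hx, eval_prod]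
          exact Finset.prod_eq_zero (Finset.mem_univ j) (by simp)
        rwa [eval_map, ← algebraMap_int_eq, ← aeval_def] at e
    rw [Bx, Finset.mem_filter]
    refine ⟨?_, h0⟩
    refine Finset.mk_mem_product (Finset.mk_mem_product (int_bd hz ?_) (int_bd hw ?_))
      (Finset.mk_mem_product (int_bd hU ?_) (int_bd hV ?_))
    · refine (sum_bd _ _ fun i => m2 (hb i) (hb (i + 1))).trans (le_of_eq ?_)
      push_cast; ring
    · refine (sum_bd _ _ fun i => m2 (hb i) (hb (i + 2))).trans (le_of_eq ?_)
      push_cast; ring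
    · refine (sum_bd _ (10 * (20 * lam) ^ 3) fun k => ?_).trans (le_of_eq ?_)
      · refine le_trans (le_of_eq ?_) (m6 (hb k) (hb k) (hb (k + 1)) (hb (k + 2)) (hb (k + 4)) (hb (k + 3))
          (hb k) (hb (k + 4)) (hb (k + 1)) (hb (k + 3)) (hb (k + 2)))
        congr 1; ring
      · push_cast; ring
    · refine (sum_bd _ (10 * (20 * lam) ^ 3) fun k => ?_).trans (le_of_eq ?_)
      · refine le_trans (le_of_eq ?_) (m6 (hb k) (hb k) (hb (k + 2)) (hb (k + 3)) (hb (k + 4)) (hb (k + 1))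
          (hb k) (hb (k + 3)) (hb (k + 1)) (hb (k + 2)) (hb (k + 4)))
        congr 1; ring
      · push_cast; ring
  · left
    push Not at h0
    rw [hz, hw, h0.1, h0.2] at hc3
    have h3 : q.coeff 3 = 0 := by simpa using hc3
    refine ⟨hq, hd, fun i hi => ?_⟩
    unfold W5
    split_ifs with h
    · have : i = 3 ∨ i = 4 := by omega
      rcases this with rfl | rfl <;> simp [h3, h4]
    · exact wbox_of_roots hq hd hr i
end ModH3

section ModH4
/-- `k`-homogeneity -/
def KH (G R : Type*) [Group G] [MulAction G R] (k : ℕ) : Prop :=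
  ∀ S T : Finset R, S.card = k → T.card = k → ∃ g : G, (fun x => g • x) '' (S : Set R) = T

lemma dih_fin : ∀ t0 t1 : Fin 5, (t1 - t0 = 1 ∨ t1 - t0 = 4) → ∀ t2 : Fin 5, (t2 - t1 = 1 ∨ t2 - t1 = 4) →
    ∀ t3 : Fin 5, (t3 - t2 = 1 ∨ t3 - t2 = 4) → ∀ t4 : Fin 5, (t4 - t3 = 1 ∨ t4 - t3 = 4) →
    (t0 - t4 = 1 ∨ t0 - t4 = 4) →
    (t1 = t0 + 1 ∧ t2 = t0 + 2 ∧ t3 = t0 + 3 ∧ t4 = t0 + 4) ∨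
    (t1 = t0 - 1 ∧ t2 = t0 - 2 ∧ t3 = t0 - 3 ∧ t4 = t0 - 4) := by
  intro t0 t1 h1 t2 h2 t3 h3 t4 h4 h5
  simp only [sub_eq_iff_eq_add'] at h1 h2 h3 h4
  rcases h1 with rfl | rfl <;> rcases h2 with rfl | rfl <;> rcases h3 with rfl | rfl <;>
    rcases h4 with rfl | rfl <;> revert t0 <;> decide

lemma cyc_label {G R : Type*} [Group G] [Finite G] [Fintype R] [MulAction G R] [MulAction.IsPretransitive G R]
    (h5 : Fintype.card R = 5) : ∃ (L : Fin 5 ≃ R) (s : G), ∀ i, s • L i = L (i + 1) := by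
  classical
  have : Fact (Nat.Prime 5) := ⟨by norm_num⟩
  have hne : Nonempty R := Fintype.card_pos_iff.1 (by omega)
  obtain ⟨r⟩ := hne
  set H := (MulAction.toPermHom G R).range
  have htr : MulAction.IsPretransitive H R := ⟨fun x y => by
    obtain ⟨g, hg⟩ := MulAction.exists_smul_eq G x y
    exact ⟨⟨MulAction.toPermHom G R g, g, rfl⟩, hg⟩⟩
  have hdvd : 5 ∣ Nat.card H := by
    have := MulAction.index_stabilizer_of_transitive H r
    rw [Nat.card_eq_fintype_card, h5] at this
    rw [← this]
    exact Subgroup.index_dvd_card _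
  obtain ⟨σ, hσ⟩ := exists_prime_orderOf_dvd_card' 5 hdvd
  obtain ⟨⟨σ, s, rfl⟩, hσ'⟩ : ∃ τ : H, orderOf (τ : Equiv.Perm R) = 5 := ⟨σ, by rw [← hσ]; exact Subgroup.orderOf_coe σ⟩
  set σ := MulAction.toPermHom G R s
  have hcyc : σ.IsCycle := Equiv.Perm.isCycle_of_prime_order'' (by rw [h5]; norm_num) (by rw [h5]; exact hσ')
  have hsupp : σ.support = Finset.univ := by
    rw [← Finset.card_eq_iff_eq_univ, ← hcyc.orderOf, h5]; exact hσ'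
  have hon : σ.IsCycleOn (Finset.univ : Finset R) := by
    have := hcyc.isCycleOn
    convert this using 1
    ext x
    have : x ∈ σ.support := by rw [hsupp]; exact Finset.mem_univ x
    simpa using this
  have hinj : Function.Injective (fun i : Fin 5 => (σ ^ (i : ℕ)) r) := by
    intro i j hij
    have := (hon.pow_apply_eq_pow_apply (Finset.mem_univ r)).1 hij
    rw [Finset.card_univ, h5] at this
    ext
    have := Nat.ModEq.eq_of_lt_of_lt this i.2 j.2
    exact this
  refine ⟨Equiv.ofBijective _ ((Fintype.bijective_iff_injective_and_card _).2 ⟨hinj, by simp [h5]⟩), s, fun i => ?_⟩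
  change σ ((σ ^ (i : ℕ)) r) = (σ ^ ((i + 1 : Fin 5) : ℕ)) r
  rw [← Equiv.Perm.mul_apply, ← pow_succ', hon.pow_apply_eq_pow_apply (Finset.mem_univ r), Finset.card_univ, h5]
  revert i; decide

lemma dihedral {G R : Type*} [Group G] [Finite G] [Fintype R] [MulAction G R] [MulAction.IsPretransitive G R]
    (h5 : Fintype.card R = 5) (hk : ¬ KH G R 2) : ∃ L : Fin 5 ≃ R, ∀ g : G,
      (∃ c : Fin 5, ∀ i, g • L i = L (c + i)) ∨ (∃ c : Fin 5, ∀ i, g • L i = L (c - i)) := by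
  classical
  obtain ⟨L, s, hs⟩ := cyc_label (G := G) h5
  refine ⟨L, ?_⟩
  set P : Fin 5 → Fin 5 → Prop := fun a b =>
    ∃ g : G, (g • L 0 = L a ∧ g • L 1 = L b) ∨ (g • L 0 = L b ∧ g • L 1 = L a) with hP
  have symm : ∀ a b, P a b → P b a := fun a b ⟨g, h⟩ => ⟨g, h.symm⟩
  have act : ∀ (g : G) a b a' b', g • L a = L a' → g • L b = L b' → P a b → P a' b' := by
    rintro g a b a' b' h1 h2 ⟨k, ⟨h3, h4⟩ | ⟨h3, h4⟩⟩
    · exact ⟨g * k, Or.inl ⟨by rw [mul_smul, h3, h1], by rw [mul_smul, h4, h2]⟩⟩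
    · exact ⟨g * k, Or.inr ⟨by rw [mul_smul, h3, h2], by rw [mul_smul, h4, h1]⟩⟩
  have sh : ∀ a b, P a b → P (a + 1) (b + 1) := fun a b h => act s a b _ _ (hs a) (hs b) h
  have P0 : P 0 1 := ⟨1, Or.inl ⟨one_smul _ _, one_smul _ _⟩⟩
  have P1 : ∀ a, P a (a + 1) := by
    have h1 := sh _ _ P0
    have h2 := sh _ _ h1
    have h3 := sh _ _ h2
    have h4 := sh _ _ h3
    intro a; fin_cases a
    exacts [P0, h1, h2, h3, h4]
  have nP : (∀ a b, a ≠ b → P a b) → False := by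
    intro hall
    apply hk
    intro S T hS hT
    obtain ⟨x, y, hxy, rfl⟩ := Finset.card_eq_two.1 hS
    obtain ⟨u, v, huv, rfl⟩ := Finset.card_eq_two.1 hT
    obtain ⟨g, hg⟩ := hall (L.symm x) (L.symm y) (by simpa using hxy)
    obtain ⟨h, hh⟩ := hall (L.symm u) (L.symm v) (by simpa using huv)
    simp only [Equiv.apply_symm_apply] at hg hh
    refine ⟨h * g⁻¹, ?_⟩
    push_cast
    rw [Set.image_pair]
    rcases hg with ⟨rfl, rfl⟩ | ⟨rfl, rfl⟩ <;> rcases hh with ⟨rfl, rfl⟩ | ⟨rfl, rfl⟩ <;>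
      simp [mul_smul, Set.pair_comm]
  have P2 : ∀ a, ¬ P a (a + 2) := by
    intro a h
    have h1 := sh _ _ h
    have h2 := sh _ _ h1
    have h3 := sh _ _ h2
    have h4 := sh _ _ h3
    have all2 : ∀ a, P a (a + 2) := by
      intro b; fin_cases a <;> fin_cases b <;> assumption
    refine nP fun a b hab => ?_
    have : b = a + 1 ∨ a = b + 1 ∨ b = a + 2 ∨ a = b + 2 := by revert a b; decide
    rcases this with h | h | h | h
    · rw [h]; exact P1 a
    · rw [h]; exact symm _ _ (P1 b)
    · rw [h]; exact all2 a
    · rw [h]; exact symm _ _ (all2 b)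
  intro g
  set t : Fin 5 → Fin 5 := fun i => L.symm (g • L i) with ht
  have hLt : ∀ i, g • L i = L (t i) := fun i => by simp [ht]
  have hti : ∀ i, t (i + 1) - t i = 1 ∨ t (i + 1) - t i = 4 := by
    intro i
    have hp : P (t i) (t (i + 1)) := act g i (i + 1) _ _ (hLt i) (hLt (i + 1)) (P1 i)
    have hne : t (i + 1) ≠ t i := by
      intro h
      have : L (i + 1) = L i := MulAction.injective g (by simp only [hLt, h])
      have h1 : ∀ i : Fin 5, i + 1 ≠ i := by decide
      exact h1 i (L.injective this)
    have hn2 : t (i + 1) ≠ t i + 2 := fun h => P2 _ (h ▸ hp)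
    have hn3 : t i ≠ t (i + 1) + 2 := fun h => P2 _ (h ▸ symm _ _ hp)
    generalize t (i + 1) = a at *
    generalize t i = b at *
    clear_value P t
    clear hp P2 nP P1 P0 sh act symm hLt hP ht
    revert a b; decide
  have key := dih_fin (t 0) (t 1) (hti 0) (t 2) (hti 1) (t 3) (hti 2) (t 4) (hti 3) (hti 4)
  rcases key with ⟨k1, k2, k3, k4⟩ | ⟨k1, k2, k3, k4⟩
  · left; refine ⟨t 0, fun i => ?_⟩
    rw [hLt]; congr 1
    fin_cases i
    exacts [(add_zero _).symm, k1, k2, k3, k4]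
  · right; refine ⟨t 0, fun i => ?_⟩
    rw [hLt]; congr 1
    fin_cases i
    exacts [(sub_zero _).symm, k1, k2, k3, k4]
end ModH4

section ModH5
open Polynomial NumberField

attribute [local instance] Polynomial.Gal.splits_ℚ_ℂ

section
variable {R S : Type*} [CommRing R] [CommRing S]
lemma map_iz (φ : R →+* S) (x : Fin 5 → R) : φ (iz x) = iz (fun i => φ (x i)) := by simp [iz]
lemma map_iw (φ : R →+* S) (x : Fin 5 → R) : φ (iw x) = iw (fun i => φ (x i)) := by simp [iw]
lemma map_iU (φ : R →+* S) (x : Fin 5 → R) : φ (iU x) = iU (fun i => φ (x i)) := by simp [iU, map_ofNat]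
lemma map_iV (φ : R →+* S) (x : Fin 5 → R) : φ (iV x) = iV (fun i => φ (x i)) := by simp [iV, map_ofNat]

def DInv (F : (Fin 5 → R) → R) : Prop := ∀ x c, F (fun i => x (c + i)) = F x ∧ F (fun i => x (c - i)) = F x

lemma dinv_iz : DInv (iz (R := R)) := by
  intro x c; unfold iz; constructor <;> fin_cases c <;> simp only [Fin.sum_univ_five, Fin.reduceAdd, Fin.reduceSub, Fin.isValue, Fin.reduceFinMk, Fin.zero_eta, Fin.mk_one] <;> ring
lemma dinv_iw : DInv (iw (R := R)) := by
  intro x c; unfold iw; constructor <;> fin_cases c <;> simp only [Fin.sum_univ_five, Fin.reduceAdd, Fin.reduceSub, Fin.isValue, Fin.reduceFinMk, Fin.zero_eta, Fin.mk_one] <;> ring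
lemma dinv_iU : DInv (iU (R := R)) := by
  intro x c; unfold iU; constructor <;> fin_cases c <;> simp only [Fin.sum_univ_five, Fin.reduceAdd, Fin.reduceSub, Fin.isValue, Fin.reduceFinMk, Fin.zero_eta, Fin.mk_one] <;> ring
lemma dinv_iV : DInv (iV (R := R)) := by
  intro x c; unfold iV; constructor <;> fin_cases c <;> simp only [Fin.sum_univ_five, Fin.reduceAdd, Fin.reduceSub, Fin.isValue, Fin.reduceFinMk, Fin.zero_eta, Fin.mk_one] <;> ring
end

lemma fixed_int {f : ℤ[X]} (hf : f.Monic) (hirr : Irreducible f) (a : FF f) (ha : IsIntegral ℤ a)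
    (h : ∀ g : (fQ f).Gal, g a = a) : ∃ z : ℤ, a = z := by
  have hsf : IsSplittingField ℚ (FF f) (fQ f) := IsSplittingField.splittingField (fQ f)
  have : IsGalois ℚ (FF f) := IsGalois.of_separable_splitting_field (p := fQ f) (irr_Q hf hirr).separable
  have h1 : a ∈ (⊥ : IntermediateField ℚ (FF f)) := (IsGalois.mem_bot_iff_fixed a).2 h
  obtain ⟨r, rfl⟩ := IntermediateField.mem_bot.1 h1
  have h2 : IsIntegral ℤ r := (isIntegral_algebraMap_iff (algebraMap ℚ (FF f)).injective).1 ha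
  obtain ⟨z, rfl⟩ := IsIntegrallyClosed.isIntegral_iff.1 h2
  exact ⟨z, by simp⟩

lemma gen_poly {α γ : ℂ} (hα : IsIntegral ℚ α) (h : γ ∈ IntermediateField.adjoin ℚ {α}) :
    ∃ p : ℚ[X], aeval α p = γ := by
  have h1 : γ ∈ Algebra.adjoin ℚ {α} := by
    rw [← IntermediateField.adjoin_simple_toSubalgebra_of_isAlgebraic hα.isAlgebraic]; exact h
  rw [Algebra.adjoin_singleton_eq_range_aeval] at h1
  exact h1

lemma h5 {f q : ℤ[X]} {α γ : ℂ} {lam : ℕ} (hP : ¬ KH (fQ f).Gal (RR f) 2) (hf : f.Monic)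
    (hd : f.natDegree = 5) (hirr : Irreducible f) (hα : aeval α f = 0)
    (hγ : IntermediateField.adjoin ℚ {γ} = IntermediateField.adjoin ℚ {α}) (hq : q.Monic)
    (hqd : q.natDegree = 5) (hqr : aeval γ q = 0)
    (h4 : q.coeff (5 - 1) = 0) (hr : ∀ x : ℂ, aeval x q = 0 → ‖x‖ ≤ (4 * 5 * lam : ℕ)) : q ∈ Q5 lam := by
  have hm : fQ f = minpoly ℚ α := minpoly_Q hf hirr hα
  obtain ⟨h, hh⟩ := gen_poly (integral_of_root hf hα).tower_top
    (hγ ▸ IntermediateField.mem_adjoin_simple_self ℚ γ)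
  obtain ⟨h2, hh2⟩ := gen_poly (integral_of_root hq hqr).tower_top
    (hγ.symm ▸ IntermediateField.mem_adjoin_simple_self ℚ α)
  have : MulAction.IsPretransitive (fQ f).Gal (RR f) := Gal.galAction_isPretransitive _ _ (irr_Q hf hirr)
  obtain ⟨L, hL⟩ := dihedral (G := (fQ f).Gal) (R := RR f) (by rw [card_RR hf hirr, hd]) hP
  have hroot : ∀ x : RR f, aeval (lf hf x : FF f) (fQ f) = 0 := fun x =>
    aeval_eq_zero_of_mem_rootSet ((Gal.rootsEquivRoots (fQ f) ℂ).symm x).2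
  have hdiv : ∀ p : ℚ[X], aeval α p = 0 → ∀ x : RR f, aeval (lf hf x : FF f) p = 0 := by
    intro p hp x
    obtain ⟨c, hc⟩ : fQ f ∣ p := hm ▸ minpoly.dvd ℚ α hp
    rw [hc, map_mul, hroot, zero_mul]
  set Y : RR f → FF f := fun x => aeval (lf hf x : FF f) h with hY
  have hYg : ∀ (g : (fQ f).Gal) x, g (Y x) = Y (g • x) := by
    intro g x
    have := lf_smul hf g x
    simp only [hY]
    change _ = aeval (lf hf (Gal.galActionHom (fQ f) ℂ g x) : FF f) h
    rw [this]
    exact (aeval_algHom_apply (AlgEquiv.toAlgHom (R := ℚ) (A₁ := FF f) (A₂ := FF f) g) _ h).symm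
  have hYq : ∀ x, aeval (Y x) q = 0 := by
    intro x
    have := hdiv ((fQ q).comp h) (by rw [aeval_comp, hh]; exact (aeval_map_algebraMap ℚ γ q).trans hqr) x
    rw [aeval_comp] at this
    rw [← aeval_map_algebraMap ℚ]
    exact this
  have hYinj : Function.Injective Y := by
    have k : ∀ x, aeval (Y x) h2 = (lf hf x : FF f) := by
      intro x
      have := hdiv (h2.comp h - X) (by rw [map_sub, aeval_comp, hh, hh2, aeval_X, sub_self]) x
      rwa [map_sub, aeval_comp, aeval_X, sub_eq_zero] at this
    intro x y hxy
    have := k x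
    rw [hxy, k y] at this
    exact (Gal.rootsEquivRoots (fQ f) ℂ).symm.injective (Subtype.ext this.symm)
  have hYint : ∀ x, IsIntegral ℤ (Y x) := fun x => ⟨q, hq, by simpa [aeval_def] using hYq x⟩
  let e : FF f →ₐ[ℚ] ℂ := IsAlgClosed.lift
  set y : Fin 5 → FF f := fun i => Y (L i) with hy
  let yO : Fin 5 → 𝓞 (FF f) := fun i => ⟨y i, hYint _⟩
  have main : ∀ F : (Fin 5 → FF f) → FF f, DInv F → (∀ (g : FF f →+* FF f) x, g (F x) = F (fun i => g (x i))) →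
      IsIntegral ℤ (F y) → ∃ z : ℤ, F y = z := by
    intro F hF1 hF2 hF3
    refine fixed_int hf hirr _ hF3 fun g => ?_
    have := hF2 (g : FF f →+* FF f) y
    refine this.trans ?_
    have hgi : ∀ i, (g : FF f →+* FF f) (y i) = Y (g • L i) := fun i => hYg g (L i)
    simp only [hgi]
    rcases hL g with ⟨c, hc⟩ | ⟨c, hc⟩ <;> simp only [hc]
    · exact (hF1 y c).1
    · exact (hF1 y c).2
  have emb : ∀ i, algebraMap (𝓞 (FF f)) (FF f) (yO i) = y i := fun i => rfl
  obtain ⟨z, hz⟩ := main iz dinv_iz map_iz (by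
    have := map_iz (algebraMap (𝓞 (FF f)) (FF f)) yO
    simp only [emb] at this; rw [← this]; exact RingOfIntegers.isIntegral_coe _)
  obtain ⟨w, hw⟩ := main iw dinv_iw map_iw (by
    have := map_iw (algebraMap (𝓞 (FF f)) (FF f)) yO
    simp only [emb] at this; rw [← this]; exact RingOfIntegers.isIntegral_coe _)
  obtain ⟨U, hU⟩ := main iU dinv_iU map_iU (by
    have := map_iU (algebraMap (𝓞 (FF f)) (FF f)) yO
    simp only [emb] at this; rw [← this]; exact RingOfIntegers.isIntegral_coe _)
  obtain ⟨V, hV⟩ := main iV dinv_iV map_iV (by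
    have := map_iV (algebraMap (𝓞 (FF f)) (FF f)) yO
    simp only [emb] at this; rw [← this]; exact RingOfIntegers.isIntegral_coe _)
  refine mem_Q5 hq hqd h4 hr (fun i => e (y i)) ?_ (z := z) (w := w) (U := U) (V := V) ?_ ?_ ?_ ?_
  · have hinj : Function.Injective (fun i => e (y i)) :=
      e.toRingHom.injective.comp (hYinj.comp L.injective)
    have hroots : ∀ i, (q.map (Int.castRingHom ℂ)).IsRoot (e (y i)) := by
      intro i
      have h0 := hYq (L i)
      rw [IsRoot, eval_map]
      have := congrArg e h0
      rw [aeval_def, map_zero] at this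
      rw [← this]
      have h9 := hom_eval₂ q (algebraMap ℤ (FF f)) (e : FF f →+* ℂ) (y i)
      have h10 : ((e : FF f →+* ℂ).comp (algebraMap ℤ (FF f))) = Int.castRingHom ℂ := RingHom.ext_int _ _
      rw [h10] at h9
      exact h9.symm
    apply eq_of_monic_of_dvd_of_natDegree_le (monic_prod_X_sub_C _ _) (hq.map _)
    · exact Finset.prod_dvd_of_coprime (fun i _ j _ hij => by
        exact isCoprime_X_sub_C_of_isUnit_sub (sub_ne_zero.2 (hinj.ne hij)).isUnit)
        (fun i _ => dvd_iff_isRoot.2 (hroots i))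
    · rw [hq.natDegree_map, hqd, natDegree_prod_of_monic _ _ (fun i _ => monic_X_sub_C _)]
      simp
  · have := map_iz (e : FF f →+* ℂ) y
    rw [hz] at this; simpa using this.symm
  · have := map_iw (e : FF f →+* ℂ) y
    rw [hw] at this; simpa using this.symm
  · have := map_iU (e : FF f →+* ℂ) y
    rw [hU] at this; simpa using this.symm
  · have := map_iV (e : FF f →+* ℂ) y
    rw [hV] at this; simpa using this.symm

open IntermediateField in
lemma caseII_five (W : ℕ) (hW : 1 ≤ W) : SmallP 5 (fun N => {f | f ∈ PBox 5 N ∧ Irreducible f ∧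
      ¬ KH (fQ f).Gal (RR f) 2 ∧ ∃ α : ℂ, aeval α f = 0 ∧
      NoMid ℚ⟮α⟯ ∧ ∃ _ : FiniteDimensional ℚ ℚ⟮α⟯, |discr ℚ⟮α⟯| ≤ (W * N ^ 2 : ℕ)}) := by
  obtain ⟨C0, hC0, hQ⟩ := Q5_card
  exact caseII (n := 5) (by norm_num) (fun f => ¬ KH (fQ f).Gal (RR f) 2) Q5 C0 hC0 W hW hQ
    (fun f q α γ lam _ hP hf hd hirr hα hγ hq hqd _ hqr h4 hr => h5 hP hf hd hirr hα hγ hq hqd hqr h4 hr)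
end ModH5

section ModG1
open Pointwise

section
variable {G R : Type*} [Group G] [Fintype R] [MulAction G R]

lemma KH_of_surj (k : ℕ) (h : Function.Surjective (MulAction.toPermHom G R)) : KH G R k := by
  classical
  intro S T hS hT
  have e : {x // x ∈ S} ≃ {x // x ∈ T} := Fintype.equivOfCardEq (by simp [hS, hT])
  obtain ⟨g, hg⟩ := h e.extendSubtype
  refine ⟨g, ?_⟩
  have h1 : S.image (fun x => g • x) = T := by
    apply Finset.eq_of_subset_of_card_le
    · intro y hy
      obtain ⟨x, hx, rfl⟩ := Finset.mem_image.1 hy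
      have := e.extendSubtype_mem x hx
      rw [← hg] at this
      exact this
    · rw [Finset.card_image_of_injective _ (MulAction.injective g), hS, hT]
  rw [← h1]; simp

lemma KH_compl {k m : ℕ} (hkm : k + m = Fintype.card R) (h : KH G R k) : KH G R m := by
  classical
  intro S T hS hT
  obtain ⟨g, hg⟩ := h Sᶜ Tᶜ (by rw [Finset.card_compl]; omega) (by rw [Finset.card_compl]; omega)
  refine ⟨g, ?_⟩
  rw [Finset.coe_compl, Finset.coe_compl, Set.image_compl_eq (MulAction.bijective g)] at hg
  exact compl_injective hg

lemma KH_one [MulAction.IsPretransitive G R] : KH G R 1 := by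
  intro S T hS hT
  obtain ⟨x, rfl⟩ := Finset.card_eq_one.1 hS
  obtain ⟨y, rfl⟩ := Finset.card_eq_one.1 hT
  obtain ⟨g, hg⟩ := MulAction.exists_smul_eq G x y
  exact ⟨g, by simp [hg]⟩

lemma no_match [MulAction.IsPreprimitive G R] (h4 : 2 < Fintype.card R) (r : R → R → Prop)
    (hs : ∀ x y, r x y → r y x) (hi : ∀ x, ¬ r x x) (inv : ∀ (g : G) x y, r x y → r (g • x) (g • y))
    (x y : R) (hxy : r x y) (hu : ∀ z, r x z → z = y) : False := by
  classical
  have uni : ∀ a b c, r a b → r a c → b = c := by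
    intro a b c hb hc
    obtain ⟨g, hg⟩ := MulAction.exists_smul_eq G a x
    have h1 := hu _ (hg ▸ inv g _ _ hb)
    have h2 := hu _ (hg ▸ inv g _ _ hc)
    exact MulAction.injective g (h1.trans h2.symm)
  have hne : x ≠ y := fun h => hi x (by nth_rw 2 [h]; exact hxy)
  have hB : MulAction.IsBlock G ({x, y} : Set R) := by
    rw [MulAction.isBlock_iff_smul_eq_or_disjoint]
    intro g
    have hg := inv g _ _ hxy
    have e : g • ({x, y} : Set R) = {g • x, g • y} := by
      rw [← Set.image_smul, Set.image_pair]
    rw [e]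
    by_cases h1 : g • x = x
    · left; rw [h1] at hg ⊢; rw [uni _ _ _ hg hxy]
    by_cases h2 : g • x = y
    · left; rw [h2] at hg ⊢; rw [uni _ _ _ hg (hs _ _ hxy), Set.pair_comm]
    by_cases h3 : g • y = x
    · rw [h3] at hg; exact absurd (uni _ _ _ (hs _ _ hg) hxy) h2
    by_cases h4 : g • y = y
    · rw [h4] at hg; exact absurd (uni _ _ _ (hs _ _ hg) (hs _ _ hxy)) h1
    right
    simp [Ne.symm h1, Ne.symm h2, Ne.symm h3, Ne.symm h4]
  rcases MulAction.IsPreprimitive.isTrivialBlock_of_isBlock hB with h | h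
  · exact hne (h (by simp) (by simp))
  · have : (Finset.univ : Finset R) ⊆ {x, y} := by
      intro z _
      have : z ∈ ({x, y} : Set R) := by rw [h]; trivial
      simpa using this
    have := (Finset.card_le_card this).trans (Finset.card_le_two)
    rw [Finset.card_univ] at this
    omega

lemma KH_four [MulAction.IsPreprimitive G R] (h4 : Fintype.card R = 4) : KH G R 2 := by
  classical
  intro S T hS hT
  obtain ⟨a, b, hab, rfl⟩ := Finset.card_eq_two.1 hS
  obtain ⟨c, d, hcd, rfl⟩ := Finset.card_eq_two.1 hT
  set r : R → R → Prop := fun x y => x ≠ y ∧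
    ∃ g : G, (g • a = x ∧ g • b = y) ∨ (g • a = y ∧ g • b = x) with hr
  have rs : ∀ x y, r x y → r y x := fun x y ⟨h, g, hg⟩ => ⟨h.symm, g, hg.symm⟩
  have ri : ∀ (g : G) x y, r x y → r (g • x) (g • y) := by
    rintro g x y ⟨h, k, hk⟩
    refine ⟨(MulAction.injective g).ne h, g * k, ?_⟩
    rcases hk with ⟨rfl, rfl⟩ | ⟨rfl, rfl⟩ <;> simp [mul_smul]
  by_cases hgoal : r c d
  · obtain ⟨_, g, hg⟩ := hgoal
    refine ⟨g, ?_⟩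
    push_cast
    rw [Set.image_pair]
    rcases hg with ⟨rfl, rfl⟩ | ⟨rfl, rfl⟩
    · rfl
    · rw [Set.pair_comm]
  exfalso
  obtain ⟨g, hg⟩ := MulAction.exists_smul_eq G c a
  have hrab : r a b := ⟨hab, 1, Or.inl ⟨one_smul _ _, one_smul _ _⟩⟩
  have hae : a ≠ g • d := by rw [← hg]; exact (MulAction.injective g).ne hcd
  have hnr : ¬ r a (g • d) := by
    intro h
    apply hgoal
    have := ri g⁻¹ _ _ h
    rwa [inv_smul_smul, ← hg, inv_smul_smul] at this
  set e := g • d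
  have hbe : b ≠ e := fun h => hnr (h ▸ hrab)
  have hc1 : ({a, b, e} : Finset R)ᶜ.card = 1 := by
    rw [Finset.card_compl, h4, Finset.card_eq_three.2 ⟨a, b, e, hab, hae, hbe, rfl⟩]
  obtain ⟨t, ht⟩ := Finset.card_eq_one.1 hc1
  have hfour : ∀ z, z = a ∨ z = b ∨ z = e ∨ z = t := by
    intro z
    by_cases hz : z ∈ ({a, b, e} : Finset R)
    · simp at hz; tauto
    · have : z ∈ ({a, b, e} : Finset R)ᶜ := Finset.mem_compl.2 hz
      rw [ht, Finset.mem_singleton] at this; tauto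
  have hi : ∀ x, ¬ r x x := fun x h => h.1 rfl
  by_cases hat : r a t
  · refine no_match (G := G) (by omega) (fun x y => x ≠ y ∧ ¬ r x y) (fun x y h => ⟨h.1.symm, fun h' => h.2 (rs _ _ h')⟩)
      (fun x h => h.1 rfl) (fun g x y h => ⟨(MulAction.injective g).ne h.1, fun h' => h.2 ?_⟩) a e ⟨hae, hnr⟩ ?_
    · have := ri g⁻¹ _ _ h'
      rwa [inv_smul_smul, inv_smul_smul] at this
    · rintro z ⟨h1, h2⟩
      rcases hfour z with rfl | rfl | rfl | rfl
      · exact absurd rfl h1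
      · exact absurd hrab h2
      · rfl
      · exact absurd hat h2
  · refine no_match (G := G) (by omega) r rs hi ri a b hrab ?_
    intro z hz
    rcases hfour z with rfl | rfl | rfl | rfl
    · exact absurd hz (hi _)
    · rfl
    · exact absurd hz hnr
    · exact absurd hz hat
end
end ModG1

section ModZ1
open Polynomial NumberField IntermediateField Polynomial.Gal

attribute [local instance] Polynomial.Gal.splits_ℚ_ℂ

lemma Wn_pos (n : ℕ) : 1 ≤ Wn n := by
  unfold Wn
  refine Nat.one_le_pow _ _ (Finset.prod_pos fun l hl => pow_pos (Finset.mem_filter.1 hl).2.pos _)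

lemma tri {f : ℤ[X]} {n N : ℕ} (hn : 2 ≤ n) (hf : f ∈ PBox n N) (hirr : Irreducible f) {α : ℂ} (hα : aeval α f = 0)
    (hmid : NoMid ℚ⟮α⟯) (hs : ¬ Function.Surjective (galActionHom (fQ f) ℂ)) :
    (∃ S : Finset ℕ, (∀ l ∈ S, l.Prime) ∧ ∏ l ∈ S, l ≤ N ∧ N * ∏ l ∈ S, l ≤ ∏ l ∈ S, l ^ (n - sR l f)) ∨
    (∃ S : Finset ℕ, (∀ l ∈ S, l.Prime ∧ n < l ∧ sR l f + 2 ≤ n) ∧ N < ∏ l ∈ S, l) ∨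
    (∃ _ : FiniteDimensional ℚ ℚ⟮α⟯, |discr ℚ⟮α⟯| ≤ (Wn n * N ^ 2 : ℕ)) := by
  obtain ⟨hm, hd, hb⟩ := hf
  have hfd := fd_of_root hm hα
  have hS : ∀ l ∈ BP ℚ⟮α⟯, l.Prime ∧ n < l ∧ sR l f + 2 ≤ n := by
    intro l hl
    have hl' := Finset.mem_filter.1 hl
    refine ⟨Nat.prime_of_mem_primeFactors hl'.1, ?_, ?_⟩
    · rw [← hd, ← finrank_of_root hm hirr hα]; exact hl'.2
    · by_contra hc
      exact hs (surj_of hm hirr hα hmid (by omega) hl (by omega))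
  have hE := E_bound hm hirr hα
  rw [hd] at hE
  by_cases h3 : N < ∏ l ∈ BP ℚ⟮α⟯, l
  · exact Or.inr (Or.inl ⟨_, hS, h3⟩)
  by_cases h2 : ∏ l ∈ BP ℚ⟮α⟯, l ^ (n - sR l f) ≤ N ^ 2
  · right; right
    refine ⟨hfd, ?_⟩
    rw [Int.abs_eq_natAbs]
    exact_mod_cast hE.trans (Nat.mul_le_mul_left _ h2)
  left
  refine ⟨BP ℚ⟮α⟯, fun l hl => (hS l hl).1, by omega, ?_⟩
  have h4 : (∏ l ∈ BP ℚ⟮α⟯, l) ^ 2 ≤ ∏ l ∈ BP ℚ⟮α⟯, l ^ (n - sR l f) := by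
    rw [← Finset.prod_pow]
    refine Finset.prod_le_prod' fun l hl => Nat.pow_le_pow_right (hS l hl).1.pos ?_
    have := (hS l hl).2.2
    omega
  set P := ∏ l ∈ BP ℚ⟮α⟯, l
  set E := ∏ l ∈ BP ℚ⟮α⟯, l ^ (n - sR l f)
  push Not at h2 h3
  nlinarith

lemma KH_surj {f : ℤ[X]} (k : ℕ) (h : Function.Surjective (galActionHom (fQ f) ℂ)) :
    KH (fQ f).Gal (RR f) k := KH_of_surj k h

/-- the small cases -/
lemma KH_small {f : ℤ[X]} {n k : ℕ} (hk : k = 2 ∨ k = 3) (hkn : k < n) (hn : n ≤ 4)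
    (hf : f.Monic) (hd : f.natDegree = n) (hirr : Irreducible f) {α : ℂ} (hα : aeval α f = 0)
    (hmid : NoMid ℚ⟮α⟯) : KH (fQ f).Gal (RR f) k := by
  have hp := prim hf hirr hα hmid (by omega)
  have hc := card_RR hf hirr
  rw [hd] at hc
  have : MulAction.IsPretransitive (fQ f).Gal (RR f) := galAction_isPretransitive _ _ (irr_Q hf hirr)
  by_cases h : n = 4 ∧ k = 2
  · rw [h.2]; exact KH_four (by omega)
  · exact KH_compl (k := 1) (by omega) KH_one

lemma bad_small {n k : ℕ} (hk : k = 2 ∨ k = 3) (hkn : k < n) : SmallP n (fun N => {f | f ∈ PBox n N ∧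
    ¬ (Irreducible f ∧ KH (fQ f).Gal (RR f) k)}) := by
  have hI := caseI n (by omega)
  have hIII := caseIII n (by omega)
  have base := (red_small n).union (mid_small n)
  have root : ∀ {f : ℤ[X]} {N : ℕ}, f ∈ PBox n N → ∃ α : ℂ, aeval α f = 0 := by
    intro f N hf
    refine IsAlgClosed.exists_aeval_eq_zero_of_injective ℂ (algebraMap ℤ ℂ).injective_int f ?_
    rw [degree_eq_natDegree hf.1.ne_zero, hf.2.1]
    exact_mod_cast (by omega : n ≠ 0)
  rcases Nat.lt_or_ge n 5 with h5 | h5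
  · refine base.mono ?_
    rintro N hN f ⟨hf, hbad⟩
    by_cases hirr : Irreducible f
    swap
    · exact Or.inl ⟨hf, hirr⟩
    right
    obtain ⟨α, hα⟩ := root hf
    refine ⟨hf, hirr, α, hα, fun hmid => hbad ⟨hirr, ?_⟩⟩
    exact KH_small hk hkn (by omega) hf.1 hf.2.1 hirr hα hmid
  have hII : SmallP n (fun N => {f | f ∈ PBox n N ∧ Irreducible f ∧
      ¬ KH (fQ f).Gal (RR f) k ∧ ∃ α : ℂ, aeval α f = 0 ∧
      NoMid ℚ⟮α⟯ ∧ ∃ _ : FiniteDimensional ℚ ℚ⟮α⟯, |discr ℚ⟮α⟯| ≤ (Wn n * N ^ 2 : ℕ)}) := by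
    rcases h5.eq_or_lt with h5 | h5
    · subst h5
      refine (caseII_five (Wn 5) (Wn_pos 5)).mono ?_
      rintro N hN f ⟨hf, hirr, hK, hr⟩
      refine ⟨hf, hirr, fun hK2 => hK ?_, hr⟩
      rcases hk with rfl | rfl
      · exact hK2
      · refine KH_compl (k := 2) ?_ hK2
        rw [card_RR hf.1 hirr, hf.2.1]
    · refine (caseII_six h5 (Wn n) (Wn_pos n)).mono ?_
      rintro N hN f ⟨hf, hirr, hK, hr⟩
      exact ⟨hf, hirr, trivial, hr⟩
  refine (base.union (hI.union (hIII.union hII))).mono ?_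
  rintro N hN f ⟨hf, hbad⟩
  by_cases hirr : Irreducible f
  swap
  · exact Or.inl (Or.inl ⟨hf, hirr⟩)
  obtain ⟨α, hα⟩ := root hf
  by_cases hmid : NoMid ℚ⟮α⟯
  swap
  · exact Or.inl (Or.inr ⟨hf, hirr, α, hα, hmid⟩)
  right
  have hK : ¬ KH (fQ f).Gal (RR f) k := fun h => hbad ⟨hirr, h⟩
  rcases tri (by omega) hf hirr hα hmid (fun h => hK (KH_surj k h)) with h | h | h
  · exact Or.inl ⟨hf, h⟩
  · exact Or.inr (Or.inl ⟨hf, h⟩)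
  · exact Or.inr (Or.inr ⟨hf, hirr, hK, α, hα, hmid, h⟩)
end ModZ1


open Polynomial Polynomial.Gal

attribute [local instance] Polynomial.Gal.splits_ℚ_ℂ

open scoped Classical

/-- For `k ∈ {2, 3}` and `d > k`, the number of monic integer polynomials of degree `d`
with coefficients bounded by `N` whose Galois group is not `k`-homogeneous (acting on
the `d` distinct complex roots) is `O(N ^ (d-1) * (log N) ^ Ω)`. -/
theorem galois_group_k_homogeneous_count (k d : ℕ) (hk : k = 2 ∨ k = 3) (hd : k < d) :
    ∃ C : ℝ, 0 < C ∧ ∃ Ω : ℕ, 0 < Ω ∧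
      ∀ N : ℕ, 2 ≤ N →
        (Set.ncard {p : Polynomial ℤ |
            p.Monic ∧ p.natDegree = d ∧
            (∀ i < d, |p.coeff i| ≤ (N : ℤ)) ∧
            ¬ (Fintype.card ((p.map (Int.castRingHom ℚ)).rootSet ℂ) = d ∧
              ∀ S T : Finset ((p.map (Int.castRingHom ℚ)).rootSet ℂ),
                S.card = k → T.card = k →
                ∃ g : (p.map (Int.castRingHom ℚ)).Gal,
                  (fun x => galActionHom (p.map (Int.castRingHom ℚ)) ℂ g x) ''
                      (S : Set ((p.map (Int.castRingHom ℚ)).rootSet ℂ)) = T)} : ℝ) ≤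
          C * (N : ℝ) ^ (d - 1) * Real.log N ^ Ω := by
  refine (((bad_small hk hd).mono fun N hN => ?_).to_log)
  rintro p ⟨h1, h2, h3, h4⟩
  refine ⟨⟨h1, h2, h3⟩, fun ⟨hirr, hK⟩ => h4 ⟨?_, fun S T hS hT => ?_⟩⟩
  · exact Eq.trans (Fintype.card_congr (Equiv.refl _)) ((card_RR h1 hirr).trans h2)
  · exact hK S T hS hT
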